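/- Let A be an admissible differential operator, let u ∈ L^p(Ω;ℝ^N), and let {u_ε}, {ũ_ε} ⊂ L^p(Ω;ℝ^N) be sequences with εu_ε ⇀ 0 weakly in L^p(Ω;ℝ^N), A ũ_ε = 0 in W^{−1,p}(Ω;ℝ^M), ũ_ε ⇀ u weakly in L^p(Ω;ℝ^N), and u_ε = ũ_ε in Ω_{1,ε}. If sup_ε F_ε(u_ε) ≤ c for some c ≥ −aλℒ^d(Ω), then there exists a sequence {ṽ_ε} ⊂ L^p(Ω;ℝ^N), with {εṽ_ε} p-equiintegrable, such that: ṽ_ε = 0 in Ω_{1,ε}; A ṽ_ε = 0 in W^{−1,p}(Ω;ℝ^M); εṽ_ε ⇀ 0 weakly in L^p(Ω;ℝ^N); and liminf_{ε→0} F_{0,ε}(ṽ_ε) + liminf_{ε→0} F_{1,ε}(ũ_ε) ≤ liminf_{ε→0} F_ε(u_ε). -/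

import Mathlib

open MeasureTheory Filter Topology Metric Set
open scoped ENNReal NNReal

noncomputable section

attribute [local instance] Classical.propDecidable

namespace HC

abbrev Rd (d : ℕ) := Fin d → ℝ
abbrev Vec (N : ℕ) := Fin N → ℝ

/-- Euclidean inner product on `ℝ^N`. -/
def dot {N : ℕ} (u v : Vec N) : ℝ := ∑ j, u j * v j

/-- Euclidean norm on `ℝ^N`. -/
def eN {N : ℕ} (ξ : Vec N) : ℝ := Real.sqrt (∑ j, ξ j ^ 2)

/-- The open unit cube `Q = (0,1)^d`. -/
def Qcube (d : ℕ) : Set (Rd d) := {x | ∀ i, x i ∈ Set.Ioo (0 : ℝ) 1}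

/-- Translation by an integer vector. -/
def tr {d : ℕ} (z : Fin d → ℤ) (x : Rd d) : Rd d := fun i => x i + (z i : ℝ)

/-- The cell `ε (S + z)`. -/
def cell {d : ℕ} (ε : ℝ) (z : Fin d → ℤ) (S : Set (Rd d)) : Set (Rd d) :=
  (fun y : Rd d => fun i => ε * (y i + (z i : ℝ))) '' S

/-- The union of the soft inclusions `Ω_{0,ε}`. -/
def softPart {d : ℕ} (ε : ℝ) (Ω D0 : Set (Rd d)) : Set (Rd d) :=
  ⋃ z ∈ {z : Fin d → ℤ | cell ε z D0 ⊆ Ω}, cell ε z D0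

/-- The stiff matrix `Ω_{1,ε}`. -/
def stiffPart {d : ℕ} (ε : ℝ) (Ω D0 : Set (Rd d)) : Set (Rd d) := Ω \ softPart ε Ω D0

/-- `Ω̂_ε`, the union of the ε-cubes contained in `Ω`. -/
def hatOmega {d : ℕ} (ε : ℝ) (Ω : Set (Rd d)) : Set (Rd d) :=
  ⋃ z ∈ {z : Fin d → ℤ | cell ε z (Qcube d) ⊆ Ω}, cell ε z (Qcube d)

/-- `Q`-periodicity of a map defined on `ℝ^d`. -/
def Zper {d : ℕ} {α : Type*} (u : Rd d → α) : Prop :=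
  ∀ (x : Rd d) (z : Fin d → ℤ), u (tr z x) = u x

/-- A local Lipschitz-graph description of `Ω` near the point `x`:  after an orthogonal
change of coordinates, `Ω` is locally the epigraph of a Lipschitz function. -/
def LipschitzGraphAt {d : ℕ} (Ω : Set (Rd d)) (x : Rd d) : Prop :=
  ∃ (L : Rd d ≃ₗ[ℝ] Rd d) (i : Fin d) (φ : Rd d → ℝ) (K : ℝ≥0) (r : ℝ),
    0 < r ∧ (∀ y z : Rd d, dot (L y) (L z) = dot y z) ∧ LipschitzWith K φ ∧
    (∀ y t, φ (Function.update y i t) = φ y) ∧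
    (∀ y ∈ Metric.ball x r, (y ∈ Ω ↔ φ (L y) < L y i))

/-- `Ω` has Lipschitz boundary. -/
def HasLipschitzBoundary {d : ℕ} (Ω : Set (Rd d)) : Prop :=
  ∀ x ∈ frontier Ω, LipschitzGraphAt Ω x

/-- Compact containment `Ω' ⋐ Ω`. -/
def CpctIn {d : ℕ} (Ω' Ω : Set (Rd d)) : Prop :=
  IsOpen Ω' ∧ IsCompact (closure Ω') ∧ closure Ω' ⊆ Ω

/-- The standing geometric assumptions: `d ≥ 2`, `Ω` bounded connected open Lipschitz,
`D₀ ⋐ Q` open connected Lipschitz. -/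
def GoodSetting (d : ℕ) (Ω D0 : Set (Rd d)) : Prop :=
  2 ≤ d ∧ IsOpen Ω ∧ IsConnected Ω ∧ Bornology.IsBounded Ω ∧ HasLipschitzBoundary Ω ∧
    IsOpen D0 ∧ IsConnected D0 ∧ HasLipschitzBoundary D0 ∧
    IsCompact (closure D0) ∧ closure D0 ⊆ Qcube d

/-! ## First-order constant-coefficient operators -/

/-- The pointwise value of the formal adjoint:
`(𝒜*ψ)(x) = - ∑ i (A^{(i)})^T ∂ψ/∂x_i (x)`. -/
def adjApply {d N M : ℕ} (A : Fin d → (Vec N →ₗ[ℝ] Vec M)) (ψ : Rd d → Vec M)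
    (x : Rd d) : Vec N :=
  fun n => -∑ i, dot (A i (Pi.single n 1)) (fderiv ℝ ψ x (Pi.single i 1))

/-- Smooth test functions compactly supported in `O`. -/
def TestOn {d M : ℕ} (O : Set (Rd d)) (ψ : Rd d → Vec M) : Prop :=
  ContDiff ℝ (⊤ : ℕ∞) ψ ∧ HasCompactSupport ψ ∧ tsupport ψ ⊆ O

/-- `𝒜 u = 0` in `W^{-1,p}(O)`, i.e. distributionally on `O`. -/
def AFreeOn {d N M : ℕ} (A : Fin d → (Vec N →ₗ[ℝ] Vec M)) (O : Set (Rd d))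
    (u : Rd d → Vec N) : Prop :=
  ∀ ψ : Rd d → Vec M, TestOn O ψ → ∫ x in O, dot (u x) (adjApply A ψ x) = 0

/-- `𝒜 u = 0` on the torus `𝕋^d` (with `Q`-periodic test functions). -/
def AFreeTorus {d N M : ℕ} (A : Fin d → (Vec N →ₗ[ℝ] Vec M)) (u : Rd d → Vec N) : Prop :=
  ∀ ψ : Rd d → Vec M, ContDiff ℝ (⊤ : ℕ∞) ψ → Zper ψ →
    ∫ x in Qcube d, dot (u x) (adjApply A ψ x) = 0

/-- The symbol `𝔸[ω] = ∑ i ω_i A^{(i)}`. -/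
def symb {d N M : ℕ} (A : Fin d → (Vec N →ₗ[ℝ] Vec M)) (ω : Rd d) : Vec N →ₗ[ℝ] Vec M :=
  ∑ i, ω i • A i

/-- Murat's constant rank condition. -/
def ConstantRank {d N M : ℕ} (A : Fin d → (Vec N →ₗ[ℝ] Vec M)) : Prop :=
  ∃ r : ℕ, ∀ ω : Rd d, ω ≠ 0 → Module.finrank ℝ (LinearMap.range (symb A ω)) = r

/-! ## Lp spaces and convergences -/

def MemLpOn {d N : ℕ} (p : ℝ) (O : Set (Rd d)) (u : Rd d → Vec N) : Prop :=
  MemLp u (ENNReal.ofReal p) (volume.restrict O)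

def LpNormOn {d N : ℕ} (p : ℝ) (O : Set (Rd d)) (u : Rd d → Vec N) : ℝ :=
  (eLpNorm (fun x => eN (u x)) (ENNReal.ofReal p) (volume.restrict O)).toReal

/-- The conjugate exponent `p' = p/(p-1)`. -/
def conjExp (p : ℝ) : ℝ := p / (p - 1)

/-- Weak convergence in `L^p(O; ℝ^N)` of a family along a filter. -/
def WeakLpTendsto {d N : ℕ} (p : ℝ) (O : Set (Rd d)) {ι : Type*} (l : Filter ι)
    (u : ι → Rd d → Vec N) (v : Rd d → Vec N) : Prop :=
  ∀ g : Rd d → Vec N, MemLpOn (conjExp p) O g →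
    Tendsto (fun k => ∫ x in O, dot (u k x) (g x)) l (𝓝 (∫ x in O, dot (v x) (g x)))

/-- `p`-equiintegrability of a family in `L^p(O)`. -/
def PEquiintegrable {d N : ℕ} (p : ℝ) (O : Set (Rd d)) {ι : Type*}
    (u : ι → Rd d → Vec N) : Prop :=
  ∀ η : ℝ, 0 < η → ∃ m : ℝ, 0 < m ∧ ∀ (k : ι) (E : Set (Rd d)), MeasurableSet E → E ⊆ O →
    volume E < ENNReal.ofReal m → ∫ x in E, eN (u k x) ^ p < η

/-- Membership in `L^p(Ω × Q; ℝ^N)`. -/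
def MemLpProd {d N : ℕ} (p : ℝ) (Ω : Set (Rd d)) (v : Rd d → Rd d → Vec N) : Prop :=
  MemLp (fun q : Rd d × Rd d => v q.1 q.2) (ENNReal.ofReal p)
    ((volume.restrict Ω).prod (volume.restrict (Qcube d)))

def LpNormProd {d N : ℕ} (p : ℝ) (Ω : Set (Rd d)) (v : Rd d → Rd d → Vec N) : ℝ :=
  (eLpNorm (fun q : Rd d × Rd d => eN (v q.1 q.2)) (ENNReal.ofReal p)
    ((volume.restrict Ω).prod (volume.restrict (Qcube d)))).toReal

/-- `p`-equiintegrability of a family in `L^p(Ω × Q)`. -/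
def PEquiintegrableProd {d N : ℕ} (p : ℝ) (Ω : Set (Rd d)) {ι : Type*}
    (w : ι → Rd d → Rd d → Vec N) : Prop :=
  ∀ η : ℝ, 0 < η → ∃ m : ℝ, 0 < m ∧ ∀ (k : ι) (E : Set (Rd d × Rd d)), MeasurableSet E →
    ((volume.restrict Ω).prod (volume.restrict (Qcube d))) E < ENNReal.ofReal m →
    ∫ q in E, eN (w k q.1 q.2) ^ p
        ∂((volume.restrict Ω).prod (volume.restrict (Qcube d))) < η

/-! ## Two-scale convergence and unfolding -/

/-- `x ↦ sup_{y ∈ Q̄} |g(x,y)|`. -/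
def perSup {d N : ℕ} (g : Rd d → Rd d → Vec N) (x : Rd d) : ℝ :=
  sSup ((fun y => eN (g x y)) '' closure (Qcube d))

/-- Test functions for two-scale convergence: elements of `L^{p'}(Ω; C_per(ℝ^d;ℝ^N))`. -/
def TwoScaleTest {d N : ℕ} (p : ℝ) (Ω : Set (Rd d)) (g : Rd d → Rd d → Vec N) : Prop :=
  (∀ x, Continuous (g x)) ∧ (∀ x, Zper (g x)) ∧
    MemLp (perSup g) (ENNReal.ofReal (conjExp p)) (volume.restrict Ω)

/-- Weak two-scale convergence in `L^p`, along a filter `l` with scales `η`. -/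
def WeakTwoScale {d N : ℕ} (p : ℝ) (Ω : Set (Rd d)) {ι : Type*} (l : Filter ι) (η : ι → ℝ)
    (u : ι → Rd d → Vec N) (v : Rd d → Rd d → Vec N) : Prop :=
  ∀ g : Rd d → Rd d → Vec N, TwoScaleTest p Ω g →
    Tendsto (fun k => ∫ x in Ω, dot (u k x) (g x ((η k)⁻¹ • x))) l
      (𝓝 (∫ x in Ω, ∫ y in Qcube d, dot (v x y) (g x y)))

/-- Strong two-scale convergence in `L^p`. -/
def StrongTwoScale {d N : ℕ} (p : ℝ) (Ω : Set (Rd d)) {ι : Type*} (l : Filter ι) (η : ι → ℝ)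
    (u : ι → Rd d → Vec N) (v : Rd d → Rd d → Vec N) : Prop :=
  WeakTwoScale p Ω l η u v ∧ Tendsto (fun k => LpNormOn p Ω (u k)) l (𝓝 (LpNormProd p Ω v))

/-- The unfolding operator `S_ε v (x,y) = ṽ(ε⌊x/ε⌋ + εy)`, where `ṽ` is the extension of `v`
by `0` outside `Ω`. -/
def unfold {d N : ℕ} (ε : ℝ) (Ω : Set (Rd d)) (v : Rd d → Vec N) :
    Rd d → Rd d → Vec N :=
  fun x y => Set.indicator Ω v (fun i => ε * ((⌊x i / ε⌋ : ℝ) + y i))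

/-! ## The energy densities and their hypotheses -/

def H1soft {N : ℕ} (f0 : ℝ → Vec N → ℝ) : Prop := ∀ ε : ℝ, 0 < ε → Continuous (f0 ε)

def H1stiff {d N : ℕ} (f1 : Rd d → Vec N → ℝ) : Prop :=
  (∀ ξ, Measurable fun x => f1 x ξ) ∧ ∀ x, Continuous (f1 x)

def H2 {d N : ℕ} (f1 : Rd d → Vec N → ℝ) : Prop :=
  ∀ (x : Rd d) (z : Fin d → ℤ) (ξ : Vec N), f1 (tr z x) ξ = f1 x ξ

def H3soft {N : ℕ} (p a lam Lam : ℝ) (f0 : ℝ → Vec N → ℝ) : Prop :=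
  0 < a ∧ 0 < lam ∧ 0 < Lam ∧
    ∀ ε : ℝ, 0 < ε → ∀ ξ, lam * (-a + eN ξ ^ p) ≤ f0 ε ξ ∧ f0 ε ξ ≤ Lam * (1 + eN ξ ^ p)

def H3stiff {d N : ℕ} (p a lam Lam : ℝ) (f1 : Rd d → Vec N → ℝ) : Prop :=
  0 < a ∧ 0 < lam ∧ 0 < Lam ∧
    ∀ (x : Rd d) (ξ : Vec N), lam * (-a + eN ξ ^ p) ≤ f1 x ξ ∧ f1 x ξ ≤ Lam * (1 + eN ξ ^ p)

def H4soft {N : ℕ} (p mu : ℝ) (f0 : ℝ → Vec N → ℝ) : Prop :=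
  0 < mu ∧ ∀ ε : ℝ, 0 < ε → ∀ ξ ζ : Vec N,
    |f0 ε ξ - f0 ε ζ| ≤ mu * (1 + eN ξ ^ (p - 1) + eN ζ ^ (p - 1)) * eN (ξ - ζ)

def H4stiff {d N : ℕ} (p mu : ℝ) (f1 : Rd d → Vec N → ℝ) : Prop :=
  0 < mu ∧ ∀ (x : Rd d) (ξ ζ : Vec N),
    |f1 x ξ - f1 x ζ| ≤ mu * (1 + eN ξ ^ (p - 1) + eN ζ ^ (p - 1)) * eN (ξ - ζ)

def H5 {N : ℕ} (f0 : ℝ → Vec N → ℝ) (f0lim : Vec N → ℝ) : Prop :=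
  ∀ ξ, Tendsto (fun ε => f0 ε ξ) (𝓝[>] (0 : ℝ)) (𝓝 (f0lim ξ))

/-! ## The admissible class: Assumptions 1 and 2 -/

/-- Assumption 1 (null average). -/
def NullAverage {d N M : ℕ} (p : ℝ) (A : Fin d → (Vec N →ₗ[ℝ] Vec M))
    (D0 : Set (Rd d)) : Prop :=
  ∀ u : Rd d → Vec N, MemLp u (ENNReal.ofReal p) (volume.restrict (Qcube d)) → Zper u →
    (∀ᵐ y ∂volume.restrict (Qcube d \ D0), u y = 0) → AFreeTorus A u →
    (∫ y in Qcube d, u y) = 0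

/-- Assumption 2 (`𝒜`-free extension operators on the perforated domains). -/
def ExtensionProperty {d N M : ℕ} (p : ℝ) (A : Fin d → (Vec N →ₗ[ℝ] Vec M))
    (Ω D0 : Set (Rd d)) (c : ℝ) (E : ℝ → (Rd d → Vec N) → (Rd d → Vec N)) : Prop :=
  0 < c ∧
  (∀ ε : ℝ, 0 < ε → ∀ u : Rd d → Vec N, MemLpOn p Ω u → AFreeOn A Ω u →
    (∀ᵐ x ∂volume.restrict (stiffPart ε Ω D0), E ε u x = u x) ∧
    MemLpOn p Ω (E ε u) ∧
    LpNormOn p Ω (E ε u) ≤ c * LpNormOn p (stiffPart ε Ω D0) u ∧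
    AFreeOn A Ω (E ε u)) ∧
  (∀ u : ℝ → Rd d → Vec N, (∀ ε : ℝ, 0 < ε → MemLpOn p Ω (u ε) ∧ AFreeOn A Ω (u ε)) →
    PEquiintegrable p Ω (fun ε : {ε : ℝ // 0 < ε} => u ε.1) →
    PEquiintegrable p Ω (fun ε : {ε : ℝ // 0 < ε} => E ε.1 (u ε.1)))

/-- An admissible operator: constant rank together with Assumptions 1 and 2. -/
def Admissible {d N M : ℕ} (p : ℝ) (A : Fin d → (Vec N →ₗ[ℝ] Vec M))
    (Ω D0 : Set (Rd d)) : Prop :=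
  ConstantRank A ∧ NullAverage p A D0 ∧ ∃ c E, ExtensionProperty p A Ω D0 c E

/-! ## High-contrast convergence -/

/-- High-contrast convergence of a family `u` (with scales `η`) to `v`. -/
def HCTendsto {d N M : ℕ} (p : ℝ) (A : Fin d → (Vec N →ₗ[ℝ] Vec M)) (Ω D0 : Set (Rd d))
    {ι : Type*} (l : Filter ι) (η : ι → ℝ) (u : ι → Rd d → Vec N) (v : Rd d → Vec N) : Prop :=
  WeakLpTendsto p Ω l (fun k x => η k • u k x) 0 ∧
  ∃ ut : ι → Rd d → Vec N,
    (∀ k, MemLpOn p Ω (ut k) ∧ AFreeOn A Ω (ut k)) ∧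
    (∀ k, ∀ᵐ x ∂volume.restrict (stiffPart (η k) Ω D0), u k x = ut k x) ∧
    WeakLpTendsto p Ω l ut v

/-! ## The functionals -/

def U1 {d N M : ℕ} (p : ℝ) (A : Fin d → (Vec N →ₗ[ℝ] Vec M)) (Ω : Set (Rd d)) :
    Set (Rd d → Vec N) :=
  {u | MemLpOn p Ω u ∧ AFreeOn A Ω u}

def U0 {d N M : ℕ} (p : ℝ) (A : Fin d → (Vec N →ₗ[ℝ] Vec M)) (Ω D0 Ω' : Set (Rd d)) :
    Set (Rd d → Rd d → Vec N) :=
  {u | MemLpProd p Ω u ∧ (∀ x, Zper (u x)) ∧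
    (∀ x, ∀ᵐ y ∂volume.restrict (Qcube d \ D0), u x y = 0) ∧
    (∀ᵐ x ∂volume.restrict Ω', AFreeTorus A (u x))}

/-- The constant `α₀`. -/
def alpha0 {d N M : ℕ} (p : ℝ) (A : Fin d → (Vec N →ₗ[ℝ] Vec M)) (Ω D0 : Set (Rd d))
    (f0lim : Vec N → ℝ) : ℝ :=
  sSup {c : ℝ | ∃ Ω' : Set (Rd d), CpctIn Ω' Ω ∧
    c = sInf {e : ℝ | ∃ u ∈ U0 p A Ω D0 Ω', e = ∫ x in Ω', ∫ y in D0, f0lim (u x y)}}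

/-- The `ℤ^d`-periodization of `D₁ = Q ∖ D₀`. -/
def D1per {d : ℕ} (D0 : Set (Rd d)) : Set (Rd d) :=
  ⋃ z : Fin d → ℤ, tr z '' (Qcube d \ D0)

/-- The homogenized stiff energy density `f_hom`. -/
def fhom {d N M : ℕ} (p : ℝ) (A : Fin d → (Vec N →ₗ[ℝ] Vec M)) (D0 : Set (Rd d))
    (f1 : Rd d → Vec N → ℝ) (ξ : Vec N) : ℝ :=
  liminf (fun k : ℕ =>
    sInf {c : ℝ | ∃ v : Rd d → Vec N,
      MemLp v (ENNReal.ofReal p) (volume.restrict (Qcube d)) ∧ Zper v ∧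
      (∫ y in Qcube d, v y) = 0 ∧ AFreeTorus A v ∧
      c = ∫ y in Qcube d ∩ {y | (k : ℝ) • y ∈ D1per D0}, f1 ((k : ℝ) • y) (ξ + v y)}) atTop

/-- The high-contrast energy `F_ε`. -/
def Feps {d N M : ℕ} (p : ℝ) (A : Fin d → (Vec N →ₗ[ℝ] Vec M)) (Ω D0 : Set (Rd d))
    (f0 : ℝ → Vec N → ℝ) (f1 : Rd d → Vec N → ℝ) (ε : ℝ) (u : Rd d → Vec N) : EReal :=
  if u ∈ U1 p A Ω then
    (((∫ x in softPart ε Ω D0, f0 ε (ε • u x)) +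
      ∫ x in stiffPart ε Ω D0, f1 (ε⁻¹ • x) (u x) : ℝ) : EReal)
  else ⊤

/-- The soft energy `F_{0,ε}`. -/
def F0eps {d N M : ℕ} (p : ℝ) (A : Fin d → (Vec N →ₗ[ℝ] Vec M)) (Ω D0 : Set (Rd d))
    (f0 : ℝ → Vec N → ℝ) (ε : ℝ) (u : Rd d → Vec N) : EReal :=
  if u ∈ U1 p A Ω then ((∫ x in softPart ε Ω D0, f0 ε (ε • u x) : ℝ) : EReal) else ⊤

/-- The stiff energy `F_{1,ε}`. -/
def F1eps {d N M : ℕ} (p : ℝ) (A : Fin d → (Vec N →ₗ[ℝ] Vec M)) (Ω D0 : Set (Rd d))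
    (f1 : Rd d → Vec N → ℝ) (ε : ℝ) (u : Rd d → Vec N) : EReal :=
  if u ∈ U1 p A Ω then ((∫ x in stiffPart ε Ω D0, f1 (ε⁻¹ • x) (u x) : ℝ) : EReal) else ⊤

/-- The limiting functional `F = α₀ + ∫_Ω f_hom(u)`. -/
def Flim {d N M : ℕ} (p : ℝ) (A : Fin d → (Vec N →ₗ[ℝ] Vec M)) (Ω D0 : Set (Rd d))
    (f0lim : Vec N → ℝ) (f1 : Rd d → Vec N → ℝ) (u : Rd d → Vec N) : EReal :=
  if u ∈ U1 p A Ω then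
    ((alpha0 p A Ω D0 f0lim + ∫ x in Ω, fhom p A D0 f1 (u x) : ℝ) : EReal)
  else ⊤

/-- The limiting soft functional `F₀`. -/
def F0lim {d N M : ℕ} (p : ℝ) (A : Fin d → (Vec N →ₗ[ℝ] Vec M)) (Ω D0 : Set (Rd d))
    (f0lim : Vec N → ℝ) (u : Rd d → Vec N) : EReal :=
  if u =ᵐ[volume.restrict Ω] (0 : Rd d → Vec N) then ((alpha0 p A Ω D0 f0lim : ℝ) : EReal)
  else ⊤

/-- The limiting stiff functional `F₁`. -/
def F1lim {d N M : ℕ} (p : ℝ) (A : Fin d → (Vec N →ₗ[ℝ] Vec M)) (Ω D0 : Set (Rd d))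
    (f1 : Rd d → Vec N → ℝ) (u : Rd d → Vec N) : EReal :=
  if u ∈ U1 p A Ω then ((∫ x in Ω, fhom p A D0 f1 (u x) : ℝ) : EReal) else ⊤

/-! ## Higher-order operators, potentials, Sobolev spaces -/

/-- The pointwise value of the formal adjoint of the `k`-th order homogeneous operator
with coefficients `A`. -/
def adjOp {d k N M : ℕ} (A : (Fin k → Fin d) → (Vec N →ₗ[ℝ] Vec M)) (ψ : Rd d → Vec M)
    (x : Rd d) : Vec N :=
  fun n => (-1 : ℝ) ^ k * ∑ j : Fin k → Fin d,
    dot (A j (Pi.single n 1)) (iteratedFDeriv ℝ k ψ x (fun t => Pi.single (j t) 1))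

/-- `𝒜 u = 0` in `W^{-k,p}(O)` for a `k`-th order operator. -/
def AFreeOnK {d k N M : ℕ} (A : (Fin k → Fin d) → (Vec N →ₗ[ℝ] Vec M)) (O : Set (Rd d))
    (u : Rd d → Vec N) : Prop :=
  ∀ ψ : Rd d → Vec M, TestOn O ψ → ∫ x in O, dot (u x) (adjOp A ψ x) = 0

/-- The symbol of a `k`-th order homogeneous operator. -/
def symbK {d k N M : ℕ} (A : (Fin k → Fin d) → (Vec N →ₗ[ℝ] Vec M)) (ω : Rd d) :
    Vec N →ₗ[ℝ] Vec M :=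
  ∑ j : Fin k → Fin d, (∏ t, ω (j t)) • A j

def ConstantRankK {d k N M : ℕ} (A : (Fin k → Fin d) → (Vec N →ₗ[ℝ] Vec M)) : Prop :=
  ∃ r : ℕ, ∀ ω : Rd d, ω ≠ 0 → Module.finrank ℝ (LinearMap.range (symbK A ω)) = r

/-- `g` is the weak partial derivative `∂_j w` (for the `m`-tuple `j` of directions) on `U`. -/
def IsWeakDerivOn {d m M : ℕ} (U : Set (Rd d)) (j : Fin m → Fin d) (w g : Rd d → Vec M) :
    Prop :=
  ∀ φ : Rd d → ℝ, ContDiff ℝ (⊤ : ℕ∞) φ → HasCompactSupport φ → tsupport φ ⊆ U →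
    ∀ cc : Fin M, (∫ x in U, w x cc * iteratedFDeriv ℝ m φ x (fun t => Pi.single (j t) 1))
      = (-1 : ℝ) ^ m * ∫ x in U, g x cc * φ x

/-- Membership in the Sobolev space `W^{ℓ,p}(U; ℝ^M)`. -/
def MemW {d M : ℕ} (ℓ : ℕ) (p : ℝ) (U : Set (Rd d)) (w : Rd d → Vec M) : Prop :=
  MemLpOn p U w ∧ ∀ m : ℕ, m ≤ ℓ → ∀ j : Fin m → Fin d,
    ∃ g : Rd d → Vec M, MemLpOn p U g ∧ IsWeakDerivOn U j w g

/-- A choice of the weak derivative `∂_j w` on `U` (defaults to `0`). -/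
def wDeriv {d m M : ℕ} (p : ℝ) (U : Set (Rd d)) (j : Fin m → Fin d) (w : Rd d → Vec M) :
    Rd d → Vec M :=
  if h : ∃ g : Rd d → Vec M, MemLpOn p U g ∧ IsWeakDerivOn U j w g then h.choose else 0

/-- The `L^p(U)` norm of the `ℓ`-th order (weak) gradient `∇^ℓ w`. -/
def gradLp {d M : ℕ} (ℓ : ℕ) (p : ℝ) (U : Set (Rd d)) (w : Rd d → Vec M) : ℝ :=
  (eLpNorm (fun x => Real.sqrt (∑ j : Fin ℓ → Fin d, eN (wDeriv p U j w x) ^ 2))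
    (ENNReal.ofReal p) (volume.restrict U)).toReal

/-- The action `ℬ w = ∑_{|j|=ℓ} B^{(j)} ∂_j w` of an `ℓ`-th order operator on a Sobolev
function, through its weak derivatives. -/
def opApplyW {d ℓ M N : ℕ} (p : ℝ) (U : Set (Rd d))
    (B : (Fin ℓ → Fin d) → (Vec M →ₗ[ℝ] Vec N)) (w : Rd d → Vec M) : Rd d → Vec N :=
  fun x => ∑ j : Fin ℓ → Fin d, B j (wDeriv p U j w x)

/-- `U` is an `𝒜`-extension domain (for a `k`-th order operator `𝒜`). -/
def AExtensionDomainK {d k N M : ℕ} (p : ℝ) (A : (Fin k → Fin d) → (Vec N →ₗ[ℝ] Vec M))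
    (U : Set (Rd d)) : Prop :=
  ∃ (E : (Rd d → Vec N) → (Rd d → Vec N)) (c : ℝ), 0 < c ∧
    ∀ u : Rd d → Vec N, MemLpOn p U u → AFreeOnK A U u →
      (∀ᵐ x ∂volume.restrict U, E u x = u x) ∧
      MemLp (E u) (ENNReal.ofReal p) volume ∧
      LpNormOn p Set.univ (E u) ≤ c * LpNormOn p U u ∧
      AFreeOnK A Set.univ (E u)

/-- `U` is an `𝒜`-extension domain (first-order version). -/
def AExtensionDomain1 {d N M : ℕ} (p : ℝ) (A : Fin d → (Vec N →ₗ[ℝ] Vec M))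
    (U : Set (Rd d)) : Prop :=
  ∃ (E : (Rd d → Vec N) → (Rd d → Vec N)) (c : ℝ), 0 < c ∧
    ∀ u : Rd d → Vec N, MemLpOn p U u → AFreeOn A U u →
      (∀ᵐ x ∂volume.restrict U, E u x = u x) ∧
      MemLp (E u) (ENNReal.ofReal p) volume ∧
      LpNormOn p Set.univ (E u) ≤ c * LpNormOn p U u ∧
      AFreeOn A Set.univ (E u)

/-- The `W^{m,q}(ℝ^d)` norm of a smooth function. -/
def WmNorm {d M : ℕ} (m : ℕ) (q : ℝ) (ψ : Rd d → Vec M) : ℝ :=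
  ∑ j ∈ Finset.range (m + 1),
    (eLpNorm (fun x => ‖iteratedFDeriv ℝ j ψ x‖) (ENNReal.ofReal q) volume).toReal

/-- The `W^{-m,p}(ℝ^d)` norm of `𝒜 u`, via duality with `W^{m,p'}`. -/
def negNorm {d k N M : ℕ} (m : ℕ) (p : ℝ) (A : (Fin k → Fin d) → (Vec N →ₗ[ℝ] Vec M))
    (u : Rd d → Vec N) : ℝ :=
  sSup {c : ℝ | ∃ ψ : Rd d → Vec M, ContDiff ℝ (⊤ : ℕ∞) ψ ∧ HasCompactSupport ψ ∧
    WmNorm m (conjExp p) ψ ≤ 1 ∧ c = ∫ x, dot (u x) (adjOp A ψ x)}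

/-! ## Fourier-analytic material -/

/-- Fourier transform of a (complexified, vector-valued) function. -/
def ftC {d N : ℕ} (f : Rd d → (Fin N → ℂ)) (ω : Rd d) : Fin N → ℂ :=
  ∫ x : Rd d, Complex.exp (-(2 * Real.pi * Complex.I) * (∑ i, (x i : ℂ) * (ω i : ℂ))) • f x

/-- Complexification of a real vector-valued map. -/
def cplx {d N : ℕ} (u : Rd d → Vec N) : Rd d → (Fin N → ℂ) := fun x n => ((u x n : ℝ) : ℂ)

/-- Action on `ℂ^N` of (the complexification of) a real linear map on `ℝ^N`. -/
def matC {N : ℕ} (P : Vec N →ₗ[ℝ] Vec N) (v : Fin N → ℂ) : Fin N → ℂ :=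
  fun m => ∑ n, ((P (Pi.single n 1) m : ℝ) : ℂ) * v n

end HC

namespace HC

/-- dyadic index of a point at generation `n`. -/
def didx {d : ℕ} (n : ℤ) (x : Rd d) : Fin d → ℤ := fun i => ⌊(2 : ℝ) ^ n * x i⌋

/-- dyadic cubes -/
def dc {d : ℕ} (n : ℤ) (z : Fin d → ℤ) : Set (Rd d) := {x | didx n x = z}

/-- centre of a dyadic cube -/
def dcen {d : ℕ} (n : ℤ) (z : Fin d → ℤ) : Rd d := fun i => ((z i : ℝ) + 1 / 2) * (2 : ℝ) ^ (-n)

lemma dc_eq_pi {d : ℕ} (n : ℤ) (z : Fin d → ℤ) :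
    (dc n z : Set (Rd d)) = Set.pi Set.univ
      (fun i => Set.Ico ((z i : ℝ) * (2 : ℝ) ^ (-n)) (((z i : ℝ) + 1) * (2 : ℝ) ^ (-n))) := by
  ext x
  have h2 : (0 : ℝ) < (2 : ℝ) ^ n := by positivity
  simp only [dc, didx, Set.mem_setOf_eq, Set.mem_pi, Set.mem_univ, true_implies, Set.mem_Ico,
    funext_iff, Int.floor_eq_iff, zpow_neg]
  refine forall_congr' fun i => ?_
  rw [← div_eq_mul_inv, ← div_eq_mul_inv, div_le_iff₀ h2, lt_div_iff₀ h2, mul_comm (x i)]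

lemma measurableSet_dc {d : ℕ} (n : ℤ) (z : Fin d → ℤ) : MeasurableSet (dc n z : Set (Rd d)) := by
  rw [dc_eq_pi]
  exact MeasurableSet.univ_pi fun i => measurableSet_Ico

lemma volume_dc {d : ℕ} (n : ℤ) (z : Fin d → ℤ) :
    volume (dc n z : Set (Rd d)) = ENNReal.ofReal (((2 : ℝ) ^ (-n)) ^ d) := by
  rw [dc_eq_pi, Real.volume_pi_Ico]
  simp only [add_mul, one_mul, add_sub_cancel_left, Finset.prod_const, Finset.card_univ,
    Fintype.card_fin]
  rw [ENNReal.ofReal_pow (by positivity)]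

lemma dc_subset_closedBall {d : ℕ} (n : ℤ) (z : Fin d → ℤ) :
    (dc n z : Set (Rd d)) ⊆ closedBall (dcen n z) ((2 : ℝ) ^ (-n) / 2) := by
  intro x hx
  rw [dc_eq_pi] at hx
  have h2 : (0 : ℝ) < (2 : ℝ) ^ (-n) := by positivity
  rw [mem_closedBall, dist_pi_le_iff (by positivity)]
  intro i
  have := hx i (Set.mem_univ i)
  rw [Set.mem_Ico] at this
  rw [Real.dist_eq, abs_le, dcen]
  constructor <;> nlinarith [this.1, this.2]

lemma volume_cb {d : ℕ} (n : ℤ) (z : Fin d → ℤ) :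
    volume (closedBall (dcen n z : Rd d) ((2 : ℝ) ^ (-n) / 2)) =
      ENNReal.ofReal (((2 : ℝ) ^ (-n)) ^ d) := by
  rw [Real.volume_pi_closedBall _ (by positivity)]
  simp only [Fintype.card_fin]
  congr 2; ring

lemma dc_ae_eq {d : ℕ} (n : ℤ) (z : Fin d → ℤ) :
    (dc n z : Set (Rd d)) =ᵐ[volume] closedBall (dcen n z) ((2 : ℝ) ^ (-n) / 2) := by
  refine ae_eq_of_subset_of_measure_ge (dc_subset_closedBall n z) ?_
    (measurableSet_dc n z).nullMeasurableSet ?_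
  · rw [volume_cb, volume_dc]
  · rw [volume_cb]; exact ENNReal.ofReal_ne_top

lemma didx_succ {d : ℕ} (n : ℤ) (x y : Rd d) (h : didx n x = didx n y) :
    didx (n - 1) x = didx (n - 1) y := by
  funext i
  have hi := congrFun h i
  simp only [didx] at hi ⊢
  have key : ∀ t : ℝ, (2 : ℝ) ^ (n - 1) * t = ((2 : ℝ) ^ n * t) / ((2 : ℕ) : ℝ) := by
    intro t
    rw [zpow_sub_one₀ (by norm_num)]; push_cast; ring
  rw [key, key, Int.floor_div_natCast, Int.floor_div_natCast, hi]

lemma didx_mono {d : ℕ} (n : ℤ) (k : ℕ) (x y : Rd d) (h : didx n x = didx n y) :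
    didx (n - k) x = didx (n - k) y := by
  induction k with
  | zero => simpa using h
  | succ k ih =>
    have := didx_succ _ x y ih
    push_cast
    rwa [← sub_sub]

lemma didx_mono' {d : ℕ} {m n : ℤ} (hmn : m ≤ n) (x y : Rd d) (h : didx n x = didx n y) :
    didx m x = didx m y := by
  obtain ⟨k, hk⟩ := Int.le.dest hmn
  have := didx_mono n k x y h
  have e : n - (k : ℤ) = m := by omega
  rwa [e] at this

/-- the stopping predicate: large average -/
def bigAv {d : ℕ} (f : Rd d → ℝ) (l : ℝ) (n : ℤ) (z : Fin d → ℤ) : Prop :=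
  ENNReal.ofReal l * volume (dc n z : Set (Rd d)) < ∫⁻ x in dc n z, ‖f x‖ₑ

/-- selected points of generation n -/
def selPt {d : ℕ} (f : Rd d → ℝ) (l : ℝ) (n : ℤ) (x : Rd d) : Prop :=
  bigAv f l n (didx n x) ∧ ∀ m < n, ¬ bigAv f l m (didx m x)

/-- selected cubes, empty if not selected -/
def selCube {d : ℕ} (f : Rd d → ℝ) (l : ℝ) (q : ℤ × (Fin d → ℤ)) : Set (Rd d) :=
  {x | x ∈ dc q.1 q.2 ∧ selPt f l q.1 x}

lemma selPt_congr {d : ℕ} (f : Rd d → ℝ) (l : ℝ) (n : ℤ) (x y : Rd d) (h : didx n x = didx n y) :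
    selPt f l n x ↔ selPt f l n y := by
  unfold selPt
  rw [h]
  have : ∀ m < n, didx m x = didx m y := fun m hm => didx_mono' hm.le x y h
  constructor
  · rintro ⟨h1, h2⟩
    exact ⟨h1, fun m hm => by rw [← this m hm]; exact h2 m hm⟩
  · rintro ⟨h1, h2⟩
    exact ⟨h1, fun m hm => by rw [this m hm]; exact h2 m hm⟩

lemma selCube_dich {d : ℕ} (f : Rd d → ℝ) (l : ℝ) (q : ℤ × (Fin d → ℤ)) :
    selCube f l q = ∅ ∨ (selCube f l q = dc q.1 q.2 ∧ bigAv f l q.1 q.2 ∧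
      ∃ z', dc q.1 q.2 ⊆ (dc (q.1 - 1) z' : Set (Rd d)) ∧ ¬ bigAv f l (q.1 - 1) z') := by
  rcases Set.eq_empty_or_nonempty (selCube f l q) with h | ⟨x, hx⟩
  · exact Or.inl h
  · right
    have hxz : didx q.1 x = q.2 := hx.1
    refine ⟨?_, ?_, didx (q.1 - 1) x, ?_, ?_⟩
    · ext y
      constructor
      · exact fun hy => hy.1
      · intro hy
        refine ⟨hy, ?_⟩
        rw [selPt_congr f l q.1 y x (by rw [hxz]; exact hy)]
        exact hx.2
    · have := hx.2.1; rwa [hxz] at this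
    · intro y hy
      exact didx_succ q.1 y x (by rw [hxz]; exact hy)
    · exact hx.2.2 _ (by omega)

lemma selCube_disjoint {d : ℕ} (f : Rd d → ℝ) (l : ℝ) :
    Pairwise (Function.onFun Disjoint (selCube f l : ℤ × (Fin d → ℤ) → Set (Rd d))) := by
  rintro ⟨n, z⟩ ⟨m, y⟩ hne
  rw [Function.onFun, Set.disjoint_left]
  rintro x ⟨hx1, hx2⟩ ⟨hy1, hy2⟩
  apply hne
  have hnm : n = m := by
    rcases lt_trichotomy n m with h | h | h
    · exact absurd hx2.1 (hy2.2 _ h)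
    · exact h
    · exact absurd hy2.1 (hx2.2 _ h)
  subst hnm
  have a1 : didx n x = z := hx1
  have a2 : didx n x = y := hy1
  rw [← a1, ← a2]

lemma exists_sel {d : ℕ} (hd : 0 < d) (f : Rd d → ℝ) (hf : Integrable f) (l : ℝ) (hl : 0 < l)
    (x : Rd d) (n : ℤ) (hn : bigAv f l n (didx n x)) : ∃ q, x ∈ selCube f l q := by
  have hfin : ∫⁻ y, ‖f y‖ₑ ≠ ⊤ := hf.2.ne
  -- bounded below
  have hbb : ∃ b : ℤ, ∀ m, bigAv f l m (didx m x) → b ≤ m := by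
    set I := (∫⁻ y, ‖f y‖ₑ).toReal
    obtain ⟨k, hk⟩ := pow_unbounded_of_one_lt (I / l) (one_lt_two (α := ℝ))
    refine ⟨-k, fun m hm => ?_⟩
    by_contra hcon
    push Not at hcon
    unfold bigAv at hm
    have h1 : ENNReal.ofReal l * volume (dc m (didx m x) : Set (Rd d)) < ∫⁻ y, ‖f y‖ₑ :=
      hm.trans_le (setLIntegral_le_lintegral _ _)
    rw [volume_dc, ← ENNReal.ofReal_mul hl.le, ← ENNReal.ofReal_toReal hfin,
      ENNReal.ofReal_lt_ofReal_iff_of_nonneg (by positivity)] at h1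
    have h2 : (2 : ℝ) ^ k ≤ (2 : ℝ) ^ (-m) := by
      rw [← zpow_natCast]
      exact zpow_le_zpow_right₀ (by norm_num) (by omega)
    have h3 : (2 : ℝ) ^ (-m) ≤ ((2 : ℝ) ^ (-m)) ^ d := by
      apply le_self_pow₀ _ (by omega)
      exact le_trans (one_le_pow₀ (by norm_num)) h2
    rw [div_lt_iff₀ hl] at hk
    have : l * (2 : ℝ) ^ k ≤ l * ((2 : ℝ) ^ (-m)) ^ d :=
      mul_le_mul_of_nonneg_left (h2.trans h3) hl.le
    linarith
  obtain ⟨n0, h0, h0min⟩ := Int.exists_least_of_bdd hbb ⟨n, hn⟩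
  refine ⟨(n0, didx n0 x), rfl, h0, fun m hm hm' => ?_⟩
  exact absurd (h0min m hm') (by omega)

lemma ae_le_off {d : ℕ} (hd : 0 < d) (f : Rd d → ℝ) (hf : Integrable f) (l : ℝ) (hl : 0 < l) :
    ∀ᵐ x, x ∉ (⋃ q, selCube f l q) → ‖f x‖ ≤ l := by
  have hloc : LocallyIntegrable (fun x => ‖f x‖) (volume : Measure (Rd d)) :=
    hf.norm.locallyIntegrable
  filter_upwards [IsUnifLocDoublingMeasure.ae_tendsto_average volume hloc 1] with x hx hnot
  have hall : ∀ n : ℤ, ¬ bigAv f l n (didx n x) := by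
    intro n hn
    obtain ⟨q, hq⟩ := exists_sel hd f hf l hl x n hn
    exact hnot (Set.mem_iUnion.2 ⟨q, hq⟩)
  have hlim := @hx ℕ atTop (fun n => dcen (n : ℤ) (didx (n : ℤ) x))
    (fun n => (2 : ℝ) ^ (-(n : ℤ)) / 2) ?_ ?_
  · refine le_of_tendsto hlim (Eventually.of_forall fun n => ?_)
    have h1 := hall n
    unfold bigAv at h1
    push Not at h1
    rw [setLIntegral_congr (dc_ae_eq (n : ℤ) (didx n x)), volume_dc, ← volume_cb,
      ← ENNReal.ofReal_toReal (a := volume (closedBall _ _))] at h1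
    · rw [← ENNReal.ofReal_mul hl.le, ← ofReal_integral_norm_eq_lintegral_enorm hf.integrableOn,
        ENNReal.ofReal_le_ofReal_iff (by positivity)] at h1
      rw [setAverage_eq, smul_eq_mul]
      have hpos : 0 < (volume.real (closedBall (dcen (n : ℤ) (didx (n : ℤ) x))
          ((2 : ℝ) ^ (-(n : ℤ)) / 2))) := by
        rw [Measure.real, volume_cb, ENNReal.toReal_ofReal (by positivity)]; positivity
      rw [inv_mul_le_iff₀ hpos, mul_comm]
      exact h1
    · rw [volume_cb]; exact ENNReal.ofReal_ne_top
  · refine tendsto_nhdsWithin_iff.2 ⟨?_, Eventually.of_forall fun n => ?_⟩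
    · have : Tendsto (fun n : ℕ => ((1 / 2 : ℝ) ^ n) / 2) atTop (𝓝 (0 / 2)) :=
        (tendsto_pow_atTop_nhds_zero_of_lt_one (by norm_num) (by norm_num)).div_const 2
      rw [zero_div] at this
      refine this.congr fun n => ?_
      rw [zpow_neg, zpow_natCast, one_div, inv_pow]
    · simp only [Set.mem_Ioi]; positivity
  · refine Eventually.of_forall fun n => ?_
    rw [one_mul]
    exact dc_subset_closedBall _ _ rfl

/-- Calderon-Zygmund decomposition (cubes). -/
theorem cz_cubes {d : ℕ} (hd : 0 < d) (f : Rd d → ℝ) (hf : Integrable f) (l : ℝ) (hl : 0 < l) :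
    ∃ (Q : ℤ × (Fin d → ℤ) → Set (Rd d)) (c : ℤ × (Fin d → ℤ) → Rd d)
      (r : ℤ × (Fin d → ℤ) → ℝ),
      (∀ i, MeasurableSet (Q i)) ∧ Pairwise (Function.onFun Disjoint Q) ∧
      (∀ i, 0 < r i) ∧ (∀ i, Q i ⊆ closedBall (c i) (r i)) ∧
      (∀ i, (Q i).Nonempty → volume (closedBall (c i) (2 * r i)) ≤ 2 ^ d * volume (Q i)) ∧
      (∀ i, volume (Q i) ≠ ⊤) ∧
      (∀ i, ENNReal.ofReal l * volume (Q i) ≤ ∫⁻ x in Q i, ‖f x‖ₑ) ∧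
      (∀ i, ∫⁻ x in Q i, ‖f x‖ₑ ≤ 2 ^ d * ENNReal.ofReal l * volume (Q i)) ∧
      (∀ᵐ x, x ∉ (⋃ q, Q q) → ‖f x‖ ≤ l) := by
  refine ⟨selCube f l, fun q => dcen q.1 q.2, fun q => (2 : ℝ) ^ (-q.1) / 2, ?_,
    selCube_disjoint f l, fun i => by positivity, ?_, ?_, ?_, ?_, ?_, ae_le_off hd f hf l hl⟩
  · intro i
    rcases selCube_dich f l i with h | ⟨h, -⟩ <;> rw [h]
    · exact MeasurableSet.empty
    · exact measurableSet_dc _ _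
  · intro i x hx
    exact dc_subset_closedBall _ _ hx.1
  · intro i hne
    rcases selCube_dich f l i with h | ⟨h, -⟩
    · rw [h] at hne; exact absurd hne (by simp)
    · rw [h, volume_dc, Real.volume_pi_closedBall _ (by positivity), Fintype.card_fin,
        show (2 : ℝ≥0∞) = ENNReal.ofReal 2 by simp, ← ENNReal.ofReal_pow (by norm_num),
        ← ENNReal.ofReal_mul (by positivity), ← mul_pow]
      apply le_of_eq; congr 2; ring
  · intro i
    rcases selCube_dich f l i with h | ⟨h, -⟩ <;> rw [h]
    · simp
    · rw [volume_dc]; exact ENNReal.ofReal_ne_top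
  · intro i
    rcases selCube_dich f l i with h | ⟨h, h', -⟩ <;> rw [h]
    · simp
    · exact h'.le
  · intro i
    rcases selCube_dich f l i with h | ⟨h, -, z', hz', hnb⟩ <;> rw [h]
    · simp
    · unfold bigAv at hnb
      push Not at hnb
      refine (lintegral_mono_set hz').trans (hnb.trans (le_of_eq ?_))
      rw [volume_dc, volume_dc, mul_comm (2 ^ d) (ENNReal.ofReal l), mul_assoc]
      congr 1
      rw [show (2 : ℝ≥0∞) = ENNReal.ofReal 2 by simp, ← ENNReal.ofReal_pow (by norm_num),
        ← ENNReal.ofReal_mul (by positivity), ← mul_pow]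
      congr 2
      rw [neg_sub, sub_eq_add_neg, zpow_add₀ (by norm_num), zpow_one]

end HC

namespace HC

/-- convolution -/
def cv {d : ℕ} (K f : Rd d → ℝ) (x : Rd d) : ℝ := ∫ y, K (x - y) * f y

structure NiceK {d : ℕ} (K : Rd d → ℝ) : Prop where
  cont : Continuous K
  int : Integrable K
  bdd : ∃ C, ∀ x, ‖K x‖ ≤ C

def L2bd {d : ℕ} (K : Rd d → ℝ) (B : ℝ≥0) : Prop :=
  ∀ f : Rd d → ℝ, Integrable f → ∫⁻ x, ‖cv K f x‖ₑ ^ 2 ≤ B * ∫⁻ x, ‖f x‖ₑ ^ 2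

def Horm {d : ℕ} (K : Rd d → ℝ) (B : ℝ≥0) : Prop :=
  ∀ y : Rd d, ∫⁻ x in {x : Rd d | 2 * ‖y‖ < ‖x‖}, ‖K (x - y) - K x‖ₑ ≤ B

lemma cv_integrable {d : ℕ} {K f : Rd d → ℝ} (hK : NiceK K) (hf : Integrable f) (x : Rd d) :
    Integrable (fun y => K (x - y) * f y) := by
  obtain ⟨C, hC⟩ := hK.bdd
  refine hf.bdd_mul (c := C) ?_ (Eventually.of_forall fun y => hC _)
  exact (hK.cont.comp (by fun_prop)).aestronglyMeasurable

lemma cv_continuous {d : ℕ} {K f : Rd d → ℝ} (hK : NiceK K) (hf : Integrable f) :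
    Continuous (cv K f) := by
  obtain ⟨C, hC⟩ := hK.bdd
  have hc := hK.cont
  refine continuous_of_dominated (bound := fun y => C * ‖f y‖) ?_ ?_ ?_ ?_
  · exact fun x => (cv_integrable hK hf x).aestronglyMeasurable
  · intro x; refine Eventually.of_forall fun y => ?_
    rw [norm_mul]; exact mul_le_mul_of_nonneg_right (hC _) (norm_nonneg _)
  · exact hf.norm.const_mul C
  · refine Eventually.of_forall fun y => ?_
    fun_prop

lemma cv_add {d : ℕ} {K f g : Rd d → ℝ} (hK : NiceK K) (hf : Integrable f) (hg : Integrable g)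
    (x : Rd d) : cv K (fun y => f y + g y) x = cv K f x + cv K g x := by
  unfold cv
  rw [← integral_add (cv_integrable hK hf x) (cv_integrable hK hg x)]
  congr 1; funext y; ring

lemma cv_congr_ae {d : ℕ} {K f g : Rd d → ℝ} (h : f =ᵐ[volume] g) (x : Rd d) :
    cv K f x = cv K g x := by
  unfold cv
  refine integral_congr_ae ?_
  filter_upwards [h] with y hy
  rw [hy]

/-- The good/bad decomposition. -/
theorem cz_decomp {d : ℕ} (hd : 0 < d) (f : Rd d → ℝ) (hf : Integrable f) (l : ℝ) (hl : 0 < l) :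
    ∃ (Q : ℤ × (Fin d → ℤ) → Set (Rd d)) (c : ℤ × (Fin d → ℤ) → Rd d)
      (r : ℤ × (Fin d → ℤ) → ℝ) (g b : Rd d → ℝ),
      (∀ i, MeasurableSet (Q i)) ∧ Pairwise (Function.onFun Disjoint Q) ∧
      (∀ i, 0 < r i) ∧ (∀ i, Q i ⊆ closedBall (c i) (r i)) ∧
      (∀ i, (Q i).Nonempty → volume (closedBall (c i) (2 * r i)) ≤ 2 ^ d * volume (Q i)) ∧
      (∀ i, ENNReal.ofReal l * volume (Q i) ≤ ∫⁻ x in Q i, ‖f x‖ₑ) ∧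
      Integrable g ∧ Integrable b ∧ (∀ x, f x = g x + b x) ∧
      (∀ᵐ x, ‖g x‖ₑ ≤ 2 ^ d * ENNReal.ofReal l) ∧ (∫⁻ x, ‖g x‖ₑ ≤ ∫⁻ x, ‖f x‖ₑ) ∧
      (∀ x, x ∉ (⋃ i, Q i) → b x = 0) ∧ (∀ i, ∫ x in Q i, b x = 0) ∧
      (∀ i, ∫⁻ x in Q i, ‖b x‖ₑ ≤ 2 * ∫⁻ x in Q i, ‖f x‖ₑ) := by
  obtain ⟨Q, c, r, hQm, hQd, hr, hQb, hQv, hQf, hlow, hup, hoff⟩ := cz_cubes hd f hf l hl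
  set U := ⋃ i, Q i with hU
  have hUm : MeasurableSet U := MeasurableSet.iUnion hQm
  let a : ℤ × (Fin d → ℤ) → ℝ := fun i => ⨍ x in Q i, f x
  let g : Rd d → ℝ := fun x => if h : ∃ i, x ∈ Q i then a h.choose else f x
  have hgQ : ∀ i, ∀ x ∈ Q i, g x = a i := by
    intro i x hx
    have h : ∃ i, x ∈ Q i := ⟨i, hx⟩
    have e : h.choose = i := by
      by_contra hne
      exact (Set.disjoint_left.1 (hQd hne)) h.choose_spec hx
    simp only [g, dif_pos h, e]
  have hgU : ∀ x, x ∉ U → g x = f x := by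
    intro x hx
    have h : ¬ ∃ i, x ∈ Q i := by rw [hU, Set.mem_iUnion] at hx; exact hx
    simp only [g, dif_neg h]
  have hai : ∀ i, ‖a i‖ₑ * volume (Q i) ≤ ∫⁻ x in Q i, ‖f x‖ₑ := by
    intro i
    by_cases h0 : volume (Q i) = 0
    · simp [h0]
    have e : a i = (volume.real (Q i))⁻¹ * ∫ x in Q i, f x := by
      simp only [a]; rw [setAverage_eq, smul_eq_mul]
    have hvr : ‖(volume.real (Q i))‖ₑ = volume (Q i) := by
      rw [Real.enorm_of_nonneg (by positivity), Measure.real, ENNReal.ofReal_toReal (hQf i)]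
    have hne : (volume.real (Q i)) ≠ 0 := by
      rw [Measure.real]; exact ENNReal.toReal_ne_zero.2 ⟨h0, hQf i⟩
    have e2 : a i * volume.real (Q i) = ∫ x in Q i, f x := by
      rw [e]; field_simp
    rw [← hvr, ← enorm_mul, e2]
    exact enorm_integral_le_lintegral_enorm _
  have hgm : AEStronglyMeasurable g := by
    rw [← Measure.restrict_univ (μ := (volume : Measure (Rd d))), ← Set.union_compl_self U,
      aestronglyMeasurable_union_iff]
    constructor
    · rw [hU, aestronglyMeasurable_iUnion_iff]
      intro i
      refine (aestronglyMeasurable_const (b := a i)).congr ?_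
      filter_upwards [ae_restrict_mem (hQm i)] with x hx
      exact (hgQ i x hx).symm
    · refine hf.aestronglyMeasurable.restrict.congr ?_
      filter_upwards [ae_restrict_mem hUm.compl] with x hx
      exact (hgU x hx).symm
  have hgi : ∀ i, ∫⁻ x in Q i, ‖g x‖ₑ ≤ ∫⁻ x in Q i, ‖f x‖ₑ := by
    intro i
    rw [setLIntegral_congr_fun (hQm i) (fun x hx => by simp only [hgQ i x hx] : EqOn _
      (fun _ => ‖a i‖ₑ) (Q i)), setLIntegral_const]
    exact hai i
  have hgl1 : ∫⁻ x, ‖g x‖ₑ ≤ ∫⁻ x, ‖f x‖ₑ := by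
    rw [← lintegral_add_compl _ hUm, ← lintegral_add_compl (fun x => ‖f x‖ₑ) hUm]
    refine add_le_add ?_ ?_
    · rw [hU, lintegral_iUnion hQm hQd, lintegral_iUnion hQm hQd]
      exact ENNReal.tsum_le_tsum hgi
    · refine le_of_eq (setLIntegral_congr_fun hUm.compl fun x hx => ?_)
      simp only [hgU x hx]
  have hgint : Integrable g := ⟨hgm, hgl1.trans_lt hf.2⟩
  refine ⟨Q, c, r, g, fun x => f x - g x, hQm, hQd, hr, hQb, hQv, hlow, hgint, hf.sub hgint,
    fun x => by ring, ?_, hgl1, ?_, ?_, ?_⟩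
  · have hpt : ∀ i, volume (Q i) ≠ 0 → ‖a i‖ₑ ≤ 2 ^ d * ENNReal.ofReal l := by
      intro i h0
      have := (hai i).trans (hup i)
      exact (ENNReal.mul_le_mul_iff_left h0 (hQf i)).1 this
    have hnull : ∀ᵐ x, ∀ i, volume (Q i) = 0 → x ∉ Q i := by
      rw [ae_all_iff]; intro i
      by_cases h0 : volume (Q i) = 0
      · filter_upwards [measure_eq_zero_iff_ae_notMem.1 h0] with x hx _ using hx
      · exact Eventually.of_forall fun x h => absurd h h0
    filter_upwards [hoff, hnull] with x hx1 hx2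
    by_cases hxU : x ∈ U
    · obtain ⟨i, hi⟩ := Set.mem_iUnion.1 hxU
      rw [hgQ i x hi]
      exact hpt i fun h0 => hx2 i h0 hi
    · rw [hgU x hxU, ← ofReal_norm]
      refine (ENNReal.ofReal_le_ofReal (hx1 hxU)).trans ?_
      exact le_mul_of_one_le_left (by positivity) (one_le_pow₀ (by norm_num))
  · intro x hx
    simp only [hgU x hx, sub_self]
  · intro i
    rw [integral_sub hf.integrableOn hgint.integrableOn,
      setIntegral_congr_fun (hQm i) (hgQ i), setIntegral_const]
    by_cases h0 : volume (Q i) = 0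
    · rw [setIntegral_measure_zero _ h0]
      simp [Measure.real, h0]
    · have hne : (volume.real (Q i)) ≠ 0 := by
        rw [Measure.real]; exact ENNReal.toReal_ne_zero.2 ⟨h0, hQf i⟩
      simp only [a, setAverage_eq, smul_eq_mul]
      field_simp; simp
  · intro i
    have : ∫⁻ x in Q i, ‖f x - g x‖ₑ ≤ ∫⁻ x in Q i, (‖f x‖ₑ + ‖g x‖ₑ) :=
      lintegral_mono fun x => enorm_sub_le
    refine this.trans ?_
    rw [lintegral_add_left' hf.aestronglyMeasurable.enorm.restrict, two_mul]
    exact add_le_add le_rfl (hgi i)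

lemma horm_shift {d : ℕ} {K : Rd d → ℝ} {B : ℝ≥0} (hH : Horm K B) (c y : Rd d) (r : ℝ)
    (hy : y ∈ closedBall c r) :
    ∫⁻ x in (closedBall c (2 * r))ᶜ, ‖K (x - y) - K (x - c)‖ₑ ≤ B := by
  have h1 := hH (y - c)
  have hmp : MeasurePreserving (fun x : Rd d => x - c) volume volume :=
    measurePreserving_sub_right volume c
  have hs : MeasurableSet {x : Rd d | 2 * ‖y - c‖ < ‖x‖} :=
    measurableSet_lt measurable_const measurable_norm
  rw [← hmp.setLIntegral_comp_preimage_emb (measurableEmbedding_subRight c)] at h1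
  refine le_trans ?_ h1
  refine le_trans (lintegral_mono_set (t := (fun x : Rd d => x - c) ⁻¹' {x : Rd d | 2 * ‖y - c‖ < ‖x‖}) ?_) ?_
  · intro x hx
    simp only [Set.mem_compl_iff, mem_closedBall, not_le, dist_eq_norm] at hx hy
    change 2 * ‖y - c‖ < ‖x - c‖
    linarith
  · refine le_of_eq (lintegral_congr fun x => ?_)
    congr 3; abel

theorem weak11 {d : ℕ} (hd : 0 < d) {K : Rd d → ℝ} {B : ℝ≥0} (hK : NiceK K) (h2 : L2bd K B)
    (hH : Horm K B) (f : Rd d → ℝ) (hf : Integrable f) (l : ℝ) (hl : 0 < l) :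
    ENNReal.ofReal l * volume {x | l < ‖cv K f x‖} ≤
      (2 ^ d * (4 * B + 1) + 4 * B) * ∫⁻ x, ‖f x‖ₑ := by
  obtain ⟨Q, c, r, g, b, hQm, hQd, hr, hQb, hQv, hlow, hg, hb, hfgb, hgl, hg1, hb0, hbi, hbf⟩ :=
    cz_decomp hd f hf l hl
  set I := ∫⁻ x, ‖f x‖ₑ with hI
  set L := ENNReal.ofReal l with hL
  have hL0 : L ≠ 0 := by rw [hL]; simpa using hl
  have hLt : L ≠ ⊤ := ENNReal.ofReal_ne_top
  let Qs : ℤ × (Fin d → ℤ) → Set (Rd d) := fun i =>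
    if (Q i).Nonempty then closedBall (c i) (2 * r i) else ∅
  have hQsm : ∀ i, MeasurableSet (Qs i) := by
    intro i; simp only [Qs]; split_ifs
    · exact measurableSet_closedBall
    · exact MeasurableSet.empty
  have hsumf : ∑' i, ∫⁻ x in Q i, ‖f x‖ₑ ≤ I := by
    rw [← lintegral_iUnion hQm hQd]; exact setLIntegral_le_lintegral _ _
  -- the exceptional set
  have hE : L * volume (⋃ i, Qs i) ≤ 2 ^ d * I := by
    calc L * volume (⋃ i, Qs i) ≤ L * ∑' i, volume (Qs i) := by
          gcongr; exact measure_iUnion_le _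
      _ = ∑' i, L * volume (Qs i) := ENNReal.tsum_mul_left.symm
      _ ≤ ∑' i, 2 ^ d * ∫⁻ x in Q i, ‖f x‖ₑ := by
          refine ENNReal.tsum_le_tsum fun i => ?_
          simp only [Qs]; split_ifs with h
          · calc L * volume (closedBall (c i) (2 * r i)) ≤ L * (2 ^ d * volume (Q i)) := by
                  gcongr; exact hQv i h
              _ = 2 ^ d * (L * volume (Q i)) := by ring
              _ ≤ _ := by gcongr; exact hlow i
          · simp
      _ = 2 ^ d * ∑' i, ∫⁻ x in Q i, ‖f x‖ₑ := ENNReal.tsum_mul_left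
      _ ≤ _ := by gcongr
  -- good part
  have hgood : L * volume {x | l / 2 < ‖cv K g x‖} ≤ 4 * B * 2 ^ d * I := by
    have hm : Measurable fun x => ‖cv K g x‖ₑ ^ 2 :=
      (cv_continuous hK hg).measurable.enorm.pow_const 2
    have hch := mul_meas_ge_le_lintegral (μ := volume) hm ((L / 2) ^ 2)
    have hsub : {x | l / 2 < ‖cv K g x‖} ⊆ {x | (L / 2) ^ 2 ≤ ‖cv K g x‖ₑ ^ 2} := by
      intro x hx
      have hx' : l / 2 < ‖cv K g x‖ := hx
      have : L / 2 ≤ ‖cv K g x‖ₑ := by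
        rw [← ofReal_norm, hL, show (2 : ℝ≥0∞) = ENNReal.ofReal 2 by simp,
          ← ENNReal.ofReal_div_of_pos (by norm_num)]
        exact ENNReal.ofReal_le_ofReal hx'.le
      exact pow_le_pow_left' this 2
    have hg2 : ∫⁻ x, ‖g x‖ₑ ^ 2 ≤ 2 ^ d * L * I := by
      calc ∫⁻ x, ‖g x‖ₑ ^ 2 ≤ ∫⁻ x, 2 ^ d * L * ‖g x‖ₑ := by
            refine lintegral_mono_ae ?_
            filter_upwards [hgl] with x hx
            rw [pow_two]; gcongr
        _ = 2 ^ d * L * ∫⁻ x, ‖g x‖ₑ :=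
            lintegral_const_mul'' _ hg.aestronglyMeasurable.enorm
        _ ≤ _ := by gcongr
    have h3 : L * (L * volume {x | l / 2 < ‖cv K g x‖}) ≤ L * (4 * B * 2 ^ d * I) := by
      calc L * (L * volume {x | l / 2 < ‖cv K g x‖})
          = 4 * ((L / 2) ^ 2 * volume {x | l / 2 < ‖cv K g x‖}) := by
            rw [ENNReal.div_eq_inv_mul, mul_pow, ← mul_assoc, ← mul_assoc, ← mul_assoc]
            congr 1
            rw [← ENNReal.inv_pow, show (2 : ℝ≥0∞) ^ 2 = 4 by norm_num,
              ENNReal.mul_inv_cancel (by norm_num) (by norm_num), one_mul, pow_two]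
        _ ≤ 4 * ((L / 2) ^ 2 * volume {x | (L / 2) ^ 2 ≤ ‖cv K g x‖ₑ ^ 2}) := by gcongr
        _ ≤ 4 * ∫⁻ x, ‖cv K g x‖ₑ ^ 2 := by gcongr
        _ ≤ 4 * (B * ∫⁻ x, ‖g x‖ₑ ^ 2) := by gcongr; exact h2 g hg
        _ ≤ 4 * (B * (2 ^ d * L * I)) := by gcongr
        _ = _ := by ring
    exact (ENNReal.mul_le_mul_iff_right hL0 hLt).1 h3
  -- bad part
  have hbadI : ∫⁻ x in (⋃ i, Qs i)ᶜ, ‖cv K b x‖ₑ ≤ B * (2 * I) := by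
    have hpt : ∀ x, ‖cv K b x‖ₑ ≤
        ∑' i, ∫⁻ y in Q i, ‖K (x - y) - K (x - c i)‖ₑ * ‖b y‖ₑ := by
      intro x
      have e1 : cv K b x = ∑' i, ∫ y in Q i, K (x - y) * b y := by
        unfold cv
        rw [← integral_iUnion hQm hQd (cv_integrable hK hb x).integrableOn]
        refine (setIntegral_eq_integral_of_forall_compl_eq_zero fun y hy => ?_).symm
        rw [hb0 y hy, mul_zero]
      have e2 : ∀ i, ‖∫ y in Q i, K (x - y) * b y‖ₑ ≤
          ∫⁻ y in Q i, ‖K (x - y) - K (x - c i)‖ₑ * ‖b y‖ₑ := by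
        intro i
        have e3 : ∫ y in Q i, K (x - y) * b y = ∫ y in Q i, (K (x - y) - K (x - c i)) * b y := by
          simp_rw [sub_mul]
          rw [integral_sub (cv_integrable hK hb x).integrableOn
            (hb.integrableOn.const_mul _), integral_const_mul, hbi i, mul_zero, sub_zero]
        rw [e3]
        refine (enorm_integral_le_lintegral_enorm _).trans (le_of_eq ?_)
        exact lintegral_congr fun y => enorm_mul _ _
      rw [e1]
      exact (enorm_tsum_le_tsum_enorm).trans (ENNReal.tsum_le_tsum e2)
    have hbm : AEMeasurable (fun y => ‖b y‖ₑ) := hb.aestronglyMeasurable.enorm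
    have hKm : ∀ i, AEMeasurable (Function.uncurry fun (x y : Rd d) =>
        ‖K (x - y) - K (x - c i)‖ₑ * ‖b y‖ₑ)
        ((volume.restrict (⋃ i, Qs i)ᶜ).prod (volume.restrict (Q i))) := by
      intro i
      have hKc := hK.cont
      have m1 : Measurable fun q : Rd d × Rd d => ‖K (q.1 - q.2) - K (q.1 - c i)‖ₑ :=
        (Continuous.measurable (by fun_prop)).enorm
      exact m1.aemeasurable.mul (hbm.restrict.comp_snd)
    calc ∫⁻ x in (⋃ i, Qs i)ᶜ, ‖cv K b x‖ₑ
        ≤ ∫⁻ x in (⋃ i, Qs i)ᶜ, ∑' i, ∫⁻ y in Q i, ‖K (x - y) - K (x - c i)‖ₑ * ‖b y‖ₑ :=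
          lintegral_mono hpt
      _ = ∑' i, ∫⁻ x in (⋃ i, Qs i)ᶜ, ∫⁻ y in Q i, ‖K (x - y) - K (x - c i)‖ₑ * ‖b y‖ₑ :=
          lintegral_tsum fun i => (hKm i).lintegral_prod_right'
      _ ≤ ∑' i, B * (2 * ∫⁻ y in Q i, ‖f y‖ₑ) := by
          refine ENNReal.tsum_le_tsum fun i => ?_
          rcases Set.eq_empty_or_nonempty (Q i) with he | hne
          · rw [he]; simp
          rw [lintegral_lintegral_swap (hKm i)]
          calc ∫⁻ y in Q i, ∫⁻ x in (⋃ i, Qs i)ᶜ, ‖K (x - y) - K (x - c i)‖ₑ * ‖b y‖ₑ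
              ≤ ∫⁻ y in Q i, B * ‖b y‖ₑ := by
                refine setLIntegral_mono_ae' (hQm i) (Eventually.of_forall fun y hy => ?_)
                have hKc := hK.cont
                rw [lintegral_mul_const _ (Continuous.measurable (by fun_prop)).enorm]
                gcongr
                refine le_trans (lintegral_mono_set ?_) (horm_shift hH (c i) y (r i) (hQb i hy))
                intro x hx
                simp only [Set.mem_compl_iff, Set.mem_iUnion, not_exists] at hx
                have := hx i
                rw [Set.mem_compl_iff]
                simpa only [Qs, if_pos hne] using this
            _ = B * ∫⁻ y in Q i, ‖b y‖ₑ := lintegral_const_mul'' _ hbm.restrict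
            _ ≤ _ := by gcongr; exact hbf i
      _ = B * (2 * ∑' i, ∫⁻ y in Q i, ‖f y‖ₑ) := by
          rw [ENNReal.tsum_mul_left, ENNReal.tsum_mul_left]
      _ ≤ _ := by gcongr
  have hbad : L * volume ({x | l / 2 < ‖cv K b x‖} ∩ (⋃ i, Qs i)ᶜ) ≤ 4 * B * I := by
    have hm : Measurable fun x => ‖cv K b x‖ₑ := (cv_continuous hK hb).measurable.enorm
    have hch := mul_meas_ge_le_lintegral (μ := volume.restrict (⋃ i, Qs i)ᶜ) hm (L / 2)
    have hsub : {x | l / 2 < ‖cv K b x‖} ⊆ {x | L / 2 ≤ ‖cv K b x‖ₑ} := by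
      intro x hx
      have hx' : l / 2 < ‖cv K b x‖ := hx
      change L / 2 ≤ ‖cv K b x‖ₑ
      rw [← ofReal_norm, hL, show (2 : ℝ≥0∞) = ENNReal.ofReal 2 by simp,
          ← ENNReal.ofReal_div_of_pos (by norm_num)]
      exact ENNReal.ofReal_le_ofReal hx'.le
    have hms : MeasurableSet (⋃ i, Qs i)ᶜ := (MeasurableSet.iUnion hQsm).compl
    calc L * volume ({x | l / 2 < ‖cv K b x‖} ∩ (⋃ i, Qs i)ᶜ)
        = 2 * (L / 2 * volume ({x | l / 2 < ‖cv K b x‖} ∩ (⋃ i, Qs i)ᶜ)) := by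
          rw [← mul_assoc, ENNReal.mul_div_cancel (by norm_num) (by norm_num)]
      _ ≤ 2 * (L / 2 * (volume.restrict (⋃ i, Qs i)ᶜ) {x | L / 2 ≤ ‖cv K b x‖ₑ}) := by
          refine mul_le_mul' le_rfl (mul_le_mul' le_rfl ?_)
          rw [Measure.restrict_apply' hms]
          exact measure_mono (Set.inter_subset_inter_left _ hsub)
      _ ≤ 2 * (B * (2 * I)) := mul_le_mul' le_rfl (hch.trans hbadI)
      _ = _ := by ring
  have hincl : {x | l < ‖cv K f x‖} ⊆ {x | l / 2 < ‖cv K g x‖} ∪ ((⋃ i, Qs i) ∪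
      ({x | l / 2 < ‖cv K b x‖} ∩ (⋃ i, Qs i)ᶜ)) := by
    intro x hx
    have hx' : l < ‖cv K f x‖ := hx
    have e : cv K f x = cv K g x + cv K b x := by
      rw [← cv_add hK hg hb]; congr 1; funext y; exact hfgb y
    by_cases h1 : l / 2 < ‖cv K g x‖
    · exact Or.inl h1
    · right
      by_cases h2 : x ∈ ⋃ i, Qs i
      · exact Or.inl h2
      · right
        refine ⟨?_, h2⟩
        have := norm_add_le (cv K g x) (cv K b x)
        rw [e] at hx'
        change l / 2 < ‖cv K b x‖
        linarith
  calc L * volume {x | l < ‖cv K f x‖}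
      ≤ L * (volume {x | l / 2 < ‖cv K g x‖} + (volume (⋃ i, Qs i) +
        volume ({x | l / 2 < ‖cv K b x‖} ∩ (⋃ i, Qs i)ᶜ))) := by
        gcongr
        exact (measure_mono hincl).trans ((measure_union_le _ _).trans
          (add_le_add le_rfl (measure_union_le _ _)))
    _ ≤ 4 * B * 2 ^ d * I + (2 ^ d * I + 4 * B * I) := by
        rw [mul_add, mul_add]
        exact add_le_add hgood (add_le_add hE hbad)
    _ = _ := by ring

end HC

namespace HC

lemma ofReal_rpow_norm (x : ℝ) (q : ℝ) (hq : 0 ≤ q) : ENNReal.ofReal (‖x‖ ^ q) = ‖x‖ₑ ^ q := by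
  rw [← ofReal_norm, ENNReal.ofReal_rpow_of_nonneg (norm_nonneg _) hq]

lemma lint_pow_Ioo (q : ℝ) (hq : 1 < q) (a : ℝ) (ha : 0 ≤ a) :
    ∫⁻ t in Ioi (0 : ℝ), (if t < a then ENNReal.ofReal (t ^ (q - 2)) else 0) =
      ENNReal.ofReal (a ^ (q - 1) / (q - 1)) := by
  have e1 : ∀ t : ℝ, (if t < a then ENNReal.ofReal (t ^ (q - 2)) else 0) =
      (Iio a).indicator (fun t => ENNReal.ofReal (t ^ (q - 2))) t := by
    intro t; simp [indicator]
  simp_rw [e1]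
  rw [lintegral_indicator measurableSet_Iio, Measure.restrict_restrict measurableSet_Iio,
    Set.inter_comm, Ioi_inter_Iio, setLIntegral_congr (Ioo_ae_eq_Ioc)]
  have hi : IntervalIntegrable (fun t : ℝ => t ^ (q - 2)) volume 0 a :=
    intervalIntegral.intervalIntegrable_rpow' (by linarith)
  have hi' : IntegrableOn (fun t : ℝ => t ^ (q - 2)) (Ioc 0 a) :=
    (intervalIntegrable_iff_integrableOn_Ioc_of_le ha).1 hi
  rw [← ofReal_integral_eq_lintegral_ofReal hi' ?_, ← intervalIntegral.integral_of_le ha,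
    integral_rpow (Or.inl (by linarith))]
  · congr 1
    rw [show q - 2 + 1 = q - 1 by ring, Real.zero_rpow (by linarith), sub_zero]
  · filter_upwards [ae_restrict_mem measurableSet_Ioc] with t ht
    exact Real.rpow_nonneg ht.1.le _

lemma lint_pow_Ioi (q : ℝ) (hq2 : q < 2) (a : ℝ) (ha : 0 < a) :
    ∫⁻ t in Ioi (0 : ℝ), (if t < a then 0 else ENNReal.ofReal (t ^ (q - 3))) =
      ENNReal.ofReal (a ^ (q - 2) / (2 - q)) := by
  have e1 : ∀ t : ℝ, (if t < a then 0 else ENNReal.ofReal (t ^ (q - 3))) =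
      (Ici a).indicator (fun t => ENNReal.ofReal (t ^ (q - 3))) t := by
    intro t; by_cases h : t < a
    · simp [indicator, h]
    · simp [indicator, h, not_lt.1 h]
  simp_rw [e1]
  rw [lintegral_indicator measurableSet_Ici, Measure.restrict_restrict measurableSet_Ici,
    Set.inter_eq_left.2 (Set.Ici_subset_Ioi.2 ha),
    setLIntegral_congr (Ioi_ae_eq_Ici).symm]
  have hi' : IntegrableOn (fun t : ℝ => t ^ (q - 3)) (Ioi a) :=
    integrableOn_Ioi_rpow_of_lt (by linarith) ha
  rw [← ofReal_integral_eq_lintegral_ofReal hi' ?_, integral_Ioi_rpow_of_lt (by linarith) ha]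
  · congr 1
    rw [show q - 3 + 1 = -(2 - q) by ring, show q - 2 = -(2 - q) by ring, div_neg, neg_div, neg_neg]
  · filter_upwards [ae_restrict_mem measurableSet_Ioi] with t ht
    exact Real.rpow_nonneg (ha.trans ht).le _

lemma marc_level {d : ℕ} (hd : 0 < d) {K : Rd d → ℝ} {B : ℝ≥0} (hK : NiceK K) (h2 : L2bd K B)
    (hH : Horm K B) (f : Rd d → ℝ) (hfm : Measurable f) (hf : Integrable f) (t : ℝ) (ht : 0 < t) :
    volume {x | t < ‖cv K f x‖ / 2} ≤
      (ENNReal.ofReal t)⁻¹ * ((2 ^ d * (4 * B + 1) + 4 * B) * ∫⁻ x, (if t < ‖f x‖ then ‖f x‖ₑ else 0))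
      + (ENNReal.ofReal t ^ 2)⁻¹ * (B * ∫⁻ x, (if t < ‖f x‖ then 0 else ‖f x‖ₑ ^ 2)) := by
  have hs : MeasurableSet {x | t < ‖f x‖} := measurableSet_lt measurable_const hfm.norm
  set f1 := indicator {x | t < ‖f x‖} f with hf1
  set f2 := indicator {x | t < ‖f x‖}ᶜ f with hf2
  have i1 : Integrable f1 := hf.indicator hs
  have i2 : Integrable f2 := hf.indicator hs.compl
  have e : ∀ x, cv K f x = cv K f1 x + cv K f2 x := by
    intro x; rw [← cv_add hK i1 i2]; congr 1
    exact (indicator_self_add_compl _ f).symm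
  have hT0 : ENNReal.ofReal t ≠ 0 := by simpa using ht
  have hTt : ENNReal.ofReal t ≠ ⊤ := ENNReal.ofReal_ne_top
  have b1 : volume {x | t < ‖cv K f1 x‖} ≤ (ENNReal.ofReal t)⁻¹ *
      ((2 ^ d * (4 * B + 1) + 4 * B) * ∫⁻ x, (if t < ‖f x‖ then ‖f x‖ₑ else 0)) := by
    have := weak11 hd hK h2 hH f1 i1 t ht
    rw [ENNReal.mul_le_iff_le_inv hT0 hTt] at this
    refine this.trans (le_of_eq ?_)
    congr 2
    refine lintegral_congr fun x => ?_
    by_cases h : t < ‖f x‖ <;> simp only [hf1, indicator, Set.mem_ofPred_eq, h, if_true, if_false, enorm_zero]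
  have b2 : volume {x | t < ‖cv K f2 x‖} ≤ (ENNReal.ofReal t ^ 2)⁻¹ *
      (B * ∫⁻ x, (if t < ‖f x‖ then 0 else ‖f x‖ₑ ^ 2)) := by
    have hm : Measurable fun x => ‖cv K f2 x‖ₑ ^ 2 :=
      (cv_continuous hK i2).measurable.enorm.pow_const 2
    have hch := mul_meas_ge_le_lintegral (μ := volume) hm (ENNReal.ofReal t ^ 2)
    rw [ENNReal.mul_le_iff_le_inv (by positivity) (by finiteness)] at hch
    refine (measure_mono ?_).trans (hch.trans ?_)
    · intro x hx
      have hx' : t < ‖cv K f2 x‖ := hx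
      have : ENNReal.ofReal t ≤ ‖cv K f2 x‖ₑ := by
        rw [← ofReal_norm]; exact ENNReal.ofReal_le_ofReal hx'.le
      exact pow_le_pow_left' this 2
    · refine mul_le_mul' le_rfl ((h2 f2 i2).trans (le_of_eq ?_))
      congr 1
      refine lintegral_congr fun x => ?_
      by_cases h : t < ‖f x‖ <;> simp [hf2, indicator, Set.mem_ofPred_eq, h, -Real.norm_eq_abs]
  refine (measure_mono (?_ : _ ⊆ {x | t < ‖cv K f1 x‖} ∪ {x | t < ‖cv K f2 x‖})).trans
    ((measure_union_le _ _).trans (add_le_add b1 b2))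
  intro x hx
  have hx' : t < ‖cv K f x‖ / 2 := hx
  rw [e] at hx'
  have := norm_add_le (cv K f1 x) (cv K f2 x)
  by_cases h : t < ‖cv K f1 x‖
  · exact Or.inl h
  · right; change t < ‖cv K f2 x‖; linarith

theorem strong_lt2 {d : ℕ} (hd : 0 < d) (B : ℝ≥0) (q : ℝ) (hq : 1 < q) (hq2 : q < 2) :
    ∃ C : ℝ≥0, ∀ K : Rd d → ℝ, NiceK K → L2bd K B → Horm K B → ∀ f : Rd d → ℝ, Integrable f →
      ∫⁻ x, ‖cv K f x‖ₑ ^ q ≤ C * ∫⁻ x, ‖f x‖ₑ ^ q := by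
  set A1 : ℝ≥0 := 2 ^ d * (4 * B + 1) + 4 * B with hA1
  refine ⟨Real.toNNReal (2 ^ q) * Real.toNNReal q * (A1 * Real.toNNReal (1 / (q - 1)) +
    B * Real.toNNReal (1 / (2 - q))), ?_⟩
  intro K hK h2 hH f0 hf0
  -- pass to a measurable representative
  set f := hf0.aestronglyMeasurable.mk f0 with hfdef
  have hfe : f0 =ᵐ[volume] f := hf0.aestronglyMeasurable.ae_eq_mk
  have hfm : Measurable f := hf0.aestronglyMeasurable.stronglyMeasurable_mk.measurable
  have hf : Integrable f := hf0.congr hfe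
  have c1 : ∫⁻ x, ‖cv K f0 x‖ₑ ^ q = ∫⁻ x, ‖cv K f x‖ₑ ^ q := by
    refine lintegral_congr fun x => ?_
    rw [cv_congr_ae hfe]
  have c2 : ∫⁻ x, ‖f0 x‖ₑ ^ q = ∫⁻ x, ‖f x‖ₑ ^ q := by
    refine lintegral_congr_ae ?_
    filter_upwards [hfe] with x hx; rw [hx]
  rw [c1, c2]
  have hq0 : 0 < q := by linarith
  have e0 : ∫⁻ x, ‖cv K f x‖ₑ ^ q = ENNReal.ofReal (2 ^ q) *
      ∫⁻ x, ENNReal.ofReal ((‖cv K f x‖ / 2) ^ q) := by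
    rw [← lintegral_const_mul _ ?_]
    · refine lintegral_congr fun x => ?_
      rw [← ENNReal.ofReal_mul (by positivity), ← Real.mul_rpow (by norm_num) (by positivity),
        ← ofReal_rpow_norm _ _ hq0.le]
      congr 2; ring
    · have := (cv_continuous hK hf).measurable
      fun_prop
  rw [e0, lintegral_rpow_eq_lintegral_meas_lt_mul volume
    (Eventually.of_forall fun x => by simp only [Pi.zero_apply]; positivity)
    ((cv_continuous hK hf).measurable.norm.div_const 2).aemeasurable hq0]
  have hm1 : Measurable fun z : ℝ × Rd d => (if z.1 < ‖f z.2‖ then ‖f z.2‖ₑ *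
      ENNReal.ofReal (z.1 ^ (q - 2)) else 0) := by
    refine Measurable.ite (measurableSet_lt measurable_fst (hfm.norm.comp measurable_snd)) ?_
      measurable_const
    fun_prop
  have hm2 : Measurable fun z : ℝ × Rd d => (if z.1 < ‖f z.2‖ then 0 else ‖f z.2‖ₑ ^ 2 *
      ENNReal.ofReal (z.1 ^ (q - 3))) := by
    refine Measurable.ite (measurableSet_lt measurable_fst (hfm.norm.comp measurable_snd)) 
      measurable_const ?_
    fun_prop
  have sw1 := lintegral_lintegral_swap (μ := volume.restrict (Ioi (0 : ℝ)))
    (ν := (volume : Measure (Rd d))) (f := fun t x => (if t < ‖f x‖ then ‖f x‖ₑ *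
      ENNReal.ofReal (t ^ (q - 2)) else 0)) hm1.aemeasurable
  have sw2 := lintegral_lintegral_swap (μ := volume.restrict (Ioi (0 : ℝ)))
    (ν := (volume : Measure (Rd d))) (f := fun t x => (if t < ‖f x‖ then 0 else ‖f x‖ₑ ^ 2 *
      ENNReal.ofReal (t ^ (q - 3)))) hm2.aemeasurable
  have key : ∫⁻ t in Ioi (0 : ℝ), volume {x | t < ‖cv K f x‖ / 2} * ENNReal.ofReal (t ^ (q - 1)) ≤
      (A1 * Real.toNNReal (1 / (q - 1)) + B * Real.toNNReal (1 / (2 - q)) : ℝ≥0) *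
        ∫⁻ x, ‖f x‖ₑ ^ q := by
    calc ∫⁻ t in Ioi (0 : ℝ), volume {x | t < ‖cv K f x‖ / 2} * ENNReal.ofReal (t ^ (q - 1))
        ≤ ∫⁻ t in Ioi (0 : ℝ), (A1 * ∫⁻ x, (if t < ‖f x‖ then ‖f x‖ₑ *
            ENNReal.ofReal (t ^ (q - 2)) else 0)) +
            (B * ∫⁻ x, (if t < ‖f x‖ then 0 else ‖f x‖ₑ ^ 2 * ENNReal.ofReal (t ^ (q - 3)))) := by
          refine setLIntegral_mono_ae' measurableSet_Ioi (Eventually.of_forall fun t ht => ?_)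
          have ht' : 0 < t := ht
          refine (mul_le_mul' (marc_level hd hK h2 hH f hfm hf t ht') le_rfl).trans (le_of_eq ?_)
          have hT0 : ENNReal.ofReal t ≠ 0 := by simpa using ht'
          have r1 : (ENNReal.ofReal t)⁻¹ * ENNReal.ofReal (t ^ (q - 1)) =
              ENNReal.ofReal (t ^ (q - 2)) := by
            rw [← ENNReal.ofReal_inv_of_pos ht', ← ENNReal.ofReal_mul (by positivity)]
            congr 1
            rw [← Real.rpow_neg_one, ← Real.rpow_add ht']; congr 1; ring
          have r2 : (ENNReal.ofReal t ^ 2)⁻¹ * ENNReal.ofReal (t ^ (q - 1)) =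
              ENNReal.ofReal (t ^ (q - 3)) := by
            rw [← ENNReal.ofReal_pow ht'.le, ← ENNReal.ofReal_inv_of_pos (by positivity),
              ← ENNReal.ofReal_mul (by positivity)]
            congr 1
            rw [← Real.rpow_natCast, ← Real.rpow_neg ht'.le, ← Real.rpow_add ht']; congr 1
            push_cast; ring
          have s1 : ∫⁻ x, (if t < ‖f x‖ then ‖f x‖ₑ * ENNReal.ofReal (t ^ (q - 2)) else 0) =
              (∫⁻ x, (if t < ‖f x‖ then ‖f x‖ₑ else 0)) * ENNReal.ofReal (t ^ (q - 2)) := by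
            rw [← lintegral_mul_const' _ _ ENNReal.ofReal_ne_top]
            refine lintegral_congr fun x => ?_
            split_ifs <;> simp
          have s2 : ∫⁻ x, (if t < ‖f x‖ then 0 else ‖f x‖ₑ ^ 2 * ENNReal.ofReal (t ^ (q - 3))) =
              (∫⁻ x, (if t < ‖f x‖ then 0 else ‖f x‖ₑ ^ 2)) * ENNReal.ofReal (t ^ (q - 3)) := by
            rw [← lintegral_mul_const' _ _ ENNReal.ofReal_ne_top]
            refine lintegral_congr fun x => ?_
            split_ifs <;> simp
          rw [s1, s2, ← r1, ← r2, hA1]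
          push_cast
          ring
      _ = A1 * (∫⁻ x, ∫⁻ t in Ioi (0 : ℝ), (if t < ‖f x‖ then ‖f x‖ₑ *
            ENNReal.ofReal (t ^ (q - 2)) else 0)) +
            B * ∫⁻ x, ∫⁻ t in Ioi (0 : ℝ), (if t < ‖f x‖ then 0 else ‖f x‖ₑ ^ 2 *
              ENNReal.ofReal (t ^ (q - 3))) := by
          rw [lintegral_add_left (hm1.lintegral_prod_right'.const_mul _),
            lintegral_const_mul _ hm1.lintegral_prod_right',
            lintegral_const_mul _ hm2.lintegral_prod_right',
            sw1, sw2]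
      _ ≤ A1 * (∫⁻ x, Real.toNNReal (1 / (q - 1)) * ‖f x‖ₑ ^ q) +
            B * (∫⁻ x, Real.toNNReal (1 / (2 - q)) * ‖f x‖ₑ ^ q) := by
          refine add_le_add (mul_le_mul' le_rfl (lintegral_mono fun x => ?_))
            (mul_le_mul' le_rfl (lintegral_mono fun x => ?_))
          · have : ∀ t : ℝ, (if t < ‖f x‖ then ‖f x‖ₑ * ENNReal.ofReal (t ^ (q - 2)) else 0) =
                ‖f x‖ₑ * (if t < ‖f x‖ then ENNReal.ofReal (t ^ (q - 2)) else 0) := by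
              intro t; split_ifs <;> simp
            simp_rw [this]
            rw [lintegral_const_mul' _ _ enorm_ne_top, lint_pow_Ioo q hq _ (norm_nonneg _),
              ← ofReal_rpow_norm _ _ hq0.le, ← ofReal_norm, ← ENNReal.ofReal_mul (norm_nonneg _)]
            change _ ≤ ENNReal.ofReal _ * _
            rw [← ENNReal.ofReal_mul (by apply one_div_nonneg.2; linarith)]
            refine ENNReal.ofReal_le_ofReal (le_of_eq ?_)
            have : ‖f x‖ * ‖f x‖ ^ (q - 1) = ‖f x‖ ^ q := by
              rw [← Real.rpow_one_add' (norm_nonneg _) (by linarith)]; congr 1; ring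
            rw [← this]; ring
          · rcases eq_or_lt_of_le (norm_nonneg (f x)) with h0 | h0
            · have : f x = 0 := norm_eq_zero.1 h0.symm
              simp [this]
            have : ∀ t : ℝ, (if t < ‖f x‖ then 0 else ‖f x‖ₑ ^ 2 * ENNReal.ofReal (t ^ (q - 3))) =
                ‖f x‖ₑ ^ 2 * (if t < ‖f x‖ then 0 else ENNReal.ofReal (t ^ (q - 3))) := by
              intro t; split_ifs <;> simp
            simp_rw [this]
            rw [lintegral_const_mul' _ _ (by finiteness), lint_pow_Ioi q hq2 _ h0,
              ← ofReal_rpow_norm _ _ hq0.le, ← ofReal_norm, ← ENNReal.ofReal_pow (norm_nonneg _),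
              ← ENNReal.ofReal_mul (by positivity)]
            change _ ≤ ENNReal.ofReal _ * _
            rw [← ENNReal.ofReal_mul (by apply one_div_nonneg.2; linarith)]
            refine ENNReal.ofReal_le_ofReal (le_of_eq ?_)
            have : ‖f x‖ ^ 2 * ‖f x‖ ^ (q - 2) = ‖f x‖ ^ q := by
              rw [← Real.rpow_natCast, ← Real.rpow_add h0]; congr 1; push_cast; ring
            rw [← this]; ring
      _ = _ := by
          rw [lintegral_const_mul _ (by fun_prop), lintegral_const_mul _ (by fun_prop)]
          push_cast
          ring
  calc ENNReal.ofReal (2 ^ q) * (ENNReal.ofReal q * ∫⁻ t in Ioi (0 : ℝ),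
        volume {x | t < ‖cv K f x‖ / 2} * ENNReal.ofReal (t ^ (q - 1)))
      ≤ ENNReal.ofReal (2 ^ q) * (ENNReal.ofReal q * _) :=
        mul_le_mul' le_rfl (mul_le_mul' le_rfl key)
    _ = _ := by
        push_cast
        simp only [ENNReal.ofReal]
        ring

end HC

namespace HC

lemma NiceK.refl {d : ℕ} {K : Rd d → ℝ} (hK : NiceK K) : NiceK (fun x => K (-x)) := by
  obtain ⟨C, hC⟩ := hK.bdd
  exact ⟨hK.cont.comp continuous_neg, hK.int.comp_neg, C, fun x => hC _⟩

lemma cv_refl {d : ℕ} (K f : Rd d → ℝ) (x : Rd d) :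
    cv (fun x => K (-x)) f x = cv K (fun y => f (-y)) (-x) := by
  unfold cv
  rw [← integral_neg_eq_self]
  refine integral_congr_ae (Eventually.of_forall fun y => ?_)
  simp only
  congr 2; abel

lemma L2bd.refl {d : ℕ} {K : Rd d → ℝ} {B : ℝ≥0} (h : L2bd K B) : L2bd (fun x => K (-x)) B := by
  intro f hf
  have := h (fun y => f (-y)) hf.comp_neg
  rw [lintegral_neg_eq_self (fun y => ‖f y‖ₑ ^ 2)] at this
  refine le_trans (le_of_eq ?_) this
  rw [← lintegral_neg_eq_self]
  refine lintegral_congr fun x => ?_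
  rw [cv_refl, neg_neg]

lemma Horm.refl {d : ℕ} {K : Rd d → ℝ} {B : ℝ≥0} (h : Horm K B) : Horm (fun x => K (-x)) B := by
  intro y
  have h1 := h (-y)
  have hs : MeasurableSet {x : Rd d | 2 * ‖y‖ < ‖x‖} :=
    measurableSet_lt measurable_const measurable_norm
  rw [norm_neg] at h1
  rw [← lintegral_indicator hs] at h1 ⊢
  refine le_trans (le_of_eq ?_) h1
  rw [← lintegral_neg_eq_self]
  refine lintegral_congr fun x => ?_
  simp only [indicator, Set.mem_ofPred_eq, norm_neg, neg_sub, neg_neg, sub_neg_eq_add]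
  congr 4; abel

lemma cv_bdd {d : ℕ} {K f : Rd d → ℝ} (hK : NiceK K) (hf : Integrable f) :
    ∃ C, ∀ x, ‖cv K f x‖ ≤ C := by
  obtain ⟨C, hC⟩ := hK.bdd
  refine ⟨∫ y, C * ‖f y‖, fun x => ?_⟩
  unfold cv
  refine norm_integral_le_of_norm_le (hf.norm.const_mul C) (Eventually.of_forall fun y => ?_)
  rw [norm_mul]; exact mul_le_mul_of_nonneg_right (hC _) (norm_nonneg _)

lemma cv_int {d : ℕ} {K f : Rd d → ℝ} (hK : NiceK K) (hf : Integrable f) :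
    Integrable (cv K f) := by
  have := Integrable.integrable_convolution (ContinuousLinearMap.mul ℝ ℝ) (μ := volume) hf hK.int
  refine this.congr (Eventually.of_forall fun x => ?_)
  simp only [convolution, cv, ContinuousLinearMap.mul_apply']
  refine integral_congr_ae (Eventually.of_forall fun y => mul_comm _ _)

lemma cv_dual {d : ℕ} {K f g : Rd d → ℝ} (hK : NiceK K) (hf : Integrable f) (hg : Integrable g) :
    ∫ x, cv K f x * g x = ∫ y, f y * cv (fun x => K (-x)) g y := by
  obtain ⟨C, hC⟩ := hK.bdd
  have hKc := hK.cont
  have hi : Integrable (Function.uncurry fun x y : Rd d => K (x - y) * f y * g x)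
      (volume.prod volume) := by
    have h1 : Integrable (fun z : Rd d × Rd d => K (z.1 - z.2) * (g z.1 * f z.2))
        (volume.prod volume) := by
      refine (hg.mul_prod hf).bdd_mul (c := C) ?_ (Eventually.of_forall fun y => hC _)
      exact Continuous.aestronglyMeasurable (by fun_prop)
    refine h1.congr (Eventually.of_forall fun z => ?_)
    simp only [Function.uncurry]; ring
  have := integral_integral_swap hi
  calc ∫ x, cv K f x * g x = ∫ x, ∫ y, K (x - y) * f y * g x := by
        refine integral_congr_ae (Eventually.of_forall fun x => ?_)
        simp only [cv]; rw [← integral_mul_const]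
    _ = _ := this
    _ = _ := by
        refine integral_congr_ae (Eventually.of_forall fun y => ?_)
        simp only [cv]; rw [← integral_const_mul]
        refine integral_congr_ae (Eventually.of_forall fun x => ?_)
        simp only [neg_sub]; ring

lemma strong_gt2 {d : ℕ} {K : Rd d → ℝ} (hK : NiceK K) (q q' : ℝ) (hq : 2 ≤ q)
    (hqq : q.HolderConjugate q') (C : ℝ≥0)
    (hC : ∀ f : Rd d → ℝ, Integrable f →
      ∫⁻ x, ‖cv (fun x => K (-x)) f x‖ₑ ^ q' ≤ C * ∫⁻ x, ‖f x‖ₑ ^ q')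
    (f : Rd d → ℝ) (hf : Integrable f) :
    ∫⁻ x, ‖cv K f x‖ₑ ^ q ≤ (C ^ (q - 1) : ℝ≥0) * ∫⁻ x, ‖f x‖ₑ ^ q := by
  set h := cv K f with hh
  have hhc : Continuous h := cv_continuous hK hf
  have hhi : Integrable h := cv_int hK hf
  obtain ⟨M, hM⟩ := cv_bdd hK hf
  have hM0 : 0 ≤ M := (norm_nonneg _).trans (hM 0)
  have hq0 : 0 < q := by linarith
  have hq'0 : 0 < q' := hqq.symm.pos
  set g : Rd d → ℝ := fun x => ‖h x‖ ^ (q - 2) * h x with hg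
  have hgm : Measurable g := by
    have := hhc.measurable
    rw [hg]; fun_prop
  have hgi : Integrable g := by
    refine hhi.bdd_mul (c := M ^ (q - 2)) ?_ (Eventually.of_forall fun x => ?_)
    · have := hhc.measurable
      exact Measurable.aestronglyMeasurable (by fun_prop)
    · rw [Real.norm_of_nonneg (by positivity)]
      exact Real.rpow_le_rpow (norm_nonneg _) (hM x) (by linarith)
  have hgn : ∀ x, ‖g x‖ = ‖h x‖ ^ (q - 1) := by
    intro x
    rw [hg]; simp only [norm_mul]
    rw [Real.norm_of_nonneg (by positivity), ← Real.rpow_add_one' (norm_nonneg _) (by linarith)]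
    congr 1; ring
  have hgq : ∀ x, ‖g x‖ₑ ^ q' = ‖h x‖ₑ ^ q := by
    intro x
    rw [← ofReal_rpow_norm _ _ hq'0.le, hgn, ← ofReal_rpow_norm _ _ hq0.le,
      ← Real.rpow_mul (norm_nonneg _), hqq.sub_one_mul_conj]
  have hhg : ∀ x, h x * g x = ‖h x‖ ^ q := by
    intro x
    have e : h x * g x = ‖h x‖ ^ (q - 2) * ‖h x‖ ^ (2 : ℝ) := by
      rw [Real.rpow_two, Real.norm_eq_abs, sq_abs, hg]; simp only [Real.norm_eq_abs]; ring
    rw [e, ← Real.rpow_add' (norm_nonneg _) (by linarith)]; congr 1; ring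
  have hIntg : Integrable fun x => ‖h x‖ ^ q := by
    have : Integrable fun x => g x * h x := by
      refine hhi.bdd_mul (c := M ^ (q - 1)) hgm.aestronglyMeasurable
        (Eventually.of_forall fun x => ?_)
      rw [hgn]
      exact Real.rpow_le_rpow (norm_nonneg _) (hM x) (by linarith)
    refine this.congr (Eventually.of_forall fun x => ?_)
    simp only; rw [mul_comm, hhg]
  set X := ∫⁻ x, ‖h x‖ₑ ^ q with hX
  have hXe : X = ENNReal.ofReal (∫ x, h x * g x) := by
    simp_rw [hhg]
    rw [ofReal_integral_eq_lintegral_ofReal hIntg (Eventually.of_forall fun x => by positivity)]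
    exact lintegral_congr fun x => (ofReal_rpow_norm _ _ hq0.le).symm
  have hXt : X ≠ ⊤ := by rw [hXe]; exact ENNReal.ofReal_ne_top
  set F := ∫⁻ x, ‖f x‖ₑ ^ q with hF
  have hm2 : AEMeasurable fun y => ‖cv (fun x => K (-x)) g y‖ₑ :=
    (cv_continuous hK.refl hgi).measurable.enorm.aemeasurable
  have main : X ≤ F ^ (1 / q) * (C * X) ^ (1 / q') := by
    calc X = ENNReal.ofReal (∫ x, h x * g x) := hXe
      _ ≤ ‖∫ x, h x * g x‖ₑ := by
          rw [← ofReal_norm]; exact ENNReal.ofReal_le_ofReal (Real.le_norm_self _)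
      _ = ‖∫ y, f y * cv (fun x => K (-x)) g y‖ₑ := by rw [hh, cv_dual hK hf hgi]
      _ ≤ ∫⁻ y, ‖f y‖ₑ * ‖cv (fun x => K (-x)) g y‖ₑ := by
          refine (enorm_integral_le_lintegral_enorm _).trans (le_of_eq ?_)
          exact lintegral_congr fun y => enorm_mul _ _
      _ ≤ F ^ (1 / q) * (∫⁻ y, ‖cv (fun x => K (-x)) g y‖ₑ ^ q') ^ (1 / q') :=
          ENNReal.lintegral_mul_le_Lp_mul_Lq volume hqq hf.aestronglyMeasurable.enorm hm2
      _ ≤ F ^ (1 / q) * (C * X) ^ (1 / q') := by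
          refine mul_le_mul' le_rfl (ENNReal.rpow_le_rpow ?_ (by positivity))
          refine (hC g hgi).trans (le_of_eq ?_)
          rw [hX]; congr 1
          exact lintegral_congr fun x => hgq x
  rcases eq_or_ne X 0 with h0 | h0
  · rw [h0]; positivity
  have hp1 : X ^ (1 / q) * X ^ (1 / q') = X := by
    rw [← ENNReal.rpow_add _ _ h0 hXt, one_div, one_div, hqq.inv_add_inv_eq_one, ENNReal.rpow_one]
  have hXq0 : X ^ (1 / q') ≠ 0 := by
    simp only [ne_eq, ENNReal.rpow_eq_zero_iff, not_or, not_and_or]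
    exact ⟨Or.inl h0, Or.inl hXt⟩
  have hXqt : X ^ (1 / q') ≠ ⊤ := ENNReal.rpow_ne_top_of_nonneg (by positivity) hXt
  have m2 : X ^ (1 / q) ≤ F ^ (1 / q) * (C : ℝ≥0∞) ^ (1 / q') := by
    rw [ENNReal.mul_rpow_of_nonneg _ _ (by positivity : (0 : ℝ) ≤ 1 / q'), ← mul_assoc] at main
    nth_rewrite 1 [← hp1] at main
    exact (ENNReal.mul_le_mul_iff_left hXq0 hXqt).1 main
  have m3 := ENNReal.rpow_le_rpow m2 hq0.le
  rw [← ENNReal.rpow_mul, ENNReal.mul_rpow_of_nonneg _ _ hq0.le, ← ENNReal.rpow_mul,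
    ← ENNReal.rpow_mul, one_div_mul_cancel hq0.ne', ENNReal.rpow_one, ENNReal.rpow_one] at m3
  rw [mul_comm]
  refine m3.trans (mul_le_mul' le_rfl (le_of_eq ?_))
  have : 1 / q' * q = q - 1 := by
    have := hqq.sub_one_mul_conj
    field_simp; linarith
  rw [this, ENNReal.coe_rpow_of_nonneg _ (by linarith)]

/-- Calderon-Zygmund: uniform strong type bounds. -/
theorem strong_q {d : ℕ} (hd : 0 < d) (B : ℝ≥0) (q : ℝ) (hq : 1 < q) :
    ∃ C : ℝ≥0, ∀ K : Rd d → ℝ, NiceK K → L2bd K B → Horm K B → ∀ f : Rd d → ℝ, Integrable f →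
      ∫⁻ x, ‖cv K f x‖ₑ ^ q ≤ C * ∫⁻ x, ‖f x‖ₑ ^ q := by
  rcases lt_trichotomy q 2 with h | h | h
  · exact strong_lt2 hd B q hq h
  · refine ⟨B, fun K hK h2 hH f hf => ?_⟩
    have := h2 f hf
    rw [h]; simpa only [ENNReal.rpow_two] using this
  · have hqq : q.HolderConjugate (Real.conjExponent q) := Real.HolderConjugate.conjExponent hq
    obtain ⟨C, hC⟩ := strong_lt2 hd B (Real.conjExponent q) hqq.symm.lt (by
      rw [Real.conjExponent, div_lt_iff₀ (by linarith)]; linarith)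
    refine ⟨C ^ (q - 1), fun K hK h2 hH f hf => ?_⟩
    exact strong_gt2 hK q _ h.le hqq C (hC _ hK.refl h2.refl hH.refl) f hf

end HC

namespace HC
open scoped SchwartzMap

lemma summable_half_zpow : Summable fun k : ℤ => (1 / 2 : ℝ) ^ k.natAbs := by
  refine Summable.of_nat_of_neg ?_ ?_
  · simpa using summable_geometric_of_lt_one (r := (1 / 2 : ℝ)) (by norm_num) (by norm_num)
  · simpa using summable_geometric_of_lt_one (r := (1 / 2 : ℝ)) (by norm_num) (by norm_num)

/-- `∑_j min(2^j a, 2^{-j}/a)` is bounded. -/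
lemma sum_min_le : ∃ C : ℝ, 0 ≤ C ∧ ∀ (a : ℝ) (s : Finset ℤ), 0 < a →
    ∑ j ∈ s, min ((2 : ℝ) ^ j * a) (((2 : ℝ) ^ j * a)⁻¹) ≤ C := by
  refine ⟨2 * ∑' k : ℤ, (1 / 2 : ℝ) ^ k.natAbs, by positivity, fun a s ha => ?_⟩
  obtain ⟨n, hn1, hn2⟩ := exists_mem_Ico_zpow (y := (2 : ℝ)) ha (by norm_num)
  have hb : ∀ j : ℤ, min ((2 : ℝ) ^ j * a) (((2 : ℝ) ^ j * a)⁻¹) ≤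
      2 * (1 / 2 : ℝ) ^ (j + n).natAbs := by
    intro j
    have e1 : (2 : ℝ) ^ (j + n) ≤ 2 ^ j * a := by
      rw [zpow_add₀ (by norm_num)]; gcongr
    have e2 : 2 ^ j * a ≤ 2 * (2 : ℝ) ^ (j + n) := by
      rw [← zpow_one_add₀ (by norm_num), show 1 + (j + n) = j + (n + 1) by ring,
        zpow_add₀ (by norm_num)]
      gcongr
    rcases le_total 0 (j + n) with h | h
    · obtain ⟨m, hm⟩ := Int.eq_ofNat_of_zero_le h
      refine (min_le_right _ _).trans ?_
      rw [hm] at e1 ⊢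
      simp only [zpow_natCast, Int.natAbs_natCast] at e1 ⊢
      rw [one_div, inv_pow]
      have : (2 ^ j * a)⁻¹ ≤ ((2 : ℝ) ^ m)⁻¹ := inv_anti₀ (by positivity) e1
      have h0 : (0 : ℝ) ≤ ((2 : ℝ) ^ m)⁻¹ := by positivity
      linarith
    · obtain ⟨m, hm⟩ := Int.eq_ofNat_of_zero_le (neg_nonneg.2 h)
      have hm' : j + n = -(m : ℤ) := by simp at hm; linarith
      refine (min_le_left _ _).trans (e2.trans (le_of_eq ?_))
      rw [hm']; simp
  calc ∑ j ∈ s, min ((2 : ℝ) ^ j * a) (((2 : ℝ) ^ j * a)⁻¹)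
      ≤ ∑ j ∈ s, 2 * (1 / 2 : ℝ) ^ (j + n).natAbs := Finset.sum_le_sum fun j _ => hb j
    _ = 2 * ∑ j ∈ s, (1 / 2 : ℝ) ^ (j + n).natAbs := by rw [Finset.mul_sum]
    _ = 2 * ∑ k ∈ s.map (Equiv.addRight n).toEmbedding, (1 / 2 : ℝ) ^ k.natAbs := by
        rw [Finset.sum_map]; rfl
    _ ≤ _ := by
        gcongr
        exact summable_half_zpow.sum_le_tsum _ fun i _ => by positivity

/-- the truncated sum of dilates -/
def KJ {d : ℕ} (J : ℕ) (k : Rd d → ℝ) (x : Rd d) : ℝ :=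
  ∑ j ∈ Finset.Icc (-(J : ℤ)) J, ((2 : ℝ) ^ j) ^ d * k ((2 : ℝ) ^ j • x)

lemma lintegral_dil {d : ℕ} (R : ℝ) (hR : 0 < R) (F : Rd d → ℝ≥0∞) (hF : Measurable F) :
    ∫⁻ x, ENNReal.ofReal (R ^ d) * F (R • x) = ∫⁻ x, F x := by
  have h := Measure.map_addHaar_smul (volume : Measure (Rd d)) hR.ne'
  have hm : Measurable (fun x : Rd d => R • x) := measurable_const_smul R
  have hFm : Measurable fun x => F (R • x) := hF.comp hm
  rw [lintegral_const_mul _ hFm, ← lintegral_map hF hm, h, lintegral_smul_measure,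
    smul_eq_mul, ← mul_assoc, ← ENNReal.ofReal_mul (by positivity)]
  rw [Module.finrank_fin_fun, abs_of_pos (by positivity), mul_inv_cancel₀ (by positivity),
    ENNReal.ofReal_one, one_mul]

lemma schwartz_fderiv_decay {d : ℕ} (k : 𝓢(Rd d, ℝ)) (n : ℕ) :
    ∃ C : ℝ, 0 ≤ C ∧ ∀ x, ‖fderiv ℝ k x‖ * (1 + ‖x‖) ^ n ≤ C := by
  have h := fun x => SchwartzMap.one_add_le_sup_seminorm_apply (𝕜 := ℝ) (m := (n, 1)) (k := n)
    (n := 1) le_rfl le_rfl k x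
  simp only [norm_iteratedFDeriv_one, mul_comm ((1 + ‖_‖) ^ n)] at h
  exact ⟨_, le_trans (by positivity) (h 0), h⟩

lemma schwartz_horm_pt {d : ℕ} (k : 𝓢(Rd d, ℝ)) :
    ∃ C : ℝ, 0 ≤ C ∧ ∀ u x : Rd d, 2 * ‖u‖ < ‖x‖ →
      ‖k (x - u) - k x‖ ≤ C * ‖u‖ * ((1 + ‖u‖) ^ 2)⁻¹ * ((1 + ‖x‖) ^ (d + 1))⁻¹ := by
  obtain ⟨C, hC0, hC⟩ := schwartz_fderiv_decay k (d + 3)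
  refine ⟨C * 2 ^ (d + 1), by positivity, fun u x hux => ?_⟩
  have hu0 := norm_nonneg u
  have hs : ∀ z ∈ segment ℝ x (x - u), ‖fderiv ℝ k z‖ ≤
      C * 2 ^ (d + 1) * ((1 + ‖u‖) ^ 2)⁻¹ * ((1 + ‖x‖) ^ (d + 1))⁻¹ := by
    intro z hz
    have hz1 : ‖z - x‖ ≤ ‖u‖ := by
      have := norm_sub_le_of_mem_segment hz
      simpa using this
    have hz2 : ‖x‖ - ‖u‖ ≤ ‖z‖ := by
      have := norm_sub_norm_le x (x - z)
      rw [sub_sub_cancel, norm_sub_rev x z] at this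
      linarith
    have a1 : 1 + ‖u‖ ≤ 1 + ‖z‖ := by linarith
    have a2 : (1 + ‖x‖) ≤ 2 * (1 + ‖z‖) := by linarith
    have a3 : (1 + ‖u‖) ^ 2 * (1 + ‖x‖) ^ (d + 1) ≤ 2 ^ (d + 1) * (1 + ‖z‖) ^ (d + 3) := by
      calc (1 + ‖u‖) ^ 2 * (1 + ‖x‖) ^ (d + 1) ≤ (1 + ‖z‖) ^ 2 * (2 * (1 + ‖z‖)) ^ (d + 1) := by
            gcongr
        _ = _ := by rw [mul_pow]; ring
    rw [mul_assoc, ← mul_inv, ← div_eq_mul_inv, le_div_iff₀ (by positivity)]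
    calc ‖fderiv ℝ k z‖ * ((1 + ‖u‖) ^ 2 * (1 + ‖x‖) ^ (d + 1))
        ≤ ‖fderiv ℝ k z‖ * (2 ^ (d + 1) * (1 + ‖z‖) ^ (d + 3)) := by gcongr
      _ = 2 ^ (d + 1) * (‖fderiv ℝ k z‖ * (1 + ‖z‖) ^ (d + 3)) := by ring
      _ ≤ 2 ^ (d + 1) * C := by gcongr; exact hC z
      _ = _ := by ring
  have := (convex_segment (𝕜 := ℝ) x (x - u)).norm_image_sub_le_of_norm_fderiv_le
    (fun z _ => k.differentiableAt) hs (left_mem_segment ℝ _ _) (right_mem_segment ℝ _ _)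
  refine this.trans (le_of_eq ?_)
  rw [sub_sub_cancel_left, norm_neg]; ring

lemma kj_horm {d : ℕ} (k : 𝓢(Rd d, ℝ)) : ∃ B : ℝ≥0, ∀ J, Horm (KJ J k) B := by
  obtain ⟨C, hC0, hC⟩ := schwartz_horm_pt k
  obtain ⟨S, hS0, hS⟩ := sum_min_le
  have hIntg : Integrable fun x : Rd d => (1 + ‖x‖) ^ (-((d + 1 : ℕ) : ℝ)) :=
    integrable_one_add_norm (by rw [Module.finrank_fin_fun]; push_cast; linarith)
  set I := ∫ x : Rd d, (1 + ‖x‖) ^ (-((d + 1 : ℕ) : ℝ)) with hI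
  have hI0 : 0 ≤ I := integral_nonneg fun x => by positivity
  refine ⟨Real.toNNReal (C * I * S), fun J y => ?_⟩
  rcases eq_or_ne y 0 with rfl | hy
  · simp
  have hy' : 0 < ‖y‖ := norm_pos_iff.2 hy
  have hset : MeasurableSet {x : Rd d | 2 * ‖y‖ < ‖x‖} :=
    measurableSet_lt measurable_const measurable_norm
  -- one scale
  have one : ∀ j : ℤ, ∫⁻ x in {x : Rd d | 2 * ‖y‖ < ‖x‖},
      ENNReal.ofReal (((2 : ℝ) ^ j) ^ d) * ‖k ((2 : ℝ) ^ j • (x - y)) - k ((2 : ℝ) ^ j • x)‖ₑ ≤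
      ENNReal.ofReal (C * I * min ((2 : ℝ) ^ j * ‖y‖) (((2 : ℝ) ^ j * ‖y‖)⁻¹)) := by
    intro j
    set R := (2 : ℝ) ^ j with hR
    have hR0 : 0 < R := by positivity
    set u := R • y with hu
    have hun : ‖u‖ = R * ‖y‖ := by rw [hu, norm_smul, Real.norm_of_nonneg hR0.le]
    have hu0 : 0 < ‖u‖ := by rw [hun]; positivity
    set F : Rd d → ℝ≥0∞ := fun x => {x : Rd d | 2 * ‖u‖ < ‖x‖}.indicator
      (fun x => ‖k (x - u) - k x‖ₑ) x with hF
    have hkc := k.continuous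
    have hsu : MeasurableSet {x : Rd d | 2 * ‖u‖ < ‖x‖} :=
      measurableSet_lt measurable_const measurable_norm
    have hFm : Measurable F := by
      refine Measurable.indicator ?_ hsu
      exact (Continuous.measurable (by fun_prop)).enorm
    rw [← lintegral_indicator hset]
    have e1 : ∀ x, {x : Rd d | 2 * ‖y‖ < ‖x‖}.indicator (fun x => ENNReal.ofReal (R ^ d) *
        ‖k (R • (x - y)) - k (R • x)‖ₑ) x = ENNReal.ofReal (R ^ d) * F (R • x) := by
      intro x
      have : (2 * ‖u‖ < ‖R • x‖) ↔ (2 * ‖y‖ < ‖x‖) := by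
        rw [hun, norm_smul, Real.norm_of_nonneg hR0.le, mul_left_comm, mul_lt_mul_iff_right₀ hR0]
      have e2 : R • (x - y) = R • x - u := by rw [smul_sub]
      simp only [hF, indicator, Set.mem_ofPred_eq, this, e2]
      split_ifs <;> simp
    simp_rw [e1]
    rw [lintegral_dil R hR0 F hFm]
    have hb : ∀ x, F x ≤ ENNReal.ofReal (C * min (R * ‖y‖) ((R * ‖y‖)⁻¹) *
        (1 + ‖x‖) ^ (-((d + 1 : ℕ) : ℝ))) := by
      intro x
      simp only [hF, indicator, Set.mem_ofPred_eq]
      split_ifs with h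
      · rw [← ofReal_norm]
        refine ENNReal.ofReal_le_ofReal ((hC u x h).trans ?_)
        rw [Real.rpow_neg (by positivity), Real.rpow_natCast, ← hun]
        refine mul_le_mul_of_nonneg_right ?_ (by positivity)
        rw [mul_assoc]
        refine mul_le_mul_of_nonneg_left ?_ hC0
        rw [le_min_iff, ← div_eq_mul_inv]
        constructor
        · exact div_le_self hu0.le (one_le_pow₀ (by linarith))
        · rw [div_le_iff₀ (by positivity), ← div_eq_inv_mul, le_div_iff₀ hu0]
          nlinarith
      · exact zero_le
    refine (lintegral_mono hb).trans ?_
    rw [← ofReal_integral_eq_lintegral_ofReal (hIntg.const_mul _)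
      (Eventually.of_forall fun x => by positivity), integral_const_mul]
    refine ENNReal.ofReal_le_ofReal (le_of_eq ?_)
    rw [← hI]; ring
  calc ∫⁻ x in {x : Rd d | 2 * ‖y‖ < ‖x‖}, ‖KJ J k (x - y) - KJ J k x‖ₑ
      ≤ ∫⁻ x in {x : Rd d | 2 * ‖y‖ < ‖x‖}, ∑ j ∈ Finset.Icc (-(J : ℤ)) J,
        ENNReal.ofReal (((2 : ℝ) ^ j) ^ d) * ‖k ((2 : ℝ) ^ j • (x - y)) - k ((2 : ℝ) ^ j • x)‖ₑ := by
        refine lintegral_mono fun x => ?_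
        simp only [KJ]
        rw [← Finset.sum_sub_distrib]
        refine (enorm_sum_le _ _).trans (Finset.sum_le_sum fun j _ => le_of_eq ?_)
        rw [← mul_sub, enorm_mul, Real.enorm_of_nonneg (by positivity)]
    _ = ∑ j ∈ Finset.Icc (-(J : ℤ)) J, ∫⁻ x in {x : Rd d | 2 * ‖y‖ < ‖x‖},
        ENNReal.ofReal (((2 : ℝ) ^ j) ^ d) * ‖k ((2 : ℝ) ^ j • (x - y)) - k ((2 : ℝ) ^ j • x)‖ₑ := by
        refine lintegral_finsetSum _ fun j _ => ?_
        have hkc := k.continuous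
        exact ((Continuous.measurable (by fun_prop)).enorm).const_mul _
    _ ≤ ∑ j ∈ Finset.Icc (-(J : ℤ)) J,
        ENNReal.ofReal (C * I * min ((2 : ℝ) ^ j * ‖y‖) (((2 : ℝ) ^ j * ‖y‖)⁻¹)) :=
        Finset.sum_le_sum fun j _ => one j
    _ = ENNReal.ofReal (C * I * ∑ j ∈ Finset.Icc (-(J : ℤ)) J,
          min ((2 : ℝ) ^ j * ‖y‖) (((2 : ℝ) ^ j * ‖y‖)⁻¹)) := by
        rw [Finset.mul_sum, ENNReal.ofReal_sum_of_nonneg fun j _ => by positivity]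
    _ ≤ _ := by
        change _ ≤ ENNReal.ofReal _
        refine ENNReal.ofReal_le_ofReal ?_
        exact mul_le_mul_of_nonneg_left (hS _ _ hy') (by positivity)

lemma kj_nice {d : ℕ} (J : ℕ) (k : 𝓢(Rd d, ℝ)) : NiceK (KJ J k) := by
  have hkc := k.continuous
  refine ⟨?_, ?_, ?_⟩
  · unfold KJ; fun_prop
  · unfold KJ
    refine integrable_finsetSum _ fun j _ => ?_
    exact ((integrable_comp_smul_iff volume (k : Rd d → ℝ) (by positivity)).2 k.integrable).const_mul _
  · obtain ⟨C, hC⟩ : ∃ C, ∀ x, ‖k x‖ ≤ C := ⟨_, fun x => SchwartzMap.norm_le_seminorm ℝ k x⟩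
    refine ⟨∑ j ∈ Finset.Icc (-(J : ℤ)) J, ((2 : ℝ) ^ j) ^ d * C, fun x => ?_⟩
    unfold KJ
    refine (norm_sum_le _ _).trans (Finset.sum_le_sum fun j _ => ?_)
    rw [norm_mul, Real.norm_of_nonneg (by positivity)]
    gcongr; exact hC _

end HC

namespace HC
open scoped SchwartzMap FourierTransform

abbrev Ed (d : ℕ) := EuclideanSpace ℝ (Fin d)

lemma cplx_L2_schwartz {d : ℕ} (κ f : 𝓢(Ed d, ℂ)) (C : ℝ) (hC : ∀ w, ‖𝓕 κ w‖ ≤ C) :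
    ∫⁻ x, ‖∫ y, κ (x - y) * f y‖ₑ ^ (2:ℝ) ≤ ENNReal.ofReal (C ^ 2) * ∫⁻ x, ‖f x‖ₑ ^ (2:ℝ) := by
  set c := SchwartzMap.convolution (ContinuousLinearMap.mul ℂ ℂ) f κ with hc
  have h1 : ∀ x, c x = ∫ y, κ (x - y) * f y := by
    intro x
    rw [hc, SchwartzMap.convolution_apply]
    simp only [MeasureTheory.convolution, ContinuousLinearMap.mul_apply']
    congr 1; ext y; ring
  have hl : ∀ g : 𝓢(Ed d, ℂ), ∫⁻ x, ‖g x‖ₑ ^ (2:ℝ) = ENNReal.ofReal (∫ x, ‖g x‖ ^ 2) := by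
    intro g
    rw [ofReal_integral_eq_lintegral_ofReal]
    · refine lintegral_congr fun x => ?_
      rw [← ofReal_norm, ENNReal.ofReal_rpow_of_nonneg (norm_nonneg _) (by norm_num)]; norm_num
    · have := (g.memLp 2 (μ := volume)).integrable_norm_pow (by norm_num)
      simpa using this
    · exact Eventually.of_forall fun x => by positivity
  simp_rw [← h1]
  rw [hl, hl, ← ENNReal.ofReal_mul (by positivity)]
  apply ENNReal.ofReal_le_ofReal
  rw [← SchwartzMap.integral_norm_sq_fourier, ← SchwartzMap.integral_norm_sq_fourier f,
    ← integral_const_mul]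
  refine integral_mono ?_ ?_ ?_
  · have := ((𝓕 c).memLp 2 (μ := volume)).integrable_norm_pow (by norm_num)
    simpa using this
  · have := ((𝓕 f).memLp 2 (μ := volume)).integrable_norm_pow (by norm_num)
    exact (by simpa using this : Integrable (fun x => ‖𝓕 f x‖ ^ 2)).const_mul _
  · intro x
    have : 𝓕 c x = 𝓕 f x * 𝓕 κ x := by
      rw [hc, SchwartzMap.fourier_convolution_apply, Real.fourier_mul_convolution_eq f.integrable κ.integrable]
      rfl
    simp only [this, norm_mul, mul_pow]
    rw [mul_comm]
    have := hC x
    gcongr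

lemma cplx_L2 {d : ℕ} (κ : 𝓢(Ed d, ℂ)) (C : ℝ) (hC : ∀ w, ‖𝓕 κ w‖ ≤ C) (f : Ed d → ℂ)
    (hf : MemLp f 2) :
    ∫⁻ x, ‖∫ y, κ (x - y) * f y‖ₑ ^ (2:ℝ) ≤ ENNReal.ofReal (C ^ 2) * ∫⁻ x, ‖f x‖ₑ ^ (2:ℝ) := by
  have happ : ∀ n : ℕ, ∃ g : 𝓢(Ed d, ℂ), eLpNorm (f - ⇑g) 2 volume ≤ ENNReal.ofReal (1 / ((n:ℝ) + 1)) := by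
    intro n
    obtain ⟨g, hg₁, hg₂, hg₃⟩ := hf.exist_eLpNorm_sub_le (by norm_num) (by norm_num) (show (0:ℝ) < 1 / ((n:ℝ) + 1) by positivity)
    exact ⟨hg₁.toSchwartzMap hg₂, hg₃⟩
  choose g hg using happ
  have hg0 : Tendsto (fun n => eLpNorm (f - ⇑(g n)) 2 volume) atTop (𝓝 0) := by
    refine tendsto_of_tendsto_of_tendsto_of_le_of_le tendsto_const_nhds ?_ (fun _ => zero_le) hg
    rw [← ENNReal.ofReal_zero]
    exact ENNReal.tendsto_ofReal tendsto_one_div_add_atTop_nhds_zero_nat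
  have hsq : ∀ h : Ed d → ℂ, ∫⁻ x, ‖h x‖ₑ ^ (2:ℝ) = (eLpNorm h 2 volume) ^ (2:ℝ) := by
    intro h
    rw [eLpNorm_eq_lintegral_rpow_enorm_toReal (by norm_num) (by norm_num)]
    simp only [ENNReal.toReal_ofNat]
    rw [← ENNReal.rpow_mul]; norm_num
  have hpt : ∀ x, Tendsto (fun n => ∫ y, κ (x - y) * g n y) atTop (𝓝 (∫ y, κ (x - y) * f y)) := by
    intro x
    have hκ : MemLp (fun y => κ (x - y)) 2 volume := by
      exact (κ.memLp 2 (μ := volume)).comp_measurePreserving (Measure.measurePreserving_sub_left volume x)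
    rw [tendsto_iff_edist_tendsto_0]
    have hb : ∀ n, edist (∫ y, κ (x - y) * g n y) (∫ y, κ (x - y) * f y) ≤
        eLpNorm (fun y => κ (x - y)) 2 volume * eLpNorm (f - ⇑(g n)) 2 volume := by
      intro n
      have hi1 : Integrable (fun y => κ (x - y) * g n y) := hκ.integrable_mul ((g n).memLp 2)
      have hi2 : Integrable (fun y => κ (x - y) * f y) := hκ.integrable_mul hf
      rw [edist_comm, edist_eq_enorm_sub, ← integral_sub hi2 hi1]
      refine (enorm_integral_le_lintegral_enorm _).trans ?_
      have := eLpNorm_le_eLpNorm_mul_eLpNorm_of_nnnorm (p := 2) (q := 2) (r := 1) (μ := volume) hκ.1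
        (hf.1.sub (g n).continuous.aestronglyMeasurable) (fun a b => a * b) 1 (by
          refine Eventually.of_forall fun y => ?_
          simp) 
      rw [eLpNorm_one_eq_lintegral_enorm] at this
      simpa [mul_sub] using this
    have hz : Tendsto (fun n => eLpNorm (fun y => κ (x - y)) 2 volume * eLpNorm (f - ⇑(g n)) 2 volume) atTop (𝓝 0) := by
      have := ENNReal.Tendsto.const_mul hg0 (Or.inr hκ.2.ne)
      simpa using this
    exact tendsto_of_tendsto_of_tendsto_of_le_of_le tendsto_const_nhds hz (fun _ => zero_le) hb
  have hmeas : ∀ n, Measurable fun x => ‖∫ y, κ (x - y) * g n y‖ₑ ^ (2:ℝ) := by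
    intro n
    have : (fun x => ∫ y, κ (x - y) * g n y) = fun x => SchwartzMap.convolution (ContinuousLinearMap.mul ℂ ℂ) (g n) κ x := by
      ext x
      rw [SchwartzMap.convolution_apply]
      simp only [MeasureTheory.convolution, ContinuousLinearMap.mul_apply']
      congr 1; ext y; ring
    have h2 : Continuous (fun x => ∫ y, κ (x - y) * g n y) := by
      rw [this]; exact SchwartzMap.continuous _
    exact (h2.enorm.measurable).pow_const _
  calc ∫⁻ x, ‖∫ y, κ (x - y) * f y‖ₑ ^ (2:ℝ)
      = ∫⁻ x, liminf (fun n => ‖∫ y, κ (x - y) * g n y‖ₑ ^ (2:ℝ)) atTop := by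
        refine lintegral_congr fun x => ?_
        exact (((ENNReal.continuous_rpow_const).tendsto _).comp ((hpt x).enorm)).liminf_eq.symm
    _ ≤ liminf (fun n => ∫⁻ x, ‖∫ y, κ (x - y) * g n y‖ₑ ^ (2:ℝ)) atTop := lintegral_liminf_le hmeas
    _ ≤ liminf (fun n => ENNReal.ofReal (C ^ 2) * (eLpNorm f 2 volume + eLpNorm (f - ⇑(g n)) 2 volume) ^ (2:ℝ)) atTop := by
        refine liminf_le_liminf (Eventually.of_forall fun n => ?_)
        refine (cplx_L2_schwartz κ (g n) C hC).trans ?_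
        rw [hsq]
        refine mul_le_mul' le_rfl (ENNReal.rpow_le_rpow ?_ (by norm_num))
        have : (g n : Ed d → ℂ) = f - (f - ⇑(g n)) := by simp
        rw [this]
        refine (eLpNorm_sub_le hf.1 (hf.1.sub (g n).continuous.aestronglyMeasurable) (by norm_num)).trans ?_
        simp
    _ = ENNReal.ofReal (C ^ 2) * ∫⁻ x, ‖f x‖ₑ ^ (2:ℝ) := by
        rw [hsq]
        refine Tendsto.liminf_eq ?_
        refine ENNReal.Tendsto.const_mul ?_ (Or.inr ENNReal.ofReal_ne_top)
        have := (tendsto_const_nhds (x := eLpNorm f 2 volume) (f := atTop (α := ℕ))).add hg0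
        rw [add_zero] at this
        exact ((ENNReal.continuous_rpow_const).tendsto _).comp this

/-- the dilate `r^d κ(r ·)` -/
def dilS {d : ℕ} (r : ℝ) (hr : r ≠ 0) (κ : 𝓢(Ed d, ℂ)) : 𝓢(Ed d, ℂ) :=
  ((r : ℂ) ^ d) • SchwartzMap.compCLMOfContinuousLinearEquiv ℂ
    (ContinuousLinearEquiv.smulLeft (R₁ := ℝ) (M₁ := Ed d) (Units.mk0 r hr)) κ

lemma dilS_apply {d : ℕ} (r : ℝ) (hr : r ≠ 0) (κ : 𝓢(Ed d, ℂ)) (x : Ed d) :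
    dilS r hr κ x = (r : ℂ) ^ d * κ (r • x) := rfl

lemma fourier_dilS {d : ℕ} (r : ℝ) (hr : 0 < r) (κ : 𝓢(Ed d, ℂ)) (w : Ed d) :
    𝓕 (dilS r hr.ne' κ) w = 𝓕 κ (r⁻¹ • w) := by
  rw [SchwartzMap.fourier_coe, SchwartzMap.fourier_coe, Real.fourier_eq, Real.fourier_eq]
  have h := Measure.integral_comp_smul (volume : Measure (Ed d))
    (fun v => Real.fourierChar (-inner ℝ v (r⁻¹ • w)) • κ v) r
  have h2 : ∀ v : Ed d, Real.fourierChar (-inner ℝ v w) • dilS r hr.ne' κ v =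
      ((r : ℂ) ^ d) • (Real.fourierChar (-inner ℝ (r • v) (r⁻¹ • w)) • κ (r • v)) := by
    intro v
    rw [dilS_apply]
    have : inner ℝ (r • v) (r⁻¹ • w) = inner ℝ v w := by
      rw [inner_smul_left, inner_smul_right]; simp; field_simp
    rw [this]
    simp only [Circle.smul_def, smul_eq_mul]; ring
  simp_rw [h2]
  rw [integral_smul, h, finrank_euclideanSpace_fin, abs_of_pos (by positivity)]
  have hr' : ((r:ℂ)^d) ≠ 0 := pow_ne_zero _ (by exact_mod_cast hr.ne')
  rw [Complex.real_smul, smul_eq_mul, ← mul_assoc]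
  push_cast
  rw [mul_inv_cancel₀ hr', one_mul]

def rkS {d : ℕ} (κ : 𝓢(Ed d, ℂ)) : 𝓢(Rd d, ℝ) :=
  SchwartzMap.postcompCLM Complex.reCLM
    (SchwartzMap.compCLMOfContinuousLinearEquiv ℝ
      (PiLp.continuousLinearEquiv 2 ℝ (fun _ : Fin d => ℝ)).symm κ)

lemma rkS_apply {d : ℕ} (κ : 𝓢(Ed d, ℂ)) (x : Rd d) : rkS κ x = (κ (WithLp.toLp 2 x)).re := rfl

def kapJ {d : ℕ} (J : ℕ) (κ : 𝓢(Ed d, ℂ)) : 𝓢(Ed d, ℂ) :=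
  ∑ j ∈ Finset.Icc (-(J : ℤ)) J, dilS ((2 : ℝ) ^ j) (by positivity) κ

lemma kj_rkS {d : ℕ} (J : ℕ) (κ : 𝓢(Ed d, ℂ)) (x : Rd d) :
    KJ J (rkS κ) x = (kapJ J κ (WithLp.toLp 2 x)).re := by
  unfold KJ kapJ
  rw [_root_.sum_apply, Complex.re_sum]
  refine Finset.sum_congr rfl fun j _ => ?_
  rw [dilS_apply, rkS_apply, ← Complex.ofReal_pow, Complex.re_ofReal_mul]
  rfl

lemma kj_L2bd {d : ℕ} (κ : 𝓢(Ed d, ℂ)) (C0 : ℝ) (hC0 : 0 ≤ C0)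
    (h : ∀ w, ‖𝓕 κ w‖ ≤ C0 * min ‖w‖ ‖w‖⁻¹) : ∃ B : ℝ≥0, ∀ J, L2bd (KJ J (rkS κ)) B := by
  obtain ⟨C, hC, hs⟩ := sum_min_le
  have hF : ∀ J w, ‖𝓕 (kapJ J κ) w‖ ≤ C0 * C := by
    intro J w
    have : 𝓕 (kapJ J κ) w = ∑ j ∈ Finset.Icc (-(J : ℤ)) J, 𝓕 κ (((2:ℝ)^j)⁻¹ • w) := by
      unfold kapJ
      have := map_sum (FourierTransform.fourierCLM ℂ 𝓢(Ed d, ℂ)) (fun j : ℤ => dilS ((2 : ℝ) ^ j) (by positivity) κ) (Finset.Icc (-(J : ℤ)) J)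
      simp only [FourierTransform.fourierCLM_apply] at this
      rw [this, _root_.sum_apply]
      exact Finset.sum_congr rfl fun j _ => fourier_dilS _ (by positivity) _ _
    rw [this]
    refine (norm_sum_le _ _).trans ?_
    rcases eq_or_ne w 0 with rfl | hw
    · have : 𝓕 κ (0 : Ed d) = 0 := by simpa using h 0
      simp [this]; positivity
    · have hw' : 0 < ‖w‖⁻¹ := by positivity
      refine le_trans ?_ (mul_le_mul_of_nonneg_left (hs ‖w‖⁻¹ (Finset.Icc (-(J : ℤ)) J) hw') hC0)
      rw [Finset.mul_sum]
      refine Finset.sum_le_sum fun j _ => (h _).trans_eq ?_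
      rw [norm_smul, norm_inv, Real.norm_of_nonneg (by positivity : (0:ℝ) ≤ 2^j), min_comm]
      congr 1
      rw [mul_inv, mul_inv, inv_inv, inv_inv]
  refine ⟨Real.toNNReal ((C0 * C) ^ 2) + 1, fun J f hf => ?_⟩
  by_cases htop : ∫⁻ x, ‖f x‖ₑ ^ 2 = ∞
  · rw [htop, ENNReal.mul_top (by simp)]; exact le_top
  have hmp := PiLp.volume_preserving_toLp (Fin d)
  have hmp' := PiLp.volume_preserving_ofLp (Fin d)
  set F : Ed d → ℂ := fun x => (f (WithLp.ofLp x) : ℂ) with hFd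
  have hFm : AEStronglyMeasurable F volume :=
    Complex.continuous_ofReal.comp_aestronglyMeasurable (hf.1.comp_measurePreserving hmp')
  have hFl : ∫⁻ x, ‖F x‖ₑ ^ (2:ℝ) = ∫⁻ x, ‖f x‖ₑ ^ 2 := by
    rw [← hmp.lintegral_comp_emb (MeasurableEquiv.toLp 2 _).measurableEmbedding]
    refine lintegral_congr fun x => ?_
    simp only [hFd]
    rw [← ofReal_norm, ← ofReal_norm, Complex.norm_real]; norm_num
  have hF2 : MemLp F 2 := by
    refine ⟨hFm, ?_⟩
    rw [eLpNorm_lt_top_iff_lintegral_rpow_enorm_lt_top (by norm_num) (by norm_num)]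
    simp only [ENNReal.toReal_ofNat]
    rw [hFl]; exact lt_top_iff_ne_top.2 htop
  have hmain := cplx_L2 (kapJ J κ) _ (hF J) F hF2
  rw [hFl, ← hmp.lintegral_comp_emb (MeasurableEquiv.toLp 2 _).measurableEmbedding] at hmain
  have hle : ∀ x : Rd d, ‖cv (KJ J (rkS κ)) f x‖ₑ ^ 2 ≤
      ‖∫ y, kapJ J κ (WithLp.toLp 2 x - y) * F y‖ₑ ^ (2:ℝ) := by
    intro x
    have hi : Integrable (fun y => kapJ J κ (WithLp.toLp 2 x - y) * F y) := by
      have hκ : MemLp (fun y => kapJ J κ (WithLp.toLp 2 x - y)) 2 volume :=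
        ((kapJ J κ).memLp 2 (μ := volume)).comp_measurePreserving (Measure.measurePreserving_sub_left volume _)
      exact hκ.integrable_mul hF2
    have : cv (KJ J (rkS κ)) f x = (∫ y, kapJ J κ (WithLp.toLp 2 x - y) * F y).re := by
      have h1 := integral_re hi
      simp only [RCLike.re_eq_complex_re] at h1
      rw [← h1, ← hmp.integral_comp (MeasurableEquiv.toLp 2 _).measurableEmbedding]
      unfold cv
      congr 1; ext y
      simp only [hFd, Complex.re_mul_ofReal, kj_rkS, WithLp.toLp_sub]
    rw [this]
    rw [show (2:ℝ) = ((2:ℕ):ℝ) by norm_num, ENNReal.rpow_natCast]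
    refine pow_le_pow_left' ?_ 2
    rw [← ofReal_norm, ← ofReal_norm]
    exact ENNReal.ofReal_le_ofReal (Complex.abs_re_le_norm _)
  calc _ ≤ _ := lintegral_mono hle
    _ ≤ _ := hmain
    _ ≤ _ := by
      refine mul_le_mul' ?_ le_rfl
      rw [ENNReal.ofReal]
      exact_mod_cast le_self_add

end HC

namespace HC
open scoped SchwartzMap FourierTransform ContDiff Manifold

/-- symbol as continuous linear map depending on a Euclidean frequency -/
def sym {d N M : ℕ} (A : Fin d → (Vec N →ₗ[ℝ] Vec M)) (w : Ed d) : Vec N →L[ℝ] Vec M :=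
  ∑ i, w i • LinearMap.toContinuousLinearMap (A i)

lemma sym_apply {d N M : ℕ} (A : Fin d → (Vec N →ₗ[ℝ] Vec M)) (w : Ed d) (ξ : Vec N) :
    sym A w ξ = ∑ i, w i • A i ξ := by
  simp [sym]

lemma sym_symb {d N M : ℕ} (A : Fin d → (Vec N →ₗ[ℝ] Vec M)) (w : Ed d) :
    (sym A w : Vec N →ₗ[ℝ] Vec M) = symb A (WithLp.ofLp w) := by
  ext1 ξ
  simp [sym, symb]

lemma sym_contDiff {d N M : ℕ} (A : Fin d → (Vec N →ₗ[ℝ] Vec M)) : ContDiff ℝ ∞ (sym A) := by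
  unfold sym
  refine ContDiff.sum fun i _ => ?_
  exact (by fun_prop : ContDiff ℝ ∞ (fun w : Ed d => w i)).smul contDiff_const

lemma ginv_alg {N M r : ℕ} (T : Vec N →L[ℝ] Vec M) (U : Vec r →L[ℝ] Vec N) (S : Vec M →L[ℝ] Vec r)
    (hr : Module.finrank ℝ (LinearMap.range (T : Vec N →ₗ[ℝ] Vec M)) = r)
    (hu : IsUnit (S ∘L T ∘L U)) :
    T ∘L (U ∘L Ring.inverse (S ∘L T ∘L U) ∘L S) ∘L T = T := by
  set G := S ∘L T ∘L U with hG
  have h1 : G * Ring.inverse G = 1 := Ring.mul_inverse_cancel _ hu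
  have h2 : Ring.inverse G * G = 1 := Ring.inverse_mul_cancel _ hu
  have e1 : ∀ x, S (T (U (Ring.inverse G x))) = x := fun x => by
    have := DFunLike.congr_fun h1 x; simpa [hG] using this
  have e2 : ∀ x, Ring.inverse G (S (T (U x))) = x := fun x => by
    have := DFunLike.congr_fun h2 x; simpa [hG] using this
  set ST : Vec N →ₗ[ℝ] Vec r := ((S ∘L T : Vec N →L[ℝ] Vec r) : Vec N →ₗ[ℝ] Vec r) with hST
  have hsurj : LinearMap.range ST = ⊤ := by
    rw [LinearMap.range_eq_top]
    intro x
    exact ⟨U (Ring.inverse G x), e1 x⟩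
  have hker : LinearMap.ker (T : Vec N →ₗ[ℝ] Vec M) = LinearMap.ker ST := by
    refine Submodule.eq_of_le_of_finrank_eq ?_ ?_
    · intro x hx
      simp only [LinearMap.mem_ker, ContinuousLinearMap.coe_coe] at hx
      simp [hST, hx]
    · have a1 := LinearMap.finrank_range_add_finrank_ker (T : Vec N →ₗ[ℝ] Vec M)
      have a2 := LinearMap.finrank_range_add_finrank_ker ST
      rw [hsurj, finrank_top, Module.finrank_fin_fun] at a2
      omega
  ext1 x
  have hx : x - U (Ring.inverse G (S (T x))) ∈ LinearMap.ker ST := by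
    simp [hST, e1]
  rw [← hker] at hx
  simp only [LinearMap.mem_ker, map_sub, ContinuousLinearMap.coe_coe, sub_eq_zero] at hx
  simpa using hx.symm

lemma ginv_exists {N M r : ℕ} (T : Vec N →L[ℝ] Vec M)
    (hr : Module.finrank ℝ (LinearMap.range (T : Vec N →ₗ[ℝ] Vec M)) = r) :
    ∃ (U : Vec r →L[ℝ] Vec N) (S : Vec M →L[ℝ] Vec r), S ∘L T ∘L U = 1 := by
  let T' : Vec N →ₗ[ℝ] Vec M := T
  have e : LinearMap.range T' ≃ₗ[ℝ] Vec r := by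
    refine LinearEquiv.ofFinrankEq _ _ ?_
    rw [hr, Module.finrank_fin_fun]
  obtain ⟨V, hV⟩ := LinearMap.exists_rightInverse_of_surjective T'.rangeRestrict T'.range_rangeRestrict
  obtain ⟨P, hP⟩ := LinearMap.exists_leftInverse_of_injective (LinearMap.range T').subtype
    (Submodule.ker_subtype _)
  refine ⟨LinearMap.toContinuousLinearMap (V ∘ₗ e.symm.toLinearMap),
    LinearMap.toContinuousLinearMap (e.toLinearMap ∘ₗ P), ?_⟩
  ext1 x
  have a1 : ∀ y, T (V y) = (y : Vec M) := fun y => by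
    have := DFunLike.congr_fun hV y
    exact congrArg Subtype.val this
  have a2 : ∀ y : LinearMap.range T', P (y : Vec M) = y := fun y => DFunLike.congr_fun hP y
  simp [a1, a2]

/-- a global smooth generalized inverse of the symbol, away from the origin -/
lemma ginv_smooth {d N M : ℕ} (A : Fin d → (Vec N →ₗ[ℝ] Vec M)) (hA : ConstantRank A) :
    ∃ B : Ed d → (Vec M →L[ℝ] Vec N), ContDiff ℝ ∞ B ∧
      ∀ w, 1 / 2 ≤ ‖w‖ → sym A w ∘L B w ∘L sym A w = sym A w := by
  obtain ⟨r, hr⟩ := hA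
  have hr' : ∀ w : Ed d, w ≠ 0 →
      Module.finrank ℝ (LinearMap.range (sym A w : Vec N →ₗ[ℝ] Vec M)) = r := by
    intro w hw
    rw [sym_symb]
    apply hr
    intro h
    apply hw
    ext i
    exact congrFun h i
  have key := exists_contMDiffMap_forall_mem_convex_of_local (n := (⊤ : ℕ∞)) (M := Ed d) (F := Vec M →L[ℝ] Vec N)
    𝓘(ℝ, Ed d) (t := fun w => {B | 1 / 2 ≤ ‖w‖ → sym A w ∘L B ∘L sym A w = sym A w}) ?_ ?_
  · obtain ⟨g, hg⟩ := key
    exact ⟨g, g.contMDiff.contDiff, fun w hw => hg w hw⟩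
  · intro w B hB C hC a b ha hb hab hw
    have h1 := hB hw
    have h2 := hC hw
    ext1 x
    have e1 := DFunLike.congr_fun h1 x
    have e2 := DFunLike.congr_fun h2 x
    simp only [ContinuousLinearMap.comp_apply] at e1 e2
    simp [e1, e2, ← add_smul, hab]
  · intro w
    rcases eq_or_ne w 0 with rfl | hw
    · refine ⟨ball 0 (1/2), ball_mem_nhds _ (by norm_num), fun _ => 0, contMDiffOn_const, ?_⟩
      intro y hy h
      rw [mem_ball_zero_iff] at hy
      linarith
    · obtain ⟨U, S, hUS⟩ := ginv_exists (sym A w) (hr' w hw)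
      have hcG : ContDiff ℝ ∞ (fun y => S ∘L sym A y ∘L U) :=
        contDiff_const.clm_comp ((sym_contDiff A).clm_comp contDiff_const)
      have hopen : IsOpen {y | IsUnit (S ∘L sym A y ∘L U)} :=
        Units.isOpen.preimage hcG.continuous
      refine ⟨{y | IsUnit (S ∘L sym A y ∘L U)} ∩ {0}ᶜ, ?_,
        fun y => U ∘L Ring.inverse (S ∘L sym A y ∘L U) ∘L S, ?_, ?_⟩
      · refine inter_mem (hopen.mem_nhds ?_) (isOpen_compl_singleton.mem_nhds hw)
        simp [hUS]
      · rw [contMDiffOn_iff_contDiffOn]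
        intro y hy
        refine ContDiffAt.contDiffWithinAt ?_
        have h3 : ContDiffAt ℝ ∞ (fun y => Ring.inverse (S ∘L sym A y ∘L U)) y := by
          obtain ⟨u, hu⟩ := hy.1
          have := contDiffAt_ringInverse ℝ (n := ∞) u
          rw [hu] at this
          exact this.comp (f := fun y => S ∘L sym A y ∘L U) y hcG.contDiffAt
        exact contDiffAt_const.clm_comp (h3.clm_comp contDiffAt_const)
      · intro y hy _
        exact ginv_alg _ _ _ (hr' y hy.2) hy.1

end HC

namespace HC
open scoped SchwartzMap FourierTransform ContDiff Manifold LineDeriv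

/-- the basic cut-off -/
def chiB (d : ℕ) : ContDiffBump (0 : Ed d) := ⟨1, 2, by norm_num, by norm_num⟩

def rhoB {d : ℕ} (w : Ed d) : ℝ := chiB d w - chiB d ((2:ℝ) • w)

lemma rhoB_contDiff {d : ℕ} : ContDiff ℝ ∞ (rhoB (d := d)) := by
  unfold rhoB
  exact (chiB d).contDiff.sub ((chiB d).contDiff.comp (by fun_prop))

lemma rhoB_supp {d : ℕ} (w : Ed d) (h : rhoB w ≠ 0) : 1 / 2 ≤ ‖w‖ ∧ ‖w‖ ≤ 2 := by
  constructor
  · by_contra! hc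
    apply h
    have h1 : chiB d w = 1 := (chiB d).one_of_mem_closedBall (by
      simp [chiB]; linarith)
    have h2 : chiB d ((2:ℝ) • w) = 1 := (chiB d).one_of_mem_closedBall (by
      simp [chiB, norm_smul]; linarith)
    simp [rhoB, h1, h2]
  · by_contra! hc
    apply h
    have h1 : chiB d w = 0 := (chiB d).zero_of_le_dist (by
      simp [chiB]; linarith)
    have h2 : chiB d ((2:ℝ) • w) = 0 := (chiB d).zero_of_le_dist (by
      simp [chiB, norm_smul]; linarith)
    simp [rhoB, h1, h2]

lemma cs_cplx {d : ℕ} {g : Ed d → ℝ} (h : HasCompactSupport g) :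
    HasCompactSupport (fun w => (g w : ℂ)) := h.comp_left (g := fun x : ℝ => (x : ℂ)) (by simp)

lemma cd_cplx {d : ℕ} {g : Ed d → ℝ} (h : ContDiff ℝ ∞ g) :
    ContDiff ℝ ∞ (fun w => (g w : ℂ)) := Complex.ofRealCLM.contDiff.comp h

lemma rhoB_mul_cs {d : ℕ} (g : Ed d → ℝ) : HasCompactSupport (fun w => rhoB w * g w) := by
  refine HasCompactSupport.intro (isCompact_closedBall (0 : Ed d) 2) fun w hw => ?_
  have : rhoB w = 0 := by
    by_contra hc
    exact hw (by simpa using (rhoB_supp w hc).2)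
  simp [this]

/-- The Schwartz multiplier `ρ g`. -/
def mS {d : ℕ} (g : Ed d → ℝ) (hg : ContDiff ℝ ∞ g) : 𝓢(Ed d, ℂ) :=
  (cs_cplx (rhoB_mul_cs g)).toSchwartzMap (cd_cplx (rhoB_contDiff.mul hg))

lemma mS_apply {d : ℕ} (g : Ed d → ℝ) (hg : ContDiff ℝ ∞ g) (w : Ed d) :
    mS g hg w = ((rhoB w * g w : ℝ) : ℂ) := rfl

def chiS (d : ℕ) : 𝓢(Ed d, ℂ) :=
  (cs_cplx (chiB d).hasCompactSupport).toSchwartzMap (cd_cplx (chiB d).contDiff)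

lemma chiS_apply {d : ℕ} (w : Ed d) : chiS d w = ((chiB d w : ℝ) : ℂ) := rfl

lemma mS_bound {d : ℕ} (g : Ed d → ℝ) (hg : ContDiff ℝ ∞ g) :
    ∃ C, 0 ≤ C ∧ ∀ w, ‖mS g hg w‖ ≤ C * min ‖w‖ ‖w‖⁻¹ := by
  obtain ⟨C, hC⟩ := (mS g hg).continuous.bounded_above_of_compact_support (cs_cplx (rhoB_mul_cs g))
  have hC0 : 0 ≤ C := (norm_nonneg _).trans (hC 0)
  refine ⟨2 * C, by positivity, fun w => ?_⟩
  by_cases h : rhoB w = 0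
  · rw [mS_apply, h]; simp only [zero_mul, Complex.ofReal_zero, norm_zero]; positivity
  · obtain ⟨h1, h2⟩ := rhoB_supp w h
    refine (hC w).trans ?_
    have h3 : (1:ℝ)/2 ≤ ‖w‖⁻¹ := by
      rw [one_div]; exact inv_anti₀ (by linarith) h2
    have : 1/2 ≤ min ‖w‖ ‖w‖⁻¹ := le_min h1 h3
    nlinarith

lemma lineDeriv_inv {d : ℕ} (m : 𝓢(Ed d, ℂ)) (v : Ed d) :
    ∂_{v} (𝓕⁻ m) = (2 * Real.pi * Complex.I) • 𝓕⁻ (SchwartzMap.smulLeftCLM ℂ (fun w : Ed d => inner ℝ w v) m) := by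
  rw [SchwartzMap.lineDerivOp_fourierInv_eq, FourierTransform.fourierInv_smul]

lemma rkS_fderiv {d : ℕ} (κ : 𝓢(Ed d, ℂ)) (x : Rd d) (i : Fin d) :
    fderiv ℝ (rkS κ) x (Pi.single i 1) =
      ((∂_{(EuclideanSpace.single i (1:ℝ) : Ed d)} κ) (WithLp.toLp 2 x)).re := by
  let L : Rd d ≃L[ℝ] Ed d := (PiLp.continuousLinearEquiv 2 ℝ (fun _ : Fin d => ℝ)).symm
  have h1 : HasFDerivAt (fun x : Rd d => κ (L x)) ((fderiv ℝ κ (L x)).comp (L : Rd d →L[ℝ] Ed d)) x :=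
    (κ.differentiable (L x)).hasFDerivAt.comp x L.hasFDerivAt
  have h2 : HasFDerivAt (rkS κ) (Complex.reCLM.comp ((fderiv ℝ κ (L x)).comp (L : Rd d →L[ℝ] Ed d))) x :=
    Complex.reCLM.hasFDerivAt.comp x h1
  rw [h2.fderiv, SchwartzMap.lineDerivOp_apply_eq_fderiv]
  rfl

lemma smulLeft_inner {d : ℕ} (m : 𝓢(Ed d, ℂ)) (i : Fin d) (w : Ed d) :
    SchwartzMap.smulLeftCLM ℂ (fun w : Ed d => inner ℝ w (EuclideanSpace.single i (1:ℝ))) m w = (w i : ℂ) * m w := by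
  rw [SchwartzMap.smulLeftCLM_apply_apply (by fun_prop), EuclideanSpace.inner_single_right]
  simp

lemma sum_fourierInv {d : ℕ} {ι : Type*} (s : Finset ι) (c : ι → ℂ) (f : ι → 𝓢(Ed d, ℂ)) :
    ∑ i ∈ s, c i • 𝓕⁻ (f i) = 𝓕⁻ (∑ i ∈ s, c i • f i) := by
  have := map_sum (FourierTransform.fourierInvCLM ℂ 𝓢(Ed d, ℂ)) (fun i => c i • f i) s
  simp only [FourierTransform.fourierInvCLM_apply, FourierTransform.fourierInv_smul] at this
  rw [this]

/-- coefficient of the operator -/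
def cf {d N M : ℕ} (A : Fin d → (Vec N →ₗ[ℝ] Vec M)) (i : Fin d) (m : Fin M) (a : Fin N) : ℝ :=
  A i (Pi.single a 1) m

structure ProjK {d N M : ℕ} (A : Fin d → (Vec N →ₗ[ℝ] Vec M)) (k : Fin N → Fin N → 𝓢(Rd d, ℝ))
    (l : Fin N → Fin M → 𝓢(Rd d, ℝ)) (φ : 𝓢(Rd d, ℝ)) : Prop where
  l2 : ∃ B : ℝ≥0, ∀ a b J, L2bd (KJ J (k a b)) B
  free : ∀ m b x, ∑ i, ∑ a, cf A i m a * fderiv ℝ (k a b) x (Pi.single i 1) = 0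
  rep : ∀ a b x, (if a = b then φ x - (1/2:ℝ)^d * φ ((1/2:ℝ) • x) else 0) - k a b x =
    ∑ i, ∑ m, cf A i m b * fderiv ℝ (l a m) x (Pi.single i 1)
  mass : ∫ x, φ x = 1

lemma re_sum_schwartz {d : ℕ} {ι : Type*} (s : Finset ι) (c : ι → ℝ) (f : ι → 𝓢(Ed d, ℂ)) (x : Ed d) :
    ∑ i ∈ s, c i * (f i x).re = ((∑ i ∈ s, (c i : ℂ) • f i) x).re := by
  rw [_root_.sum_apply, Complex.re_sum]
  refine Finset.sum_congr rfl fun i _ => ?_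
  rw [_root_.smul_apply, smul_eq_mul, Complex.re_ofReal_mul]

lemma sum_lineDeriv_inv {d : ℕ} {ι : Type*} (s : Finset ι) (c : ι → ℝ) (j : ι → Fin d)
    (f : ι → 𝓢(Ed d, ℂ)) (F : 𝓢(Ed d, ℂ))
    (h : ∀ w, ∑ i ∈ s, (c i : ℂ) * ((w (j i) : ℂ) * f i w) = F w) :
    ∑ i ∈ s, (c i : ℂ) • ∂_{(EuclideanSpace.single (j i) (1:ℝ) : Ed d)} (𝓕⁻ (f i)) =
      (2 * Real.pi * Complex.I) • 𝓕⁻ F := by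
  simp_rw [lineDeriv_inv, smul_comm _ (2 * (Real.pi : ℂ) * Complex.I)]
  rw [← Finset.smul_sum, sum_fourierInv]
  congr 2
  ext w
  rw [_root_.sum_apply, ← h]
  refine Finset.sum_congr rfl fun i _ => ?_
  rw [_root_.smul_apply, smulLeft_inner, smul_eq_mul]

lemma mS_one {d : ℕ} : 𝓕⁻ (mS (fun _ : Ed d => (1:ℝ)) contDiff_const) =
    𝓕⁻ (chiS d) - dilS (1/2) (by norm_num) (𝓕⁻ (chiS d)) := by
  have h : mS (fun _ : Ed d => (1:ℝ)) contDiff_const = 𝓕 (𝓕⁻ (chiS d) - dilS (1/2) (by norm_num) (𝓕⁻ (chiS d))) := by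
    have hs := map_sub (FourierTransform.fourierCLM ℂ 𝓢(Ed d, ℂ)) (𝓕⁻ (chiS d)) (dilS (1/2) (by norm_num) (𝓕⁻ (chiS d)))
    simp only [FourierTransform.fourierCLM_apply] at hs
    rw [hs, FourierTransform.fourier_fourierInv_eq]
    ext w
    rw [_root_.sub_apply, fourier_dilS (1/2) (by norm_num), FourierTransform.fourier_fourierInv_eq,
      mS_apply, chiS_apply, chiS_apply]
    simp [rhoB]
  rw [h, FourierTransform.fourierInv_fourier_eq]

lemma sym_coord {d N M : ℕ} (A : Fin d → (Vec N →ₗ[ℝ] Vec M)) (w : Ed d) (L : Vec M →L[ℝ] Vec N)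
    (a b : Fin N) : L (sym A w (Pi.single b 1)) a = ∑ q : Fin d × Fin M, cf A q.1 q.2 b * (w q.1 * L (Pi.single q.2 1) a) := by
  have h : ∀ i, L (A i (Pi.single b 1)) a = ∑ m, cf A i m b * L (Pi.single m 1) a := by
    intro i
    conv_lhs => rw [← Finset.univ_sum_single (A i (Pi.single b 1))]
    rw [map_sum, Finset.sum_apply]
    refine Finset.sum_congr rfl fun m _ => ?_
    have : (Pi.single m (A i (Pi.single b 1) m) : Vec M) = cf A i m b • Pi.single m 1 := by
      rw [← Pi.single_smul]; simp [cf]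
    simp [this]
  rw [sym_apply, map_sum, Finset.sum_apply, Fintype.sum_prod_type]
  refine Finset.sum_congr rfl fun i _ => ?_
  simp only [map_smul, Pi.smul_apply, smul_eq_mul, h, Finset.mul_sum]
  refine Finset.sum_congr rfl fun m _ => ?_
  ring

lemma sym_comp_coord {d N M : ℕ} (A : Fin d → (Vec N →ₗ[ℝ] Vec M)) (w : Ed d) (ξ : Vec N)
    (m : Fin M) : sym A w ξ m = ∑ q : Fin d × Fin N, cf A q.1 m q.2 * (w q.1 * ξ q.2) := by
  have h : ∀ i, A i ξ m = ∑ a, cf A i m a * ξ a := by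
    intro i
    conv_lhs => rw [← Finset.univ_sum_single ξ]
    rw [map_sum, Finset.sum_apply]
    refine Finset.sum_congr rfl fun a _ => ?_
    have : (Pi.single a (ξ a) : Vec N) = ξ a • Pi.single a 1 := by
      rw [← Pi.single_smul]; simp
    simp [this, cf, mul_comm]
  rw [sym_apply, Finset.sum_apply, Fintype.sum_prod_type]
  refine Finset.sum_congr rfl fun i _ => ?_
  simp only [Pi.smul_apply, smul_eq_mul, h, Finset.mul_sum]
  refine Finset.sum_congr rfl fun m _ => ?_
  ring

theorem projK_exists {d N M : ℕ} (A : Fin d → (Vec N →ₗ[ℝ] Vec M)) (hA : ConstantRank A) :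
    ∃ k l φ, ProjK A k l φ := by
  obtain ⟨B, hB, hBA⟩ := ginv_smooth A hA
  have hg1 : ∀ a b, ContDiff ℝ ∞ (fun w : Ed d => (if a = b then (1:ℝ) else 0) - B w (sym A w (Pi.single b 1)) a) := by
    intro a b
    refine contDiff_const.sub ?_
    have h1 : ContDiff ℝ ∞ (fun w => sym A w (Pi.single b 1)) := (sym_contDiff A).clm_apply contDiff_const
    exact (contDiff_pi.1 (hB.clm_apply h1)) a
  have hg2 : ∀ a m, ContDiff ℝ ∞ (fun w : Ed d => B w (Pi.single m 1) a) := by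
    intro a m
    exact (contDiff_pi.1 (hB.clm_apply contDiff_const)) a
  let μ : Fin N → Fin N → 𝓢(Ed d, ℂ) := fun a b => mS _ (hg1 a b)
  let ν : Fin N → Fin M → 𝓢(Ed d, ℂ) := fun a m => mS _ (hg2 a m)
  have hpi : (2 * Real.pi * Complex.I) ≠ 0 := by
    simp [Real.pi_ne_zero]
  refine ⟨fun a b => rkS (𝓕⁻ (μ a b)), fun a m => rkS ((2 * Real.pi * Complex.I)⁻¹ • 𝓕⁻ (ν a m)),
    rkS (𝓕⁻ (chiS d)), ?_, ?_, ?_, ?_⟩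
  · have : ∀ a b, ∃ B : ℝ≥0, ∀ J, L2bd (KJ J (rkS (𝓕⁻ (μ a b)))) B := by
      intro a b
      obtain ⟨C, hC, h⟩ := mS_bound _ (hg1 a b)
      refine kj_L2bd _ C hC ?_
      rw [FourierTransform.fourier_fourierInv_eq]
      exact h
    choose Bf hBf using this
    refine ⟨∑ a, ∑ b, Bf a b, fun a b J f hf => (hBf a b J f hf).trans ?_⟩
    refine mul_le_mul' ?_ le_rfl
    rw [ENNReal.coe_le_coe]
    refine le_trans ?_ (Finset.single_le_sum (f := fun a => ∑ b, Bf a b) (fun _ _ => zero_le) (Finset.mem_univ a))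
    exact Finset.single_le_sum (f := fun b => Bf a b) (fun _ _ => zero_le) (Finset.mem_univ b)
  · intro m b x
    simp_rw [rkS_fderiv]
    refine (Fintype.sum_prod_type' (fun (i : Fin d) (a : Fin N) => cf A i m a * ((∂_{(EuclideanSpace.single i (1:ℝ) : Ed d)} (𝓕⁻ (μ a b))) (WithLp.toLp 2 x)).re)).symm.trans ?_
    rw [re_sum_schwartz _ (fun q : Fin d × Fin N => cf A q.1 m q.2) (fun q => ∂_{(EuclideanSpace.single q.1 (1:ℝ) : Ed d)} (𝓕⁻ (μ q.2 b))),
      sum_lineDeriv_inv _ (fun q : Fin d × Fin N => cf A q.1 m q.2) (fun q => q.1) (fun q => μ q.2 b) 0]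
    · rw [FourierTransform.fourierInv_zero, smul_zero]; simp
    · intro w
      simp only [μ, mS_apply, _root_.zero_apply]
      simp only [← Complex.ofReal_mul, ← Complex.ofReal_sum]
      rw [← Complex.ofReal_zero, Complex.ofReal_inj]
      by_cases hr : rhoB w = 0
      · simp [hr]
      have hw := hBA w (rhoB_supp w hr).1
      have h1 := congrFun (DFunLike.congr_fun hw (Pi.single b 1)) m
      simp only [ContinuousLinearMap.comp_apply] at h1
      have h2 : sym A w (Pi.single b 1 - B w (sym A w (Pi.single b 1))) m = 0 := by
        rw [map_sub, Pi.sub_apply, h1, sub_self]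
      rw [sym_comp_coord] at h2
      have h3 := congrArg (fun t => rhoB w * t) h2
      simp only [mul_zero, Finset.mul_sum] at h3
      refine Eq.trans ?_ h3
      refine Finset.sum_congr rfl fun q _ => ?_
      simp only [Pi.sub_apply, Pi.single_apply]
      ring
  · intro a b x
    simp_rw [rkS_fderiv]
    refine Eq.trans ?_ (Fintype.sum_prod_type' (fun (i : Fin d) (m : Fin M) => cf A i m b * ((∂_{(EuclideanSpace.single i (1:ℝ) : Ed d)} ((2 * Real.pi * Complex.I)⁻¹ • 𝓕⁻ (ν a m))) (WithLp.toLp 2 x)).re))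
    rw [re_sum_schwartz _ (fun q : Fin d × Fin M => cf A q.1 q.2 b) (fun q => ∂_{(EuclideanSpace.single q.1 (1:ℝ) : Ed d)} ((2 * Real.pi * Complex.I)⁻¹ • 𝓕⁻ (ν a q.2)))]
    have h1 : ∑ q : Fin d × Fin M, (cf A q.1 q.2 b : ℂ) • ∂_{(EuclideanSpace.single q.1 (1:ℝ) : Ed d)} ((2 * Real.pi * Complex.I)⁻¹ • 𝓕⁻ (ν a q.2)) =
        (if a = b then 1 else 0 : ℂ) • 𝓕⁻ (mS (fun _ : Ed d => (1:ℝ)) contDiff_const) - 𝓕⁻ (μ a b) := by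
      have hsub := map_sub (FourierTransform.fourierInvCLM ℂ 𝓢(Ed d, ℂ)) ((if a = b then 1 else 0 : ℂ) • (mS (fun _ : Ed d => (1:ℝ)) contDiff_const)) (μ a b)
      simp only [FourierTransform.fourierInvCLM_apply] at hsub
      simp_rw [LineDeriv.lineDerivOp_smul, smul_comm _ (2 * (Real.pi : ℂ) * Complex.I)⁻¹]
      rw [← Finset.smul_sum, sum_lineDeriv_inv _ (fun q : Fin d × Fin M => cf A q.1 q.2 b) (fun q => q.1) (fun q => ν a q.2)
        ((if a = b then 1 else 0 : ℂ) • (mS (fun _ : Ed d => (1:ℝ)) contDiff_const) - μ a b), inv_smul_smul₀ hpi,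
        hsub, FourierTransform.fourierInv_smul]
      intro w
      rw [_root_.sub_apply, _root_.smul_apply]
      simp only [μ, ν, mS_apply, smul_eq_mul]
      have h3 : ((if a = b then 1 else 0 : ℝ) : ℂ) = (if a = b then 1 else 0 : ℂ) := by split_ifs <;> simp
      rw [← h3]
      simp only [← Complex.ofReal_mul, ← Complex.ofReal_sum, ← Complex.ofReal_sub]
      rw [Complex.ofReal_inj]
      have h2 := sym_coord A w (B w) a b
      rw [show ((if a = b then 1 else 0 : ℝ)) * (rhoB w * 1) - rhoB w * ((if a = b then 1 else 0 : ℝ) - B w (sym A w (Pi.single b 1)) a)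
        = rhoB w * B w (sym A w (Pi.single b 1)) a by ring, h2, Finset.mul_sum]
      refine Finset.sum_congr rfl fun q _ => ?_
      ring
    rw [h1, mS_one, _root_.sub_apply, _root_.smul_apply, _root_.sub_apply, dilS_apply]
    rw [rkS_apply, rkS_apply, rkS_apply]
    rw [Complex.sub_re]
    congr 1
    split_ifs
    · simp only [one_smul, Complex.sub_re]
      congr 1
      rw [← Complex.ofReal_pow, Complex.re_ofReal_mul]
      rfl
    · simp
  · have hmp := PiLp.volume_preserving_toLp (Fin d)
    have h1 : ∫ x : Ed d, (𝓕⁻ (chiS d)) x = 1 := by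
      have h2 : 𝓕 (𝓕⁻ (chiS d)) 0 = 1 := by
        rw [FourierTransform.fourier_fourierInv_eq, chiS_apply,
          (chiB d).one_of_mem_closedBall (by simp [chiB])]
        simp
      rw [← h2, SchwartzMap.fourier_coe, Real.fourier_eq]
      simp
    have h3 := integral_re ((𝓕⁻ (chiS d)).integrable (μ := volume))
    simp only [RCLike.re_eq_complex_re] at h3
    rw [h1, ← hmp.integral_comp (MeasurableEquiv.toLp 2 _).measurableEmbedding] at h3
    simpa [rkS_apply] using h3

end HC

namespace HC
open scoped SchwartzMap

/-- weighted truncated sum of dilates -/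
def DW {d : ℕ} (c : ℤ → ℝ) (J : ℕ) (k : Rd d → ℝ) (x : Rd d) : ℝ :=
  ∑ j ∈ Finset.Icc (-(J : ℤ)) J, c j * k ((2 : ℝ) ^ j • x)

lemma dw_contDiff {d : ℕ} (c : ℤ → ℝ) (J : ℕ) (k : 𝓢(Rd d, ℝ)) :
    ContDiff ℝ (⊤ : ℕ∞) (DW c J k) := by
  unfold DW
  refine ContDiff.sum fun j _ => contDiff_const.mul ?_
  exact k.smooth'.comp (contDiff_const_smul _)

lemma dw_fderiv {d : ℕ} (c : ℤ → ℝ) (J : ℕ) (k : 𝓢(Rd d, ℝ)) (x v : Rd d) :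
    fderiv ℝ (DW c J k) x v =
      ∑ j ∈ Finset.Icc (-(J : ℤ)) J, c j * (2 : ℝ) ^ j * fderiv ℝ k ((2 : ℝ) ^ j • x) v := by
  have h : HasFDerivAt (DW c J k) (∑ j ∈ Finset.Icc (-(J : ℤ)) J,
      c j • ((fderiv ℝ k ((2 : ℝ) ^ j • x)).comp
        ((2 : ℝ) ^ j • ContinuousLinearMap.id ℝ (Rd d)))) x := by
    unfold DW
    refine HasFDerivAt.fun_sum fun j _ => ?_
    refine HasFDerivAt.const_mul ?_ (c j)
    refine HasFDerivAt.comp x (g := (k : Rd d → ℝ)) (f := fun y => (2 : ℝ) ^ j • y) ?_ ?_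
    · exact (k.differentiable _).hasFDerivAt
    · exact (hasFDerivAt_id x).const_smul ((2 : ℝ) ^ j)
  rw [h.fderiv, _root_.sum_apply]
  refine Finset.sum_congr rfl fun j _ => ?_
  simp; ring

lemma kj_eq_dw {d : ℕ} (J : ℕ) (k : Rd d → ℝ) : KJ J k = DW (fun j => ((2:ℝ)^j)^d) J k := rfl

/-- The approximate projection operators. -/
def TJ {d N : ℕ} (k : Fin N → Fin N → 𝓢(Rd d, ℝ)) (J : ℕ) (t : Rd d → Vec N) (x : Rd d) :
    Vec N := fun a => ∑ b, cv (KJ J (k a b)) (fun y => t y b) x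

lemma integrable_comp {d N : ℕ} {t : Rd d → Vec N} {μ : Measure (Rd d)} (ht : Integrable t μ)
    (b : Fin N) : Integrable (fun y => t y b) μ :=
  (ContinuousLinearMap.proj (R := ℝ) (φ := fun _ : Fin N => ℝ) b).integrable_comp ht

lemma adjApply_eq {d N M : ℕ} (A : Fin d → (Vec N →ₗ[ℝ] Vec M)) (ψ : Rd d → Vec M)
    (hψ : Differentiable ℝ ψ) (x : Rd d) (a : Fin N) :
    adjApply A ψ x a = -∑ i, ∑ m, cf A i m a * fderiv ℝ (fun y => ψ y m) x (Pi.single i 1) := by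
  unfold adjApply dot cf
  congr 1
  refine Finset.sum_congr rfl fun i _ => Finset.sum_congr rfl fun m _ => ?_
  congr 1
  have := fderiv_apply (𝕜 := ℝ) (hψ x) m
  rw [this]; rfl

lemma ibp {d : ℕ} (S ψ : Rd d → ℝ) (hS : ContDiff ℝ (⊤ : ℕ∞) S) (hψ : ContDiff ℝ (⊤ : ℕ∞) ψ)
    (hc : HasCompactSupport ψ) (y v : Rd d) :
    ∫ x, S (x - y) * fderiv ℝ ψ x v = - ∫ x, fderiv ℝ S (x - y) v * ψ x := by
  have hS' : ContDiff ℝ (⊤ : ℕ∞) (fun x => S (x - y)) := hS.comp (by fun_prop)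
  have hf : ∀ x, fderiv ℝ (fun x => S (x - y)) x v = fderiv ℝ S (x - y) v := fun x => by
    simp only [sub_eq_add_neg]; rw [fderiv_comp_add_right]
  have h1 := hS'.continuous_fderiv (by simp)
  have h2 := hψ.continuous_fderiv (by simp)
  have h3 := hS'.continuous
  have h4 := hψ.continuous
  have := integral_mul_fderiv_eq_neg_fderiv_mul_of_integrable (𝕜 := ℝ) (μ := (volume : Measure (Rd d)))
    (f := fun x => S (x - y)) (g := ψ) (v := v) ?_ ?_ ?_ ?_ ?_
  · simpa only [hf] using this
  · exact Continuous.integrable_of_hasCompactSupport (by fun_prop) hc.mul_left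
  · exact Continuous.integrable_of_hasCompactSupport (by fun_prop)
      ((hc.fderiv_apply (𝕜 := ℝ) v).mul_left)
  · exact Continuous.integrable_of_hasCompactSupport (by fun_prop) hc.mul_left
  · exact fun x _ => (hS'.differentiable (by simp)) x
  · exact fun x _ => (hψ.differentiable (by simp)) x

lemma ibp_int1 {d : ℕ} (S ψ : Rd d → ℝ) (hS : ContDiff ℝ (⊤ : ℕ∞) S) (hψ : ContDiff ℝ (⊤ : ℕ∞) ψ)
    (hc : HasCompactSupport ψ) (y v : Rd d) :
    Integrable (fun x => S (x - y) * fderiv ℝ ψ x v) := by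
  have h2 := hψ.continuous_fderiv (by simp)
  have h1 := hS.continuous
  exact Continuous.integrable_of_hasCompactSupport (by fun_prop)
    ((hc.fderiv_apply (𝕜 := ℝ) v).mul_left)

lemma ibp_int2 {d : ℕ} (S ψ : Rd d → ℝ) (hS : ContDiff ℝ (⊤ : ℕ∞) S) (hψ : ContDiff ℝ (⊤ : ℕ∞) ψ)
    (hc : HasCompactSupport ψ) (y v : Rd d) :
    Integrable (fun x => fderiv ℝ S (x - y) v * ψ x) := by
  have h2 := hψ.continuous
  have h1 := hS.continuous_fderiv (by simp)
  exact Continuous.integrable_of_hasCompactSupport (by fun_prop) hc.mul_left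

lemma kj_free {d N M : ℕ} {A : Fin d → (Vec N →ₗ[ℝ] Vec M)} {k : Fin N → Fin N → 𝓢(Rd d, ℝ)}
    {l : Fin N → Fin M → 𝓢(Rd d, ℝ)} {φ : 𝓢(Rd d, ℝ)} (h : ProjK A k l φ) (J : ℕ) (m : Fin M)
    (b : Fin N) (x : Rd d) :
    ∑ i, ∑ a, cf A i m a * fderiv ℝ (KJ J (k a b)) x (Pi.single i 1) = 0 := by
  simp only [kj_eq_dw, dw_fderiv, Finset.mul_sum]
  rw [Finset.sum_congr rfl fun i _ => Finset.sum_comm, Finset.sum_comm]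
  refine Finset.sum_eq_zero fun j _ => ?_
  have := h.free m b ((2:ℝ)^j • x)
  calc _ = (((2:ℝ)^j)^d * (2:ℝ)^j) * ∑ i, ∑ a, cf A i m a * fderiv ℝ (k a b) ((2:ℝ)^j • x) (Pi.single i 1) := by
        rw [Finset.mul_sum]
        refine Finset.sum_congr rfl fun i _ => ?_
        rw [Finset.mul_sum]
        refine Finset.sum_congr rfl fun a _ => ?_
        ring
    _ = 0 := by rw [this, mul_zero]

lemma adjApply_cont {d N M : ℕ} (A : Fin d → (Vec N →ₗ[ℝ] Vec M)) (ψ : Rd d → Vec M)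
    (hψ : ContDiff ℝ (⊤ : ℕ∞) ψ) : Continuous (adjApply A ψ) := by
  have h2 := hψ.continuous_fderiv (by simp)
  unfold adjApply dot
  fun_prop

lemma adjApply_zero {d N M : ℕ} (A : Fin d → (Vec N →ₗ[ℝ] Vec M)) (ψ : Rd d → Vec M)
    (x : Rd d) (h : fderiv ℝ ψ x = 0) : adjApply A ψ x = 0 := by
  funext n; simp [adjApply, dot, h]

lemma adjApply_off {d N M : ℕ} (A : Fin d → (Vec N →ₗ[ℝ] Vec M)) (ψ : Rd d → Vec M)
    (x : Rd d) (h : x ∉ tsupport ψ) : adjApply A ψ x = 0 := by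
  apply adjApply_zero
  by_contra hc
  exact h (support_fderiv_subset ℝ hc)

lemma adjApply_cs {d N M : ℕ} (A : Fin d → (Vec N →ₗ[ℝ] Vec M)) (ψ : Rd d → Vec M)
    (hψ : HasCompactSupport ψ) : HasCompactSupport (adjApply A ψ) :=
  HasCompactSupport.intro hψ fun x hx => adjApply_off A ψ x hx

lemma dot_zero_right {N : ℕ} (u : Vec N) : dot u 0 = 0 := by simp [dot]

lemma test_integral {d N M : ℕ} (A : Fin d → (Vec N →ₗ[ℝ] Vec M)) (O : Set (Rd d))
    (ψ : Rd d → Vec M) (hψ : tsupport ψ ⊆ O) (u : Rd d → Vec N) :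
    ∫ x in O, dot (u x) (adjApply A ψ x) = ∫ x, dot (u x) (adjApply A ψ x) := by
  refine setIntegral_eq_integral_of_forall_compl_eq_zero fun x hx => ?_
  rw [adjApply_off A ψ x fun h => hx (hψ h), dot_zero_right]

theorem TJ_free {d N M : ℕ} {A : Fin d → (Vec N →ₗ[ℝ] Vec M)} {k : Fin N → Fin N → 𝓢(Rd d, ℝ)}
    {l : Fin N → Fin M → 𝓢(Rd d, ℝ)} {φ : 𝓢(Rd d, ℝ)} (h : ProjK A k l φ) (J : ℕ)
    (t : Rd d → Vec N) (ht : Integrable t) (O : Set (Rd d)) : AFreeOn A O (TJ k J t) := by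
  intro ψ hψ
  obtain ⟨hs, hc, hO⟩ := hψ
  rw [test_integral A O ψ hO]
  have hac := adjApply_cont A ψ hs
  have hgc : ∀ a, Continuous (fun x => adjApply A ψ x a) := fun a => by fun_prop
  have hgi : ∀ a, Integrable (fun x => adjApply A ψ x a) := fun a =>
    (hgc a).integrable_of_hasCompactSupport ((adjApply_cs A ψ hc).comp_left (g := fun v : Vec N => v a) rfl)
  have hI : ∀ a b, Integrable (fun x => cv (KJ J (k a b)) (fun y => t y b) x * adjApply A ψ x a) := by
    intro a b
    obtain ⟨C, hC⟩ := cv_bdd (kj_nice J (k a b)) (integrable_comp ht b)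
    exact (hgi a).bdd_mul (c := C) (cv_continuous (kj_nice J (k a b)) (integrable_comp ht b)).aestronglyMeasurable
      (Eventually.of_forall hC)
  have hI2 : ∀ a b, Integrable (fun y => t y b * cv (fun x => KJ J (k a b) (-x)) (fun x => adjApply A ψ x a) y) := by
    intro a b
    obtain ⟨C, hC⟩ := cv_bdd (kj_nice J (k a b)).refl (hgi a)
    have := (integrable_comp ht b).bdd_mul (c := C) (cv_continuous (kj_nice J (k a b)).refl (hgi a)).aestronglyMeasurable
      (Eventually.of_forall hC)
    exact this.congr (Eventually.of_forall fun y => mul_comm _ _)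
  calc ∫ x, dot (TJ k J t x) (adjApply A ψ x)
      = ∫ x, ∑ a, ∑ b, cv (KJ J (k a b)) (fun y => t y b) x * adjApply A ψ x a := by
        congr 1; funext x; simp only [dot, TJ, Finset.sum_mul]
    _ = ∑ a, ∑ b, ∫ x, cv (KJ J (k a b)) (fun y => t y b) x * adjApply A ψ x a := by
        rw [integral_finsetSum _ fun a _ => integrable_finsetSum _ fun b _ => hI a b]
        refine Finset.sum_congr rfl fun a _ => ?_
        rw [integral_finsetSum _ fun b _ => hI a b]
    _ = ∑ b, ∑ a, ∫ y, t y b * cv (fun x => KJ J (k a b) (-x)) (fun x => adjApply A ψ x a) y := by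
        rw [Finset.sum_comm]
        refine Finset.sum_congr rfl fun b _ => Finset.sum_congr rfl fun a _ => ?_
        exact cv_dual (kj_nice J (k a b)) (integrable_comp ht b) (hgi a)
    _ = ∑ b, ∫ y, t y b * ∑ a, cv (fun x => KJ J (k a b) (-x)) (fun x => adjApply A ψ x a) y := by
        refine Finset.sum_congr rfl fun b _ => ?_
        rw [← integral_finsetSum _ fun a _ => hI2 a b]
        simp only [Finset.mul_sum]
    _ = 0 := by
        refine Finset.sum_eq_zero fun b _ => ?_
        refine integral_eq_zero_of_ae (Eventually.of_forall fun y => ?_)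
        suffices ∑ a, cv (fun x => KJ J (k a b) (-x)) (fun x => adjApply A ψ x a) y = 0 by
          simp [this]
        have hψm : ∀ m, ContDiff ℝ (⊤ : ℕ∞) (fun y => ψ y m) := fun m => by fun_prop
        have hcm : ∀ m, HasCompactSupport (fun y => ψ y m) := fun m =>
          hc.comp_left (g := fun v : Vec M => v m) rfl
        have hKd : ∀ a, ContDiff ℝ (⊤ : ℕ∞) (KJ J (k a b)) := fun a => dw_contDiff _ J (k a b)
        have hpi : ∀ a i m, Integrable (fun x => KJ J (k a b) (x - y) *
            fderiv ℝ (fun y => ψ y m) x (Pi.single i 1)) :=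
          fun a i m => ibp_int1 _ _ (hKd a) (hψm m) (hcm m) y _
        have hpi2 : ∀ a i m, Integrable (fun x => fderiv ℝ (KJ J (k a b)) (x - y) (Pi.single i 1) *
            ψ x m) := fun a i m => ibp_int2 _ _ (hKd a) (hψm m) (hcm m) y _
        calc _ = ∑ a, ∫ x, -∑ i, ∑ m, cf A i m a * (KJ J (k a b) (x - y) *
              fderiv ℝ (fun y => ψ y m) x (Pi.single i 1)) := by
              refine Finset.sum_congr rfl fun a _ => ?_
              unfold cv
              congr 1; funext x
              beta_reduce
              rw [adjApply_eq A ψ (hs.differentiable (by simp)), neg_sub, mul_neg, Finset.mul_sum]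
              congr 1
              refine Finset.sum_congr rfl fun i _ => ?_
              rw [Finset.mul_sum]
              refine Finset.sum_congr rfl fun m _ => ?_
              ring
          _ = ∑ a, ∑ i, ∑ m, cf A i m a * ∫ x, fderiv ℝ (KJ J (k a b)) (x - y) (Pi.single i 1) * ψ x m := by
              refine Finset.sum_congr rfl fun a _ => ?_
              rw [integral_neg, integral_finsetSum _ fun i _ => integrable_finsetSum _ fun m _ => (hpi a i m).const_mul _,
                ← Finset.sum_neg_distrib]
              refine Finset.sum_congr rfl fun i _ => ?_
              rw [integral_finsetSum _ fun m _ => (hpi a i m).const_mul _, ← Finset.sum_neg_distrib]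
              refine Finset.sum_congr rfl fun m _ => ?_
              rw [integral_const_mul, ibp _ _ (hKd a) (hψm m) (hcm m)]; ring
          _ = ∑ m, ∫ x, (∑ i, ∑ a, cf A i m a * fderiv ℝ (KJ J (k a b)) (x - y) (Pi.single i 1)) * ψ x m := by
              have : ∀ m, ∫ x, (∑ i, ∑ a, cf A i m a * fderiv ℝ (KJ J (k a b)) (x - y) (Pi.single i 1)) * ψ x m
                  = ∑ i, ∑ a, cf A i m a * ∫ x, fderiv ℝ (KJ J (k a b)) (x - y) (Pi.single i 1) * ψ x m := by
                intro m
                simp only [Finset.sum_mul, mul_assoc]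
                rw [integral_finsetSum _ fun i _ => integrable_finsetSum _ fun a _ => (hpi2 a i m).const_mul _]
                refine Finset.sum_congr rfl fun i _ => ?_
                rw [integral_finsetSum _ fun a _ => (hpi2 a i m).const_mul _]
                refine Finset.sum_congr rfl fun a _ => ?_
                rw [integral_const_mul]
              simp only [this]
              rw [Finset.sum_comm]
              rw [Finset.sum_congr rfl fun i _ => Finset.sum_comm]
              exact Finset.sum_comm
          _ = 0 := by
              simp [kj_free h]

end HC

namespace HC
open scoped SchwartzMap

/-- the dilated mollifier -/
def dilF {d : ℕ} (j : ℤ) (φ : Rd d → ℝ) (x : Rd d) : ℝ := ((2:ℝ)^j)^d * φ ((2:ℝ)^j • x)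

lemma tele {d : ℕ} (J : ℕ) (φ : Rd d → ℝ) (x : Rd d) :
    ∑ j ∈ Finset.Icc (-(J : ℤ)) J, ((2:ℝ)^j)^d * (φ ((2:ℝ)^j • x) - (1/2:ℝ)^d * φ ((1/2:ℝ) • ((2:ℝ)^j • x)))
      = dilF J φ x - dilF (-(J:ℤ) - 1) φ x := by
  have key : ∀ j : ℤ, ((2:ℝ)^j)^d * (φ ((2:ℝ)^j • x) - (1/2:ℝ)^d * φ ((1/2:ℝ) • ((2:ℝ)^j • x)))
      = dilF j φ x - dilF (j - 1) φ x := by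
    intro j
    have : (2:ℝ)^(j-1) = (1/2) * (2:ℝ)^j := by
      rw [zpow_sub_one₀ (by norm_num)]; ring
    simp only [dilF, this, smul_smul, mul_pow]; ring
  rw [Finset.sum_congr rfl fun j _ => key j]
  induction J with
  | zero => simp
  | succ J ih =>
    have : Finset.Icc (-((J+1:ℕ):ℤ)) ((J+1:ℕ):ℤ) =
        insert (-((J:ℤ)+1)) (insert ((J:ℤ)+1) (Finset.Icc (-(J:ℤ)) J)) := by
      ext z; simp only [Finset.mem_Icc, Finset.mem_insert]; push_cast; omega
    rw [this, Finset.sum_insert, Finset.sum_insert, ih]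
    · push_cast
      have e1 : (J:ℤ) + 1 - 1 = J := by ring
      have e2 : -((J:ℤ)+1) = -(J:ℤ) - 1 := by ring
      rw [e1, e2]; ring
    · simp
    · simp only [Finset.mem_insert, Finset.mem_Icc]; omega

lemma dil_nice {d : ℕ} (j : ℤ) (φ : 𝓢(Rd d, ℝ)) : NiceK (dilF j φ) := by
  have hkc := φ.continuous
  refine ⟨?_, ?_, ?_⟩
  · unfold dilF; fun_prop
  · unfold dilF
    exact ((integrable_comp_smul_iff volume (φ : Rd d → ℝ) (by positivity)).2 φ.integrable).const_mul _
  · obtain ⟨C, hC⟩ : ∃ C, ∀ x, ‖φ x‖ ≤ C := ⟨_, fun x => SchwartzMap.norm_le_seminorm ℝ φ x⟩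
    refine ⟨((2 : ℝ) ^ j) ^ d * C, fun x => ?_⟩
    unfold dilF
    rw [norm_mul, Real.norm_of_nonneg (by positivity)]
    gcongr; exact hC _

lemma rep_J {d N M : ℕ} {A : Fin d → (Vec N →ₗ[ℝ] Vec M)} {k : Fin N → Fin N → 𝓢(Rd d, ℝ)}
    {l : Fin N → Fin M → 𝓢(Rd d, ℝ)} {φ : 𝓢(Rd d, ℝ)} (h : ProjK A k l φ) (J : ℕ) (a b : Fin N)
    (x : Rd d) :
    (if a = b then dilF J φ x - dilF (-(J:ℤ) - 1) φ x else 0) - KJ J (k a b) x =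
      ∑ i, ∑ m, cf A i m b * fderiv ℝ (DW (fun j => ((2:ℝ)^j)^d * ((2:ℝ)^j)⁻¹) J (l a m)) x (Pi.single i 1) := by
  have h1 : (if a = b then dilF J φ x - dilF (-(J:ℤ) - 1) φ x else 0) - KJ J (k a b) x =
      ∑ j ∈ Finset.Icc (-(J : ℤ)) J, ((2:ℝ)^j)^d *
        ((if a = b then φ ((2:ℝ)^j • x) - (1/2:ℝ)^d * φ ((1/2:ℝ) • ((2:ℝ)^j • x)) else 0) - k a b ((2:ℝ)^j • x)) := by
    rw [← tele]
    split_ifs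
    · simp only [mul_sub, Finset.sum_sub_distrib, KJ]
    · simp [KJ]
  rw [h1]
  simp only [h.rep, dw_fderiv, Finset.mul_sum]
  rw [Finset.sum_comm]
  refine Finset.sum_congr rfl fun i _ => ?_
  rw [Finset.sum_comm]
  refine Finset.sum_congr rfl fun m _ => Finset.sum_congr rfl fun j _ => ?_
  have : (2:ℝ)^j ≠ 0 := by positivity
  field_simp

theorem TJ_rep {d N M : ℕ} {A : Fin d → (Vec N →ₗ[ℝ] Vec M)} {k : Fin N → Fin N → 𝓢(Rd d, ℝ)}
    {l : Fin N → Fin M → 𝓢(Rd d, ℝ)} {φ : 𝓢(Rd d, ℝ)} (h : ProjK A k l φ) (J : ℕ)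
    (w : Rd d → Vec N) (hw : Integrable w) (R : ℝ) (hR : ∀ x, R < ‖x‖ → w x = 0)
    (hA : AFreeOn A univ w) (x : Rd d) (a : Fin N) :
    TJ k J w x a = cv (dilF J φ) (fun y => w y a) x - cv (dilF (-(J:ℤ) - 1) φ) (fun y => w y a) x := by
  -- cutoff
  obtain ⟨χ, hχs, hχc, hχ1⟩ : ∃ χ : Rd d → ℝ, ContDiff ℝ (⊤ : ℕ∞) χ ∧ HasCompactSupport χ ∧
      ∀ y, ‖y‖ ≤ R → χ =ᶠ[𝓝 y] fun _ => 1 := by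
    let f : ContDiffBump (0 : Rd d) := ⟨|R| + 1, |R| + 2, by positivity, by linarith⟩
    refine ⟨f, f.contDiff, f.hasCompactSupport, fun y hy => ?_⟩
    refine f.eventuallyEq_one_of_mem_ball ?_
    simp only [mem_ball, dist_zero_right, f]
    linarith [le_abs_self R]
  set L : Fin M → Rd d → ℝ := fun m => DW (fun j => ((2:ℝ)^j)^d * ((2:ℝ)^j)⁻¹) J (l a m) with hL
  have hLs : ∀ m, ContDiff ℝ (⊤ : ℕ∞) (L m) := fun m => dw_contDiff _ J (l a m)
  set ψ : Rd d → Vec M := fun y m => χ y * L m (x - y) with hψ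
  have hψs : ContDiff ℝ (⊤ : ℕ∞) ψ := by
    rw [contDiff_pi]
    intro m
    exact hχs.mul ((hLs m).comp (by fun_prop))
  have hψc : HasCompactSupport ψ := by
    refine HasCompactSupport.intro hχc fun y hy => ?_
    funext m
    simp [hψ, image_eq_zero_of_notMem_tsupport hy]
  have hfd : ∀ y, ‖y‖ ≤ R → ∀ m i, fderiv ℝ (fun y => ψ y m) y (Pi.single i 1) =
      - fderiv ℝ (L m) (x - y) (Pi.single i 1) := by
    intro y hy m i
    have e : (fun y => ψ y m) =ᶠ[𝓝 y] fun y => L m (x - y) := by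
      filter_upwards [hχ1 y hy] with z hz
      simp [hψ, hz]
    rw [e.fderiv_eq]
    have h1 : HasFDerivAt (fun y => L m (x - y)) ((fderiv ℝ (L m) (x - y)).comp
        (-ContinuousLinearMap.id ℝ (Rd d))) y := by
      refine HasFDerivAt.comp y (g := L m) (f := fun y => x - y) ?_ ?_
      · exact ((hLs m).differentiable (by simp) _).hasFDerivAt
      · exact (hasFDerivAt_id y).const_sub x
    rw [h1.fderiv]; simp
  have key : ∀ y, dot (w y) (adjApply A ψ y) =
      ∑ b, ((if a = b then dilF J φ (x-y) - dilF (-(J:ℤ) - 1) φ (x-y) else 0) - KJ J (k a b) (x-y)) * w y b := by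
    intro y
    by_cases hy : R < ‖y‖
    · simp [hR y hy, dot]
    · push Not at hy
      unfold dot
      refine Finset.sum_congr rfl fun b _ => ?_
      rw [adjApply_eq A ψ (hψs.differentiable (by simp)), rep_J h, mul_comm]
      congr 1
      simp only [hfd y hy, mul_neg, Finset.sum_neg_distrib, neg_neg, hL]
  have h0 := hA ψ ⟨hψs, hψc, subset_univ _⟩
  rw [setIntegral_univ] at h0
  simp only [key] at h0
  have hI1 : ∀ b, Integrable (fun y => KJ J (k a b) (x-y) * w y b) := fun b =>
    cv_integrable (kj_nice J (k a b)) (integrable_comp hw b) x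
  have hI2 : ∀ (j : ℤ) b, Integrable (fun y => dilF j φ (x-y) * w y b) := fun j b =>
    cv_integrable (dil_nice j φ) (integrable_comp hw b) x
  have hI3 : ∀ b, Integrable (fun y => (if a = b then dilF J φ (x-y) - dilF (-(J:ℤ) - 1) φ (x-y) else 0) * w y b) := by
    intro b
    split_ifs
    · simp only [sub_mul]; exact (hI2 _ b).sub (hI2 _ b)
    · simp
  simp only [sub_mul (ite _ _ _)] at h0
  rw [integral_finsetSum _ fun b _ => (hI3 b).sub' (hI1 b)] at h0
  rw [Finset.sum_congr rfl fun b _ => integral_sub (hI3 b) (hI1 b), Finset.sum_sub_distrib,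
    sub_eq_zero, Finset.sum_eq_single a] at h0
  · simp only [if_true, sub_mul] at h0
    rw [integral_sub (hI2 _ a) (hI2 _ a)] at h0
    unfold TJ cv
    exact h0.symm
  · intro b _ hb; simp [hb.symm]
  · simp

lemma L2bd.mono {d : ℕ} {K : Rd d → ℝ} {B B' : ℝ≥0} (h : L2bd K B) (hB : B ≤ B') : L2bd K B' :=
  fun f hf => (h f hf).trans (mul_le_mul' (by exact_mod_cast hB) le_rfl)

lemma Horm.mono {d : ℕ} {K : Rd d → ℝ} {B B' : ℝ≥0} (h : Horm K B) (hB : B ≤ B') : Horm K B' :=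
  fun y => (h y).trans (by exact_mod_cast hB)

lemma eLpNorm_of_lint {d : ℕ} {q : ℝ} (hq : 0 < q) {f g : Rd d → ℝ} {C : ℝ≥0}
    (h : ∫⁻ x, ‖f x‖ₑ ^ q ≤ C * ∫⁻ x, ‖g x‖ₑ ^ q) :
    eLpNorm f (ENNReal.ofReal q) volume ≤ (C : ℝ≥0∞) ^ (1 / q) * eLpNorm g (ENNReal.ofReal q) volume := by
  have h0 : ENNReal.ofReal q ≠ 0 := by simpa using hq
  rw [eLpNorm_eq_lintegral_rpow_enorm_toReal h0 ENNReal.ofReal_ne_top, eLpNorm_eq_lintegral_rpow_enorm_toReal h0 ENNReal.ofReal_ne_top,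
    ENNReal.toReal_ofReal hq.le, ← ENNReal.mul_rpow_of_nonneg _ _ (by positivity)]
  exact ENNReal.rpow_le_rpow h (by positivity)

lemma TJ_cont {d N : ℕ} (k : Fin N → Fin N → 𝓢(Rd d, ℝ)) (J : ℕ) (t : Rd d → Vec N)
    (ht : Integrable t) : Continuous (TJ k J t) := by
  refine continuous_pi fun a => continuous_finsetSum _ fun b _ => ?_
  exact cv_continuous (kj_nice J (k a b)) (integrable_comp ht b)

theorem TJ_Lp {d N M : ℕ} (hd : 0 < d) {A : Fin d → (Vec N →ₗ[ℝ] Vec M)} {k : Fin N → Fin N → 𝓢(Rd d, ℝ)}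
    {l : Fin N → Fin M → 𝓢(Rd d, ℝ)} {φ : 𝓢(Rd d, ℝ)} (h : ProjK A k l φ) (q : ℝ) (hq : 1 < q) :
    ∃ C : ℝ≥0, ∀ J (t : Rd d → Vec N), Integrable t →
      eLpNorm (TJ k J t) (ENNReal.ofReal q) volume ≤ C * eLpNorm t (ENNReal.ofReal q) volume := by
  obtain ⟨B1, hB1⟩ := h.l2
  choose B2 hB2 using fun a b => kj_horm (k a b)
  set B : ℝ≥0 := B1 + ∑ a, ∑ b, B2 a b with hB
  obtain ⟨C, hC⟩ := strong_q hd B q hq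
  have hB2' : ∀ a b, B2 a b ≤ B := fun a b => by
    have h1 : B2 a b ≤ ∑ b, B2 a b := Finset.single_le_sum (f := fun b => B2 a b) (fun _ _ => zero_le) (Finset.mem_univ b)
    have h2 : ∑ b, B2 a b ≤ ∑ a, ∑ b, B2 a b :=
      Finset.single_le_sum (f := fun a => ∑ b, B2 a b) (fun _ _ => zero_le) (Finset.mem_univ a)
    exact (h1.trans h2).trans (le_add_of_nonneg_left zero_le)
  have hq1 : 1 ≤ ENNReal.ofReal q := by simpa using hq.le
  have hc1 : ∀ a b J (t : Rd d → Vec N), Integrable t →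
      eLpNorm (cv (KJ J (k a b)) (fun y => t y b)) (ENNReal.ofReal q) volume ≤
        (C : ℝ≥0∞) ^ (1 / q) * eLpNorm t (ENNReal.ofReal q) volume := by
    intro a b J t ht
    refine (eLpNorm_of_lint (by linarith) (hC _ (kj_nice J (k a b)) ((hB1 a b J).mono (by simp [hB]))
      ((hB2 a b J).mono (hB2' a b)) _ (integrable_comp ht b))).trans ?_
    refine mul_le_mul' le_rfl (eLpNorm_mono fun x => norm_le_pi_norm (t x) b)
  refine ⟨(N * N : ℝ≥0) * C ^ (1 / q), fun J t ht => ?_⟩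
  have hm : ∀ a b, AEStronglyMeasurable (fun x => |cv (KJ J (k a b)) (fun y => t y b) x|) volume := fun a b =>
    (cv_continuous (kj_nice J (k a b)) (integrable_comp ht b)).abs.aestronglyMeasurable
  calc eLpNorm (TJ k J t) (ENNReal.ofReal q) volume
      ≤ eLpNorm (∑ a, ∑ b, fun x => |cv (KJ J (k a b)) (fun y => t y b) x|) (ENNReal.ofReal q) volume := by
        refine eLpNorm_mono_real fun x => ?_
        rw [Finset.sum_apply]
        refine (pi_norm_le_iff_of_nonneg (Finset.sum_nonneg fun a _ => ?_)).2 fun a => ?_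
        · rw [Finset.sum_apply]; exact Finset.sum_nonneg fun b _ => abs_nonneg _
        · have h1 : ‖TJ k J t x a‖ ≤ (∑ b, fun x => |cv (KJ J (k a b)) (fun y => t y b) x|) x := by
            rw [Finset.sum_apply]; exact norm_sum_le _ _
          refine h1.trans (Finset.single_le_sum (f := fun a => (∑ b, fun x => |cv (KJ J (k a b)) (fun y => t y b) x|) x)
            (fun a _ => ?_) (Finset.mem_univ a))
          rw [Finset.sum_apply]; exact Finset.sum_nonneg fun b _ => abs_nonneg _
    _ ≤ ∑ a, ∑ b, (C : ℝ≥0∞) ^ (1 / q) * eLpNorm t (ENNReal.ofReal q) volume := by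
        refine (eLpNorm_sum_le (fun a _ => Finset.aestronglyMeasurable_sum _ fun b _ => hm a b) hq1).trans ?_
        refine Finset.sum_le_sum fun a _ => ?_
        refine (eLpNorm_sum_le (fun b _ => hm a b) hq1).trans ?_
        refine Finset.sum_le_sum fun b _ => ?_
        refine le_trans (le_of_eq ?_) (hc1 a b J t ht)
        exact eLpNorm_congr_norm_ae (Eventually.of_forall fun x => by simp)
    _ = _ := by
        simp only [Finset.sum_const, Finset.card_univ, Fintype.card_fin, nsmul_eq_mul]
        push_cast
        rw [← ENNReal.coe_rpow_of_nonneg _ (by positivity)]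
        ring

end HC

namespace HC
open scoped SchwartzMap

lemma young1 {d : ℕ} {K f : Rd d → ℝ} (hK : NiceK K) (hf : Integrable f) :
    ∫⁻ x, ‖cv K f x‖ₑ ≤ (∫⁻ x, ‖K x‖ₑ) * ∫⁻ x, ‖f x‖ₑ := by
  have hKc := hK.cont
  calc ∫⁻ x, ‖cv K f x‖ₑ ≤ ∫⁻ x, ∫⁻ y, ‖K (x - y)‖ₑ * ‖f y‖ₑ := by
        refine lintegral_mono fun x => (enorm_integral_le_lintegral_enorm _).trans (le_of_eq ?_)
        simp only [enorm_mul]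
    _ = ∫⁻ y, ∫⁻ x, ‖K (x - y)‖ₑ * ‖f y‖ₑ := by
        refine lintegral_lintegral_swap ?_
        refine AEMeasurable.mul (f := fun z : Rd d × Rd d => ‖K (z.1 - z.2)‖ₑ) (g := fun z : Rd d × Rd d => ‖f z.2‖ₑ) ?_ ?_
        · exact (Continuous.measurable (by fun_prop) : Measurable fun z : Rd d × Rd d => ‖K (z.1 - z.2)‖ₑ).aemeasurable
        · exact (hf.aestronglyMeasurable.comp_snd (μ := volume)).enorm
    _ = ∫⁻ y, (∫⁻ x, ‖K x‖ₑ) * ‖f y‖ₑ := by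
        refine lintegral_congr fun y => ?_
        rw [lintegral_mul_const _ (Continuous.measurable (by fun_prop))]
        congr 1
        exact lintegral_sub_right_eq_self (fun x => ‖K x‖ₑ) y
    _ = _ := by
        rw [lintegral_const_mul' _ _ hK.int.hasFiniteIntegral.ne]

lemma dil_L1 {d : ℕ} (j : ℤ) (φ : 𝓢(Rd d, ℝ)) : ∫⁻ x, ‖dilF j φ x‖ₑ = ∫⁻ x, ‖φ x‖ₑ := by
  have hc := φ.continuous
  rw [← lintegral_dil ((2:ℝ)^j) (by positivity) (fun x => ‖φ x‖ₑ) (Continuous.measurable (by fun_prop))]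
  refine lintegral_congr fun x => ?_
  unfold dilF
  rw [enorm_mul, Real.enorm_of_nonneg (by positivity)]

lemma cv_dil {d : ℕ} (j : ℤ) (φ : 𝓢(Rd d, ℝ)) (g : Rd d → ℝ) (x : Rd d) :
    cv (dilF j φ) g x = ∫ y, φ y * g (x - ((2:ℝ)^j)⁻¹ • y) := by
  unfold cv
  have h1 := integral_sub_left_eq_self (fun y => dilF j φ y * g (x - y)) volume x
  simp only [sub_sub_cancel] at h1
  rw [h1]
  have h2 := Measure.integral_comp_smul (volume : Measure (Rd d)) (fun y => φ y * g (x - ((2:ℝ)^j)⁻¹ • y)) ((2:ℝ)^j)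
  have hne : (2:ℝ)^j ≠ 0 := by positivity
  simp only [smul_smul, inv_mul_cancel₀ hne, one_smul, Module.finrank_fin_fun] at h2
  rw [abs_of_nonneg (by positivity), smul_eq_mul, inv_mul_eq_div, eq_div_iff (by positivity)] at h2
  rw [← h2, ← integral_mul_const]
  refine integral_congr_ae (Eventually.of_forall fun y => ?_)
  simp only [dilF]; ring

lemma moll_cont {d : ℕ} (φ : 𝓢(Rd d, ℝ)) (hφ : ∫ x, φ x = 1) (g : Rd d → ℝ) (hg : Continuous g)
    (hgc : HasCompactSupport g) (Ω : Set (Rd d)) (hΩ : volume Ω ≠ ∞) :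
    Tendsto (fun J : ℕ => ∫⁻ x in Ω, ‖cv (dilF J φ) g x - g x‖ₑ) atTop (𝓝 0) := by
  obtain ⟨C, hC⟩ := hgc.exists_bound_of_continuous hg
  have hgi : Integrable g := hg.integrable_of_hasCompactSupport hgc
  have hC0 : 0 ≤ C := (norm_nonneg _).trans (hC 0)
  have hφi : Integrable φ := φ.integrable
  have hφc := φ.continuous
  have hb : ∀ (J : ℕ) x, ‖cv (dilF J φ) g x‖ ≤ ∫ y, ‖φ y‖ * C := by
    intro J x
    rw [cv_dil]
    refine norm_integral_le_of_norm_le (hφi.norm.mul_const C) (Eventually.of_forall fun y => ?_)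
    rw [norm_mul]; exact mul_le_mul_of_nonneg_left (hC _) (norm_nonneg _)
  have h0 : (0 : ℝ≥0∞) = ∫⁻ x in Ω, 0 := by simp
  rw [h0]
  refine tendsto_lintegral_of_dominated_convergence (fun _ => ENNReal.ofReal ((∫ y, ‖φ y‖ * C) + C)) ?_ ?_ ?_ ?_
  · intro J
    have := cv_continuous (dil_nice J φ) hgi
    exact Continuous.measurable (by fun_prop)
  · intro J
    refine Eventually.of_forall fun x => ?_
    beta_reduce
    rw [← ofReal_norm]
    exact ENNReal.ofReal_le_ofReal ((norm_sub_le _ _).trans (add_le_add (hb J x) (hC x)))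
  · simp only [lintegral_const, Measure.restrict_apply_univ]
    exact ENNReal.mul_ne_top ENNReal.ofReal_ne_top hΩ
  · refine Eventually.of_forall fun x => ?_
    have : Tendsto (fun J : ℕ => cv (dilF J φ) g x) atTop (𝓝 (g x)) := by
      have e : g x = ∫ y, φ y * g x := by rw [integral_mul_const, hφ, one_mul]
      rw [e]
      simp only [cv_dil]
      refine tendsto_integral_of_dominated_convergence (fun y => ‖φ y‖ * C) ?_ (hφi.norm.mul_const C) ?_ ?_
      · exact fun J => Continuous.aestronglyMeasurable (by fun_prop)
      · intro J; refine Eventually.of_forall fun y => ?_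
        rw [norm_mul]; exact mul_le_mul_of_nonneg_left (hC _) (norm_nonneg _)
      · refine Eventually.of_forall fun y => Tendsto.const_mul _ ?_
        have h1 : Tendsto (fun J : ℕ => x - ((2:ℝ)^(J:ℤ))⁻¹ • y) atTop (𝓝 x) := by
          have h2 : Tendsto (fun J : ℕ => ((2:ℝ)^(J:ℤ))⁻¹) atTop (𝓝 0) := by
            simp only [zpow_natCast, ← inv_pow]
            exact tendsto_pow_atTop_nhds_zero_of_lt_one (by norm_num) (by norm_num)
          simpa using (h2.smul_const y).const_sub x
        exact (hg.tendsto x).comp h1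
    have h3 := (this.sub_const (g x)).enorm
    simpa using h3

lemma moll {d : ℕ} (φ : 𝓢(Rd d, ℝ)) (hφ : ∫ x, φ x = 1) (f : Rd d → ℝ) (hf : Integrable f)
    (Ω : Set (Rd d)) (hΩ : volume Ω ≠ ∞) :
    Tendsto (fun J : ℕ => ∫⁻ x in Ω, ‖cv (dilF J φ) f x - f x‖ₑ) atTop (𝓝 0) := by
  rw [ENNReal.tendsto_atTop_zero]
  intro ε hε
  set B : ℝ≥0∞ := ∫⁻ x, ‖φ x‖ₑ with hB
  have hBt : B ≠ ∞ := φ.integrable.hasFiniteIntegral.ne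
  obtain ⟨δ, hδ, hδ2⟩ : ∃ δ : ℝ≥0∞, δ ≠ 0 ∧ B * δ + δ ≤ ε / 2 := by
    have hε2 : ε / 2 ≠ 0 := (ENNReal.half_pos hε.ne').ne'
    by_cases ht : ε = ∞
    · exact ⟨1, by simp, by simp [ht, ENNReal.top_div]⟩
    refine ⟨ε / 2 / (B + 1), ?_, ?_⟩
    · exact (ENNReal.div_pos hε2 (by simp [hBt])).ne'
    · calc B * (ε / 2 / (B + 1)) + (ε / 2 / (B + 1)) = (B + 1) * (ε / 2 / (B + 1)) := by ring
        _ ≤ ε / 2 := ENNReal.mul_div_le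
  obtain ⟨g, hgc, hfg, hg, hgi⟩ := hf.exists_hasCompactSupport_lintegral_sub_le hδ
  have h1 := moll_cont φ hφ g hg hgc Ω hΩ
  rw [ENNReal.tendsto_atTop_zero] at h1
  obtain ⟨J0, hJ0⟩ := h1 (ε / 2) (ENNReal.half_pos hε.ne')
  refine ⟨J0, fun J hJ => ?_⟩
  have hdi : Integrable (fun x => f x - g x) := hf.sub hgi
  have hm1 := cv_continuous (dil_nice J φ) hdi
  have hm2 := cv_continuous (dil_nice J φ) hgi
  calc ∫⁻ x in Ω, ‖cv (dilF J φ) f x - f x‖ₑ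
      ≤ ∫⁻ x in Ω, (‖cv (dilF J φ) (fun y => f y - g y) x‖ₑ + ‖f x - g x‖ₑ) + ‖cv (dilF J φ) g x - g x‖ₑ := by
        refine lintegral_mono fun x => ?_
        have e : cv (dilF J φ) f x = cv (dilF J φ) (fun y => f y - g y) x + cv (dilF J φ) g x := by
          rw [← cv_add (dil_nice J φ) hdi hgi]; simp
        have e2 : cv (dilF J φ) f x - f x = (cv (dilF J φ) (fun y => f y - g y) x - (f x - g x)) + (cv (dilF J φ) g x - g x) := by
          rw [e]; ring
        rw [e2]
        exact (enorm_add_le _ _).trans (add_le_add enorm_sub_le le_rfl)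
    _ = (∫⁻ x in Ω, ‖cv (dilF J φ) (fun y => f y - g y) x‖ₑ + ‖f x - g x‖ₑ) + ∫⁻ x in Ω, ‖cv (dilF J φ) g x - g x‖ₑ :=
        lintegral_add_right _ (Continuous.measurable (by fun_prop))
    _ ≤ (B * δ + δ) + ε / 2 := by
        refine add_le_add ?_ (hJ0 J hJ)
        rw [lintegral_add_left (Continuous.measurable (by fun_prop))]
        refine add_le_add ?_ ((setLIntegral_le_lintegral _ _).trans hfg)
        refine (setLIntegral_le_lintegral _ _).trans ((young1 (dil_nice J φ) hdi).trans ?_)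
        rw [dil_L1]
        exact mul_le_mul' le_rfl hfg
    _ ≤ ε / 2 + ε / 2 := add_le_add hδ2 le_rfl
    _ = ε := ENNReal.add_halves ε

lemma moll2 {d : ℕ} (hd : 0 < d) (φ : 𝓢(Rd d, ℝ)) (f : Rd d → ℝ) (hf : Integrable f)
    (Ω : Set (Rd d)) (hΩ : volume Ω ≠ ∞) :
    Tendsto (fun J : ℕ => ∫⁻ x in Ω, ‖cv (dilF (-(J:ℤ) - 1) φ) f x‖ₑ) atTop (𝓝 0) := by
  obtain ⟨C, hC⟩ : ∃ C, ∀ x, ‖φ x‖ ≤ C := ⟨_, fun x => SchwartzMap.norm_le_seminorm ℝ φ x⟩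
  have hC0 : 0 ≤ C := (norm_nonneg _).trans (hC 0)
  set I := ∫ y, ‖f y‖ with hI
  have hI0 : 0 ≤ I := integral_nonneg fun _ => norm_nonneg _
  have hb : ∀ (J : ℕ) x, ‖cv (dilF (-(J:ℤ) - 1) φ) f x‖ₑ ≤ ENNReal.ofReal ((1/2:ℝ)^J * (C * I)) := by
    intro J x
    rw [← ofReal_norm]
    refine ENNReal.ofReal_le_ofReal ?_
    unfold cv
    have e : (1/2:ℝ)^J * (C * I) = ∫ y, ((1/2:ℝ)^J * C) * ‖f y‖ := by rw [integral_const_mul]; ring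
    rw [e]
    refine norm_integral_le_of_norm_le (hf.norm.const_mul _) (Eventually.of_forall fun y => ?_)
    rw [norm_mul]
    refine mul_le_mul_of_nonneg_right ?_ (norm_nonneg _)
    unfold dilF
    rw [norm_mul, Real.norm_of_nonneg (by positivity)]
    refine mul_le_mul ?_ (hC _) (norm_nonneg _) (by positivity)
    have e2 : (2:ℝ)^(-(J:ℤ) - 1) = (1/2:ℝ)^(J+1) := by
      rw [show -(J:ℤ) - 1 = -((J+1:ℕ):ℤ) by push_cast; ring, zpow_neg, zpow_natCast, one_div, inv_pow]
    rw [e2, ← pow_mul]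
    refine pow_le_pow_of_le_one (by norm_num) (by norm_num) ?_
    nlinarith
  have h2 : Tendsto (fun J : ℕ => ENNReal.ofReal ((1/2:ℝ)^J * (C * I)) * volume Ω) atTop (𝓝 0) := by
    have h3 : Tendsto (fun J : ℕ => (1/2:ℝ)^J * (C * I)) atTop (𝓝 0) := by
      simpa using (tendsto_pow_atTop_nhds_zero_of_lt_one (r := (1/2:ℝ)) (by norm_num) (by norm_num)).mul_const (C * I)
    have h4 := ENNReal.tendsto_ofReal h3
    rw [ENNReal.ofReal_zero] at h4
    simpa using ENNReal.Tendsto.mul_const h4 (Or.inr hΩ)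
  refine tendsto_of_tendsto_of_tendsto_of_le_of_le tendsto_const_nhds h2 (fun _ => zero_le) fun J => ?_
  refine (lintegral_mono fun x => hb J x).trans (le_of_eq ?_)
  simp

theorem TJ_tendsto {d N M : ℕ} (hd : 0 < d) {A : Fin d → (Vec N →ₗ[ℝ] Vec M)} {k : Fin N → Fin N → 𝓢(Rd d, ℝ)}
    {l : Fin N → Fin M → 𝓢(Rd d, ℝ)} {φ : 𝓢(Rd d, ℝ)} (h : ProjK A k l φ)
    (w : Rd d → Vec N) (hw : Integrable w) (R : ℝ) (hR : ∀ x, R < ‖x‖ → w x = 0)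
    (hA : AFreeOn A univ w) (Ω : Set (Rd d)) (hΩ : volume Ω ≠ ∞) :
    Tendsto (fun J : ℕ => ∫⁻ x in Ω, ‖TJ k J w x - w x‖ₑ) atTop (𝓝 0) := by
  have h1 : Tendsto (fun J : ℕ => ∑ a : Fin N, ((∫⁻ x in Ω, ‖cv (dilF J φ) (fun y => w y a) x - w x a‖ₑ) +
      ∫⁻ x in Ω, ‖cv (dilF (-(J:ℤ) - 1) φ) (fun y => w y a) x‖ₑ)) atTop (𝓝 0) := by
    have e : (0 : ℝ≥0∞) = ∑ a : Fin N, (0 + 0) := by simp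
    rw [e]
    refine tendsto_finsetSum _ fun a _ => Tendsto.add ?_ ?_
    · exact moll φ h.mass _ (integrable_comp hw a) Ω hΩ
    · exact moll2 hd φ _ (integrable_comp hw a) Ω hΩ
  refine tendsto_of_tendsto_of_tendsto_of_le_of_le tendsto_const_nhds h1 (fun _ => zero_le) fun J => ?_
  have hm : ∀ a j, Continuous (cv (dilF j φ) (fun y => w y a)) := fun a j =>
    cv_continuous (dil_nice j φ) (integrable_comp hw a)
  have hm2 : ∀ a, AEMeasurable (fun x => ‖cv (dilF J φ) (fun y => w y a) x - w x a‖ₑ) (volume.restrict Ω) := fun a =>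
    (((hm a J).aestronglyMeasurable.sub (integrable_comp hw a).aestronglyMeasurable).enorm).restrict
  have hm3 : ∀ a, AEMeasurable (fun x => ‖cv (dilF (-(J:ℤ) - 1) φ) (fun y => w y a) x‖ₑ) (volume.restrict Ω) := fun a =>
    ((hm a _).aestronglyMeasurable.enorm).restrict
  calc ∫⁻ x in Ω, ‖TJ k J w x - w x‖ₑ ≤ ∫⁻ x in Ω, ∑ a : Fin N,
      (‖cv (dilF J φ) (fun y => w y a) x - w x a‖ₑ + ‖cv (dilF (-(J:ℤ) - 1) φ) (fun y => w y a) x‖ₑ) := by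
        refine lintegral_mono fun x => ?_
        rw [← ofReal_norm]
        have : ‖TJ k J w x - w x‖ ≤ ∑ a : Fin N, (‖cv (dilF J φ) (fun y => w y a) x - w x a‖ + ‖cv (dilF (-(J:ℤ) - 1) φ) (fun y => w y a) x‖) := by
          refine (pi_norm_le_iff_of_nonneg (Finset.sum_nonneg fun a _ => by positivity)).2 fun a => ?_
          refine le_trans ?_ (Finset.single_le_sum (f := fun a => ‖cv (dilF J φ) (fun y => w y a) x - w x a‖ + ‖cv (dilF (-(J:ℤ) - 1) φ) (fun y => w y a) x‖)
            (fun a _ => by positivity) (Finset.mem_univ a))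
          rw [Pi.sub_apply, TJ_rep h J w hw R hR hA x a, sub_right_comm]
          exact norm_sub_le _ _
        refine (ENNReal.ofReal_le_ofReal this).trans (le_of_eq ?_)
        rw [ENNReal.ofReal_sum_of_nonneg fun a _ => by positivity]
        refine Finset.sum_congr rfl fun a _ => ?_
        rw [ENNReal.ofReal_add (by positivity) (by positivity), ofReal_norm, ofReal_norm]
    _ = _ := by
        have hm4 : ∀ a, AEMeasurable (fun x => ‖cv (dilF J φ) (fun y => w y a) x - w x a‖ₑ + ‖cv (dilF (-(J:ℤ) - 1) φ) (fun y => w y a) x‖ₑ) (volume.restrict Ω) := fun a => (hm2 a).add (hm3 a)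
        rw [lintegral_finsetSum' _ fun a _ => hm4 a]
        refine Finset.sum_congr rfl fun a _ => ?_
        rw [lintegral_add_left' (hm2 a)]

end HC

namespace HC

lemma seq_tail (I : ℕ → ℕ → ℝ) (B : ℝ) (hm : ∀ n, Monotone (I n)) (h0 : ∀ n k, 0 ≤ I n k)
    (hB : ∀ n k, I n k ≤ B) :
    ∃ σ : ℕ → ℕ, StrictMono σ ∧ ∀ η > 0, ∃ j : ℕ, ∀ n, j ≤ n → I (σ n) n - I (σ n) j ≤ η := by
  have hc : IsCompact (Set.univ.pi (fun _ : ℕ => Icc (0:ℝ) B)) :=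
    isCompact_univ_pi fun _ => isCompact_Icc
  obtain ⟨α, hα, φ, hφ, hlim⟩ := hc.tendsto_subseq (x := I) (fun n => by
    intro k _; exact ⟨h0 n k, hB n k⟩)
  have hlim' : ∀ k, Tendsto (fun n => I (φ n) k) atTop (𝓝 (α k)) := fun k =>
    (tendsto_pi_nhds.1 hlim) k
  have hev : ∀ n : ℕ, ∀ᶠ m in atTop, ∀ k ≤ n, |I (φ m) k - α k| < 1 / ((n:ℝ) + 1) := by
    intro n
    have := (Finset.range (n+1)).eventually_all (l := (atTop : Filter ℕ))
      (p := fun k m => |I (φ m) k - α k| < 1 / ((n:ℝ) + 1))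
    have h2 := this.2 (fun k _ => by
      have := (Metric.tendsto_atTop.1 (hlim' k)) (1 / ((n:ℝ) + 1)) (by positivity)
      obtain ⟨N, hN⟩ := this
      filter_upwards [eventually_ge_atTop N] with m hm
      exact hN m hm)
    filter_upwards [h2] with m hm k hk
    exact hm k (Finset.mem_range.2 (by omega))
  obtain ⟨ψ, hψ, hψ2⟩ := extraction_forall_of_eventually hev
  have hαm : Monotone α := fun a b hab =>
    le_of_tendsto_of_tendsto' (hlim' a) (hlim' b) fun n => hm _ hab
  have hαb : BddAbove (range α) := ⟨B, by
    rintro _ ⟨k, rfl⟩; exact (hα k trivial).2⟩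
  have hαl := tendsto_atTop_ciSup hαm hαb
  refine ⟨φ ∘ ψ, hφ.comp hψ, fun η hη => ?_⟩
  have e1 : ∀ᶠ j in atTop, (⨆ i, α i) - η/2 < α j :=
    hαl.eventually (lt_mem_nhds (by linarith))
  have e2 : ∀ᶠ j : ℕ in atTop, 1 / ((j:ℝ)+1) < η/4 :=
    tendsto_one_div_add_atTop_nhds_zero_nat.eventually (gt_mem_nhds (by linarith))
  obtain ⟨j, h1, h2⟩ := (e1.and e2).exists
  refine ⟨j, fun n hn => ?_⟩
  have a1 := abs_lt.1 (hψ2 n n le_rfl)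
  have a2 := abs_lt.1 (hψ2 n j hn)
  have a3 : α n ≤ ⨆ i, α i := le_ciSup hαb n
  have a4 : 1 / ((n:ℝ)+1) ≤ 1 / ((j:ℝ)+1) := by
    apply one_div_le_one_div_of_le (by positivity); exact_mod_cast Nat.succ_le_succ hn
  simp only [Function.comp]
  linarith

/-- truncation at level `n`. -/
def trunc {d N : ℕ} (n : ℕ) (w : Rd d → Vec N) : Rd d → Vec N :=
  {x | ‖w x‖ ≤ (n:ℝ)}.indicator w

lemma trunc_meas {d N : ℕ} (n : ℕ) {w : Rd d → Vec N} (hw : Measurable w) :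
    Measurable (trunc n w) :=
  hw.indicator (measurableSet_le hw.norm measurable_const)

lemma trunc_norm_le {d N : ℕ} (n : ℕ) (w : Rd d → Vec N) (x) : ‖trunc n w x‖ ≤ ‖w x‖ :=
  norm_indicator_le_norm_self _ _

lemma trunc_tail {d N : ℕ} (p : ℝ) (hp : 1 < p) (μ : Measure (Rd d)) (w : ℕ → Rd d → Vec N)
    (hw : ∀ n, Measurable (w n)) (B : ℝ≥0∞) (hBt : B ≠ ∞)
    (hB : ∀ n, ∫⁻ x, ‖w n x‖ₑ ^ p ∂μ ≤ B) :
    ∃ σ : ℕ → ℕ, StrictMono σ ∧ ∀ η : ℝ, 0 < η → ∃ C : ℝ≥0, ∀ n,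
      ∫⁻ x in {x | C ≤ ‖trunc n (w (σ n)) x‖₊}, ‖trunc n (w (σ n)) x‖ₑ ^ p ∂μ ≤ ENNReal.ofReal η := by
  have hle : ∀ n S, ∫⁻ x in S, ‖w n x‖ₑ ^ p ∂μ ≤ B := fun n S =>
    (setLIntegral_le_lintegral _ _).trans (hB n)
  have hlt : ∀ n S, ∫⁻ x in S, ‖w n x‖ₑ ^ p ∂μ ≠ ∞ := fun n S =>
    ((hle n S).trans_lt hBt.lt_top).ne
  obtain ⟨σ, hσ, h⟩ := seq_tail (fun n k => (∫⁻ x in {x | ‖w n x‖ ≤ (k:ℝ)}, ‖w n x‖ₑ ^ p ∂μ).toReal)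
    B.toReal (fun n a b hab => ENNReal.toReal_mono (hlt _ _) (lintegral_mono_set (by
      intro x hx; exact le_trans (show ‖w n x‖ ≤ a from hx) (by exact_mod_cast hab))))
    (fun n k => ENNReal.toReal_nonneg) (fun n k => ENNReal.toReal_mono hBt (hle _ _))
  refine ⟨σ, hσ, fun η hη => ?_⟩
  obtain ⟨j, hj⟩ := h η hη
  refine ⟨(j:ℝ≥0) + 1, fun n => ?_⟩
  have hms : ∀ k : ℕ, MeasurableSet {x | ‖w (σ n) x‖ ≤ (k:ℝ)} := fun k =>
    measurableSet_le (hw _).norm measurable_const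
  have hsub : ∀ x, (j:ℝ≥0) + 1 ≤ ‖trunc n (w (σ n)) x‖₊ →
      x ∈ {x | ‖w (σ n) x‖ ≤ (n:ℝ)} \ {x | ‖w (σ n) x‖ ≤ (j:ℝ)} ∧ trunc n (w (σ n)) x = w (σ n) x := by
    intro x hx
    have hx' : (j:ℝ) + 1 ≤ ‖trunc n (w (σ n)) x‖ := by exact_mod_cast hx
    by_cases hh : ‖w (σ n) x‖ ≤ n
    · have e : trunc n (w (σ n)) x = w (σ n) x := indicator_of_mem (by exact hh) _
      refine ⟨⟨hh, fun h2 => ?_⟩, e⟩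
      have h2' : ‖w (σ n) x‖ ≤ (j:ℝ) := h2
      rw [e] at hx'; linarith
    · have e : trunc n (w (σ n)) x = 0 := indicator_of_notMem (by exact hh) _
      rw [e] at hx'; simp at hx'; exfalso; linarith [(Nat.cast_nonneg j : (0:ℝ) ≤ j)]
  have hmt : MeasurableSet {x | (j:ℝ≥0) + 1 ≤ ‖trunc n (w (σ n)) x‖₊} :=
    measurableSet_le measurable_const (trunc_meas n (hw _)).nnnorm
  have step1 : ∫⁻ x in {x | (j:ℝ≥0) + 1 ≤ ‖trunc n (w (σ n)) x‖₊}, ‖trunc n (w (σ n)) x‖ₑ ^ p ∂μ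
      ≤ ∫⁻ x in {x | ‖w (σ n) x‖ ≤ (n:ℝ)} \ {x | ‖w (σ n) x‖ ≤ (j:ℝ)}, ‖w (σ n) x‖ₑ ^ p ∂μ := by
    rw [setLIntegral_congr_fun hmt (g := fun x => ‖w (σ n) x‖ₑ ^ p)
      (fun x hx => by beta_reduce; rw [(hsub x hx).2])]
    exact lintegral_mono_set fun x hx => (hsub x hx).1
  refine step1.trans ?_
  rcases le_total j n with hjn | hjn
  · have hss : {x | ‖w (σ n) x‖ ≤ (j:ℝ)} ⊆ {x | ‖w (σ n) x‖ ≤ (n:ℝ)} := fun x hx =>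
      le_trans (show ‖w (σ n) x‖ ≤ j from hx) (by exact_mod_cast hjn)
    have hadd := lintegral_inter_add_diff (μ := μ) (fun x => ‖w (σ n) x‖ₑ ^ p)
      {x | ‖w (σ n) x‖ ≤ (n:ℝ)} (hms j)
    rw [inter_eq_right.2 hss] at hadd
    have h3 := hj n hjn
    rw [← hadd, ENNReal.toReal_add (hlt _ _) (hlt _ _)] at h3
    rw [← ENNReal.ofReal_toReal (hlt (σ n) _)]
    exact ENNReal.ofReal_le_ofReal (by linarith)
  · have : {x | ‖w (σ n) x‖ ≤ (n:ℝ)} \ {x | ‖w (σ n) x‖ ≤ (j:ℝ)} = ∅ := by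
      rw [diff_eq_empty]
      intro x hx
      exact le_trans (show ‖w (σ n) x‖ ≤ n from hx) (by exact_mod_cast hjn)
    rw [this]; simp

end HC

namespace HC
open scoped SchwartzMap

lemma TJ_add {d N : ℕ} (k : Fin N → Fin N → 𝓢(Rd d, ℝ)) (J : ℕ) (t s : Rd d → Vec N)
    (ht : Integrable t) (hs : Integrable s) : TJ k J (t + s) = TJ k J t + TJ k J s := by
  funext x a
  simp only [TJ, Pi.add_apply]
  rw [← Finset.sum_add_distrib]
  exact Finset.sum_congr rfl fun b _ => cv_add (kj_nice J (k a b)) (integrable_comp ht b) (integrable_comp hs b) x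

lemma eLpNorm_tail {d N : ℕ} (p : ℝ) (hp : 1 < p) (μ : Measure (Rd d)) (t : Rd d → Vec N)
    (S : Set (Rd d)) (hS : MeasurableSet S) (η : ℝ) (hη : 0 < η)
    (h : ∫⁻ x in S, ‖t x‖ₑ ^ p ∂μ ≤ ENNReal.ofReal (η ^ p)) :
    eLpNorm (S.indicator t) (ENNReal.ofReal p) μ ≤ ENNReal.ofReal η := by
  have hp0 : 0 < p := by linarith
  rw [eLpNorm_indicator_eq_eLpNorm_restrict hS,
    eLpNorm_eq_lintegral_rpow_enorm_toReal (by simpa using hp0) ENNReal.ofReal_ne_top,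
    ENNReal.toReal_ofReal hp0.le]
  calc _ ≤ (ENNReal.ofReal (η ^ p)) ^ (1/p) := ENNReal.rpow_le_rpow h (by positivity)
    _ = _ := by
      rw [ENNReal.ofReal_rpow_of_pos (by positivity), ← Real.rpow_mul hη.le, mul_one_div_cancel hp0.ne',
        Real.rpow_one]

lemma integrable_of_bdd {d N : ℕ} {Ω : Set (Rd d)} (hΩm : MeasurableSet Ω) (hΩ : volume Ω ≠ ∞)
    (t : Rd d → Vec N) (ht : Measurable t) (C : ℝ) (hC : ∀ x, ‖t x‖ ≤ C) (h0 : ∀ x ∉ Ω, t x = 0) :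
    Integrable t := by
  have : t = Ω.indicator t := (indicator_eq_self.2 fun x hx => by
    by_contra h; exact hx (h0 x h)).symm
  rw [this, integrable_indicator_iff hΩm]
  have : IsFiniteMeasure (volume.restrict Ω) := ⟨by simpa using hΩ.lt_top⟩
  exact Integrable.of_bound ht.aestronglyMeasurable C (Eventually.of_forall hC)

lemma eLpNorm_bdd {d N : ℕ} {Ω : Set (Rd d)} (hΩm : MeasurableSet Ω)
    (q : ℝ≥0∞) (t : Rd d → Vec N) (C : ℝ) (hC : ∀ x, ‖t x‖ ≤ C) (h0 : ∀ x ∉ Ω, t x = 0) :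
    eLpNorm t q volume ≤ volume Ω ^ q.toReal⁻¹ * ENNReal.ofReal C := by
  have : t = Ω.indicator t := (indicator_eq_self.2 fun x hx => by
    by_contra h; exact hx (h0 x h)).symm
  rw [this, eLpNorm_indicator_eq_eLpNorm_restrict hΩm]
  simpa using eLpNorm_le_of_ae_bound (μ := volume.restrict Ω) (p := q) (Eventually.of_forall hC)

theorem TJ_unif {d N M : ℕ} (hd : 0 < d) {A : Fin d → (Vec N →ₗ[ℝ] Vec M)} {k : Fin N → Fin N → 𝓢(Rd d, ℝ)}
    {l : Fin N → Fin M → 𝓢(Rd d, ℝ)} {φ : 𝓢(Rd d, ℝ)} (h : ProjK A k l φ) (p : ℝ) (hp : 1 < p)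
    (Ω : Set (Rd d)) (hΩm : MeasurableSet Ω) (hΩ : volume Ω ≠ ∞) (t : ℕ → Rd d → Vec N)
    (ht : ∀ n, Measurable (t n)) (h0 : ∀ n, ∀ x ∉ Ω, t n x = 0) (hi : ∀ n, Integrable (t n))
    (htail : ∀ η : ℝ, 0 < η → ∃ C : ℝ≥0, ∀ n,
      eLpNorm ({x | C ≤ ‖t n x‖₊}.indicator (t n)) (ENNReal.ofReal p) volume ≤ ENNReal.ofReal η)
    (J : ℕ → ℕ) :
    UnifIntegrable (fun n => TJ k (J n) (t n)) (ENNReal.ofReal p) (volume.restrict Ω) := by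
  have hp0 : 0 < p := by linarith
  obtain ⟨C1, hC1⟩ := TJ_Lp hd h p hp
  obtain ⟨C2, hC2⟩ := TJ_Lp hd h (2*p) (by linarith)
  intro ε hε
  obtain ⟨C, hC⟩ := htail (ε / (2 * (C1 + 1))) (by positivity)
  -- low part bound
  set D : ℝ≥0∞ := C2 * (volume Ω ^ (ENNReal.ofReal (2*p)).toReal⁻¹ * ENNReal.ofReal C) with hD
  have hDt : D ≠ ∞ := ENNReal.mul_ne_top ENNReal.coe_ne_top
    (ENNReal.mul_ne_top (ENNReal.rpow_ne_top_of_nonneg (by positivity) hΩ) ENNReal.ofReal_ne_top)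
  have hlim : Tendsto (fun δ : ℝ => D * (ENNReal.ofReal δ) ^ (1/(2*p))) (𝓝[>] 0) (𝓝 0) := by
    have h1 : Tendsto (fun δ : ℝ => ENNReal.ofReal δ) (𝓝[>] 0) (𝓝 0) := by
      have := (ENNReal.continuous_ofReal.tendsto (0:ℝ)).mono_left (nhdsWithin_le_nhds (s := Ioi 0))
      simpa using this
    have h2 := (ENNReal.continuous_rpow_const (y := 1/(2*p))).tendsto 0 |>.comp h1
    rw [ENNReal.zero_rpow_of_pos (by positivity)] at h2
    have h3 := ENNReal.Tendsto.const_mul (a := D) h2 (Or.inr hDt)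
    simpa using h3
  have hev := (hlim.eventually (gt_mem_nhds (show (0:ℝ≥0∞) < ENNReal.ofReal (ε/2) by simpa using hε))).and
    self_mem_nhdsWithin
  obtain ⟨δ, hδ1, hδ⟩ := hev.exists
  refine ⟨δ, hδ, fun n s hs hμs => ?_⟩
  set S := {x | C ≤ ‖t n x‖₊} with hSd
  have hS : MeasurableSet S := measurableSet_le measurable_const (ht n).nnnorm
  set hiP := S.indicator (t n)
  set loP := Sᶜ.indicator (t n)
  have hsum : t n = loP + hiP := (indicator_compl_add_self S (t n)).symm
  have hhi : Integrable hiP := (hi n).indicator hS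
  have hlo : Integrable loP := (hi n).indicator hS.compl
  have hlob : ∀ x, ‖loP x‖ ≤ C := by
    intro x
    by_cases hx : x ∈ S
    · simp [loP, hx]
    · have : ‖t n x‖₊ < C := not_le.1 hx
      have : ‖t n x‖ < C := by exact_mod_cast this
      simp only [loP, indicator_of_mem (show x ∈ Sᶜ from hx)]
      exact this.le
  have hlo0 : ∀ x ∉ Ω, loP x = 0 := fun x hx => by
    simp only [loP, indicator_apply, h0 n x hx, ite_self]
  have hTJ : TJ k (J n) (t n) = TJ k (J n) loP + TJ k (J n) hiP := by
    rw [hsum]; exact TJ_add k (J n) loP hiP hlo hhi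
  have m1 : AEStronglyMeasurable (TJ k (J n) loP) ((volume.restrict Ω).restrict s) :=
    (TJ_cont k (J n) loP hlo).aestronglyMeasurable
  have m2 : AEStronglyMeasurable (TJ k (J n) hiP) ((volume.restrict Ω).restrict s) :=
    (TJ_cont k (J n) hiP hhi).aestronglyMeasurable
  beta_reduce
  rw [eLpNorm_indicator_eq_eLpNorm_restrict hs, hTJ]
  refine (eLpNorm_add_le m1 m2 (by simpa using hp.le)).trans ?_
  have hres : (volume.restrict Ω).restrict s ≤ (volume : Measure (Rd d)) :=
    Measure.restrict_le_self.trans Measure.restrict_le_self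
  have b1 : eLpNorm (TJ k (J n) loP) (ENNReal.ofReal p) ((volume.restrict Ω).restrict s) ≤ ENNReal.ofReal (ε/2) := by
    refine (eLpNorm_le_eLpNorm_mul_rpow_measure_univ (q := ENNReal.ofReal (2*p))
      (ENNReal.ofReal_le_ofReal (by linarith)) m1).trans ?_
    refine le_trans ?_ hδ1.le
    have e : 1 / (ENNReal.ofReal p).toReal - 1 / (ENNReal.ofReal (2*p)).toReal = 1/(2*p) := by
      rw [ENNReal.toReal_ofReal hp0.le, ENNReal.toReal_ofReal (by positivity)]; field_simp; norm_num
    rw [e]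
    refine mul_le_mul' ?_ (ENNReal.rpow_le_rpow (by simpa using hμs) (by positivity))
    refine (eLpNorm_mono_measure _ hres).trans ((hC2 _ _ hlo).trans ?_)
    exact mul_le_mul' le_rfl (eLpNorm_bdd hΩm _ loP C hlob hlo0)
  have b2 : eLpNorm (TJ k (J n) hiP) (ENNReal.ofReal p) ((volume.restrict Ω).restrict s) ≤ ENNReal.ofReal (ε/2) := by
    refine (eLpNorm_mono_measure _ hres).trans ((hC1 _ _ hhi).trans ?_)
    refine (mul_le_mul' le_rfl (hC n)).trans ?_
    rw [← ENNReal.ofReal_coe_nnreal, ← ENNReal.ofReal_mul (by positivity)]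
    refine ENNReal.ofReal_le_ofReal ?_
    have : (0:ℝ) ≤ C1 := C1.2
    rw [mul_div_assoc', div_le_div_iff₀ (by positivity) (by positivity)]
    nlinarith
  refine (add_le_add b1 b2).trans (le_of_eq ?_)
  rw [← ENNReal.ofReal_add (by positivity) (by positivity)]; congr 1; ring

end HC

namespace HC
open scoped SchwartzMap

lemma trunc_sub_pt {d N : ℕ} (p s : ℝ) (hs : 0 < s) (hsp : s < p) (n : ℕ) (hn : 0 < n)
    (w : Rd d → Vec N) (x : Rd d) :
    ‖(w - trunc n w) x‖ₑ ^ s ≤ ENNReal.ofReal ((n:ℝ) ^ (s - p)) * ‖w x‖ₑ ^ p := by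
  by_cases hx : ‖w x‖ ≤ n
  · have : trunc n w x = w x := indicator_of_mem (by exact hx) _
    simp [this, hs]
  · have e : trunc n w x = 0 := indicator_of_notMem (by exact hx) _
    push Not at hx
    have hn' : (0:ℝ) < n := by exact_mod_cast hn
    have hw : 0 < ‖w x‖ := hn'.trans hx
    rw [Pi.sub_apply, e, sub_zero, ← ofReal_norm, ENNReal.ofReal_rpow_of_pos hw, ENNReal.ofReal_rpow_of_pos hw,
      ← ENNReal.ofReal_mul (by positivity)]
    refine ENNReal.ofReal_le_ofReal ?_
    have h1 : ‖w x‖ ^ s = ‖w x‖ ^ (s - p) * ‖w x‖ ^ p := by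
      rw [← Real.rpow_add hw]; congr 1; ring
    rw [h1]
    refine mul_le_mul_of_nonneg_right ?_ (by positivity)
    exact Real.rpow_le_rpow_of_nonpos hn' hx.le (by linarith)

lemma trunc_sub_norm {d N : ℕ} (p s : ℝ) (hs : 0 < s) (hsp : s < p) (w : ℕ → Rd d → Vec N)
    (B : ℝ≥0∞) (hBt : B ≠ ∞) (hB : ∀ n, ∫⁻ x, ‖w n x‖ₑ ^ p ≤ B) :
    Tendsto (fun n => eLpNorm (w n - trunc n (w n)) (ENNReal.ofReal s) volume) atTop (𝓝 0) := by
  have hlim : Tendsto (fun n : ℕ => (ENNReal.ofReal ((n:ℝ) ^ (s - p)) * B) ^ (1/s)) atTop (𝓝 0) := by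
    have h0 : Tendsto (fun n : ℕ => (n:ℝ) ^ (s - p)) atTop (𝓝 0) := by
      have := (tendsto_rpow_neg_atTop (y := p - s) (by linarith)).comp (tendsto_natCast_atTop_atTop (R := ℝ))
      simpa [Function.comp_def] using this
    have h1 := (ENNReal.continuous_ofReal.tendsto (0:ℝ)).comp h0
    rw [ENNReal.ofReal_zero] at h1
    have h2 := ENNReal.Tendsto.mul_const (b := B) h1 (Or.inr hBt)
    rw [zero_mul] at h2
    have h3 := ((ENNReal.continuous_rpow_const (y := 1/s)).tendsto 0).comp h2
    rw [ENNReal.zero_rpow_of_pos (by positivity)] at h3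
    exact h3
  refine tendsto_of_tendsto_of_tendsto_of_le_of_le' tendsto_const_nhds hlim
    (Eventually.of_forall fun _ => zero_le) ?_
  filter_upwards [eventually_gt_atTop 0] with n hn
  rw [eLpNorm_eq_lintegral_rpow_enorm_toReal (by simpa using hs) ENNReal.ofReal_ne_top,
    ENNReal.toReal_ofReal hs.le]
  refine ENNReal.rpow_le_rpow ?_ (by positivity)
  calc _ ≤ ∫⁻ x, ENNReal.ofReal ((n:ℝ) ^ (s - p)) * ‖w n x‖ₑ ^ p :=
        lintegral_mono fun x => trunc_sub_pt p s hs hsp n hn (w n) x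
    _ = ENNReal.ofReal ((n:ℝ) ^ (s - p)) * ∫⁻ x, ‖w n x‖ₑ ^ p :=
        lintegral_const_mul' _ _ ENNReal.ofReal_ne_top
    _ ≤ _ := mul_le_mul' le_rfl (hB n)

theorem decomp {d N M : ℕ} (hd : 0 < d) (A : Fin d → (Vec N →ₗ[ℝ] Vec M)) (hA : ConstantRank A)
    (p : ℝ) (hp : 1 < p) (Ω : Set (Rd d)) (hΩm : MeasurableSet Ω) (hΩ : volume Ω ≠ ∞)
    (R : ℝ) (hR : ∀ x ∈ Ω, ‖x‖ ≤ R) (w : ℕ → Rd d → Vec N) (hw : ∀ n, Measurable (w n))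
    (h0 : ∀ n, ∀ x ∉ Ω, w n x = 0) (hf : ∀ n, AFreeOn A univ (w n))
    (B : ℝ≥0∞) (hBt : B ≠ ∞) (hB : ∀ n, ∫⁻ x, ‖w n x‖ₑ ^ p ≤ B) :
    ∃ σ : ℕ → ℕ, StrictMono σ ∧ ∃ z : ℕ → Rd d → Vec N,
      (∀ n, MemLp (z n) (ENNReal.ofReal p) (volume.restrict Ω)) ∧
      (∀ n, AFreeOn A Ω (z n)) ∧
      Tendsto (fun n => eLpNorm (z n - trunc n (w (σ n))) (ENNReal.ofReal p) (volume.restrict Ω)) atTop (𝓝 0) ∧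
      UnifIntegrable (fun n => trunc n (w (σ n))) (ENNReal.ofReal p) (volume.restrict Ω) := by
  obtain ⟨k, l, φ, hP⟩ := projK_exists A hA
  have hp0 : 0 < p := by linarith
  obtain ⟨σ, hσ, htail⟩ := trunc_tail p hp volume w hw B hBt hB
  have fin : IsFiniteMeasure (volume.restrict Ω) := ⟨by simpa using hΩ.lt_top⟩
  have hP1 : (1:ℝ≥0∞) ≤ ENNReal.ofReal p := by simpa using hp.le
  have hwint : ∀ n, Integrable (w n) := by
    intro n
    have e : w n = Ω.indicator (w n) := (indicator_eq_self.2 fun x hx => by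
      by_contra h; exact hx (h0 n x h)).symm
    rw [e, integrable_indicator_iff hΩm]
    have : MemLp (w n) (ENNReal.ofReal p) (volume.restrict Ω) := by
      refine MemLp.restrict Ω ⟨(hw n).aestronglyMeasurable, ?_⟩
      rw [eLpNorm_lt_top_iff_lintegral_rpow_enorm_lt_top (by simpa using hp0) ENNReal.ofReal_ne_top,
        ENNReal.toReal_ofReal hp0.le]
      exact (hB n).trans_lt hBt.lt_top
    exact this.integrable hP1
  set t : ℕ → Rd d → Vec N := fun n => trunc n (w (σ n)) with ht
  have htm : ∀ n, Measurable (t n) := fun n => trunc_meas n (hw _)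
  have ht0 : ∀ n, ∀ x ∉ Ω, t n x = 0 := fun n x hx => by
    have := trunc_norm_le n (w (σ n)) x
    rw [h0 _ x hx, norm_zero] at this
    exact norm_le_zero_iff.1 this
  have htb : ∀ n x, ‖t n x‖ ≤ n := fun n x => by
    by_cases hx : ‖w (σ n) x‖ ≤ n
    · have : t n x = w (σ n) x := indicator_of_mem (by exact hx) _
      rwa [this]
    · have : t n x = 0 := indicator_of_notMem (by exact hx) _
      simp [this]
  have hti : ∀ n, Integrable (t n) := fun n => integrable_of_bdd hΩm hΩ _ (htm n) n (htb n) (ht0 n)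
  have htail2 : ∀ η : ℝ, 0 < η → ∃ C : ℝ≥0, ∀ n,
      eLpNorm ({x | C ≤ ‖t n x‖₊}.indicator (t n)) (ENNReal.ofReal p) volume ≤ ENNReal.ofReal η := by
    intro η hη
    obtain ⟨C, hC⟩ := htail (η ^ p) (by positivity)
    exact ⟨C, fun n => eLpNorm_tail p hp _ _ _ (measurableSet_le measurable_const (htm n).nnnorm) η hη (hC n)⟩
  have hUt : UnifIntegrable t (ENNReal.ofReal p) (volume.restrict Ω) := by
    refine unifIntegrable_of hP1 ENNReal.ofReal_ne_top (fun n => (htm n).aestronglyMeasurable) fun η hη => ?_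
    obtain ⟨C, hC⟩ := htail2 η hη
    exact ⟨C, fun n => (eLpNorm_mono_measure _ Measure.restrict_le_self).trans (hC n)⟩
  have hJ : ∀ n : ℕ, ∃ J : ℕ, ∫⁻ x in Ω, ‖TJ k J (w (σ n)) x - w (σ n) x‖ₑ ≤ ENNReal.ofReal (1/((n:ℝ)+1)) := by
    intro n
    have := TJ_tendsto hd hP (w (σ n)) (hwint _) R (fun x hx => h0 _ x fun hx2 => not_le.2 hx (hR x hx2)) (hf _) Ω hΩ
    obtain ⟨J, hJ⟩ := (this.eventually (gt_mem_nhds (show (0:ℝ≥0∞) < ENNReal.ofReal (1/((n:ℝ)+1)) by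
      rw [ENNReal.ofReal_pos]; positivity))).exists
    exact ⟨J, hJ.le⟩
  choose J hJ using hJ
  set z : ℕ → Rd d → Vec N := fun n => TJ k (J n) (t n) with hz
  have hzc : ∀ n, Continuous (z n) := fun n => TJ_cont k (J n) _ (hti n)
  have hUz : UnifIntegrable z (ENNReal.ofReal p) (volume.restrict Ω) :=
    TJ_unif hd hP p hp Ω hΩm hΩ t htm ht0 hti htail2 J
  have hzm : ∀ n, AEStronglyMeasurable (z n) (volume.restrict Ω) := fun n => (hzc n).aestronglyMeasurable
  have htm' : ∀ n, AEStronglyMeasurable (t n) (volume.restrict Ω) := fun n => (htm n).aestronglyMeasurable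
  refine ⟨σ, hσ, z, ?_, ?_, ?_, hUt⟩
  · intro n
    refine ⟨hzm n, ?_⟩
    obtain ⟨C1, hC1⟩ := TJ_Lp hd hP p hp
    refine (eLpNorm_mono_measure _ Measure.restrict_le_self).trans_lt ((hC1 _ _ (hti n)).trans_lt ?_)
    refine ENNReal.mul_lt_top ENNReal.coe_lt_top ?_
    refine (eLpNorm_bdd hΩm _ (t n) n (htb n) (ht0 n)).trans_lt ?_
    exact ENNReal.mul_lt_top (ENNReal.rpow_lt_top_of_nonneg (by positivity) hΩ) ENNReal.ofReal_lt_top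
  · intro n; exact TJ_free hP (J n) (t n) (hti n) Ω
  -- L1 convergence
  set s : ℝ := (1+p)/2 with hs
  have hs1 : 1 < s := by rw [hs]; linarith
  obtain ⟨C2, hC2⟩ := TJ_Lp hd hP s hs1
  have hd0 := trunc_sub_norm p s (by linarith) (by rw [hs]; linarith) (fun n => w (σ n)) B hBt (fun n => hB _)
  beta_reduce at hd0
  set e : ℕ → ℝ≥0∞ := fun n => eLpNorm (w (σ n) - t n) (ENNReal.ofReal s) volume with he
  set V : ℝ≥0∞ := volume Ω ^ (1 / (1:ℝ≥0∞).toReal - 1 / (ENNReal.ofReal s).toReal) with hV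
  have hVt : V ≠ ∞ := ENNReal.rpow_ne_top_of_nonneg (by
    rw [ENNReal.toReal_ofReal (by linarith)]; simp
    exact inv_le_one_of_one_le₀ hs1.le) hΩ
  have hL1 : ∀ n, eLpNorm (z n - t n) 1 (volume.restrict Ω) ≤
      ENNReal.ofReal (1/((n:ℝ)+1)) + (C2 * e n * V + e n * V) := by
    intro n
    have hdi : Integrable (t n - w (σ n)) := (hti n).sub (hwint _)
    have hsplit : z n - t n = (TJ k (J n) (w (σ n)) - w (σ n)) + (TJ k (J n) (t n - w (σ n)) + (w (σ n) - t n)) := by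
      have : z n = TJ k (J n) (w (σ n)) + TJ k (J n) (t n - w (σ n)) := by
        rw [← TJ_add k (J n) _ _ (hwint _) hdi]; simp [z]
      rw [this]; abel
    have m1 : AEStronglyMeasurable (TJ k (J n) (w (σ n)) - w (σ n)) (volume.restrict Ω) :=
      (TJ_cont k (J n) _ (hwint _)).aestronglyMeasurable.sub (hw _).aestronglyMeasurable
    have m2 : AEStronglyMeasurable (TJ k (J n) (t n - w (σ n))) (volume.restrict Ω) :=
      (TJ_cont k (J n) _ hdi).aestronglyMeasurable
    have m3 : AEStronglyMeasurable (w (σ n) - t n) (volume.restrict Ω) :=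
      (hw _).aestronglyMeasurable.sub (htm' n)
    have hol : ∀ f : Rd d → Vec N, AEStronglyMeasurable f (volume.restrict Ω) →
        eLpNorm f 1 (volume.restrict Ω) ≤ eLpNorm f (ENNReal.ofReal s) volume * V := by
      intro f hf
      have := eLpNorm_le_eLpNorm_mul_rpow_measure_univ (p := 1) (q := ENNReal.ofReal s) (by simpa using hs1.le) hf
      simp only [Measure.restrict_apply_univ] at this
      exact this.trans (mul_le_mul' (eLpNorm_mono_measure _ Measure.restrict_le_self) le_rfl)
    rw [hsplit]
    refine (eLpNorm_add_le m1 (m2.add m3) le_rfl).trans (add_le_add ?_ ?_)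
    · rw [eLpNorm_one_eq_lintegral_enorm]; exact hJ n
    refine (eLpNorm_add_le m2 m3 le_rfl).trans (add_le_add ?_ (hol _ m3))
    refine (hol _ m2).trans (mul_le_mul' ((hC2 _ _ hdi).trans (le_of_eq ?_)) le_rfl)
    rw [he, ← neg_sub, eLpNorm_neg]
  have hL1z : Tendsto (fun n => eLpNorm (z n - t n) 1 (volume.restrict Ω)) atTop (𝓝 0) := by
    refine tendsto_of_tendsto_of_tendsto_of_le_of_le tendsto_const_nhds ?_ (fun _ => zero_le) hL1
    have a1 : Tendsto (fun n : ℕ => ENNReal.ofReal (1/((n:ℝ)+1))) atTop (𝓝 0) := by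
      have := (ENNReal.continuous_ofReal.tendsto (0:ℝ)).comp tendsto_one_div_add_atTop_nhds_zero_nat
      simpa [Function.comp_def] using this
    have a2 : Tendsto (fun n => C2 * e n * V) atTop (𝓝 0) := by
      have := ENNReal.Tendsto.mul_const (b := V) (ENNReal.Tendsto.const_mul (a := C2) hd0 (Or.inr ENNReal.coe_ne_top)) (Or.inr hVt)
      simpa using this
    have a3 : Tendsto (fun n => e n * V) atTop (𝓝 0) := by
      have := ENNReal.Tendsto.mul_const (b := V) hd0 (Or.inr hVt)
      simpa using this
    simpa using a1.add (a2.add a3)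
  have hmeas : TendstoInMeasure (volume.restrict Ω) (z - t) atTop 0 :=
    tendstoInMeasure_of_tendsto_eLpNorm (p := 1) one_ne_zero (fun n => (hzm n).sub (htm' n))
      aestronglyMeasurable_zero (by simpa using hL1z)
  have := tendsto_Lp_finite_of_tendstoInMeasure hP1 ENNReal.ofReal_ne_top (fun n => (hzm n).sub (htm' n))
    (MemLp.zero) (hUz.sub hUt hP1 hzm htm') hmeas
  simpa using this

end HC

namespace HC

lemma mem_cell {d : ℕ} {ε : ℝ} (hε : 0 < ε) (z : Fin d → ℤ) (S : Set (Rd d)) (x : Rd d) :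
    x ∈ cell ε z S ↔ (fun i => x i / ε - (z i : ℝ)) ∈ S := by
  constructor
  · rintro ⟨y, hy, rfl⟩
    have : (fun i => (fun y : Rd d => fun i => ε * (y i + (z i : ℝ))) y i / ε - (z i : ℝ)) = y := by
      funext i; beta_reduce; field_simp; ring
    rw [this]; exact hy
  · intro h
    refine ⟨_, h, ?_⟩
    funext i; beta_reduce; field_simp; ring

lemma cell_eq {d : ℕ} {ε : ℝ} (hε : 0 < ε) (z : Fin d → ℤ) (S : Set (Rd d)) :
    cell ε z S = (fun (x : Rd d) i => x i / ε - (z i : ℝ)) ⁻¹' S := by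
  ext x; exact mem_cell hε z S x

lemma cell_open {d : ℕ} {ε : ℝ} (hε : 0 < ε) (z : Fin d → ℤ) {S : Set (Rd d)} (hS : IsOpen S) :
    IsOpen (cell ε z S) := by
  rw [cell_eq hε]; exact hS.preimage (by fun_prop)

lemma cell_closed {d : ℕ} {ε : ℝ} (hε : 0 < ε) (z : Fin d → ℤ) {S : Set (Rd d)} (hS : IsClosed S) :
    IsClosed (cell ε z S) := by
  rw [cell_eq hε]; exact hS.preimage (by fun_prop)

lemma cell_mono {d : ℕ} {ε : ℝ} (z : Fin d → ℤ) {S T : Set (Rd d)} (h : S ⊆ T) :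
    cell ε z S ⊆ cell ε z T := image_mono h

lemma Qcube_open {d : ℕ} : IsOpen (Qcube d) := by
  have : Qcube d = Set.univ.pi fun _ => Ioo (0:ℝ) 1 := by
    ext x; simp [Qcube]
  rw [this]; exact isOpen_set_pi finite_univ fun _ _ => isOpen_Ioo

lemma cell_disj {d : ℕ} {ε : ℝ} (hε : 0 < ε) {z z' : Fin d → ℤ} {x : Rd d}
    (h : x ∈ cell ε z (Qcube d)) (h' : x ∈ cell ε z' (Qcube d)) : z = z' := by
  rw [mem_cell hε] at h h'
  funext i
  obtain ⟨a1, a2⟩ := h i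
  obtain ⟨b1, b2⟩ := h' i
  have c1 : (z i : ℝ) < z' i + 1 := by linarith
  have c2 : (z' i : ℝ) < z i + 1 := by linarith
  have c1' : z i < z' i + 1 := by exact_mod_cast c1
  have c2' : z' i < z i + 1 := by exact_mod_cast c2
  omega

/-- the good soft part: cells whose closure is contained in `Ω`. -/
def goodPart {d : ℕ} (ε : ℝ) (Ω D0 : Set (Rd d)) : Set (Rd d) :=
  ⋃ z : {z : Fin d → ℤ // cell ε z (closure D0) ⊆ Ω}, cell ε z.1 D0

lemma goodPart_open {d : ℕ} {ε : ℝ} (hε : 0 < ε) (Ω : Set (Rd d)) {D0 : Set (Rd d)} (h : IsOpen D0) :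
    IsOpen (goodPart ε Ω D0) := isOpen_iUnion fun z => cell_open hε _ h

lemma softPart_open {d : ℕ} {ε : ℝ} (hε : 0 < ε) (Ω : Set (Rd d)) {D0 : Set (Rd d)} (h : IsOpen D0) :
    IsOpen (softPart ε Ω D0) := isOpen_biUnion fun z _ => cell_open hε _ h

lemma softPart_sub {d : ℕ} {ε : ℝ} (Ω D0 : Set (Rd d)) : softPart ε Ω D0 ⊆ Ω :=
  iUnion₂_subset fun _ hz => hz

lemma goodPart_sub {d : ℕ} {ε : ℝ} (Ω D0 : Set (Rd d)) : goodPart ε Ω D0 ⊆ softPart ε Ω D0 :=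
  iUnion_subset fun z => subset_biUnion_of_mem (u := fun z => cell ε z D0)
    (show z.1 ∈ {z : Fin d → ℤ | cell ε z D0 ⊆ Ω} from (cell_mono z.1 subset_closure).trans z.2)

lemma bad_sub {d : ℕ} {ε : ℝ} (hε : 0 < ε) (Ω D0 : Set (Rd d)) (hQ : closure D0 ⊆ Qcube d) :
    softPart ε Ω D0 \ goodPart ε Ω D0 ⊆ cthickening ε Ωᶜ := by
  rintro x ⟨hx, hx2⟩
  obtain ⟨z, hz, hxz⟩ := mem_iUnion₂.1 hx
  have hnot : ¬ cell ε z (closure D0) ⊆ Ω := fun h =>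
    hx2 (mem_iUnion.2 ⟨⟨z, h⟩, hxz⟩)
  obtain ⟨y, hy, hyΩ⟩ := not_subset.1 hnot
  refine mem_cthickening_of_dist_le x y ε _ hyΩ ?_
  rw [dist_pi_le_iff hε.le]
  intro i
  have a := hQ (subset_closure ((mem_cell hε z D0 x).1 hxz)) i
  have b := hQ ((mem_cell hε z _ y).1 hy) i
  have a' : x i / ε - z i ∈ Ioo (0:ℝ) 1 := a
  have b' : y i / ε - z i ∈ Ioo (0:ℝ) 1 := b
  have : |x i / ε - y i / ε| ≤ 1 := by
    rw [abs_le]; constructor <;> linarith [a'.1, a'.2, b'.1, b'.2]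
  rw [← sub_div, abs_div, abs_of_pos hε, div_le_one hε] at this
  exact this

lemma bad_tendsto {d : ℕ} (Ω D0 : Set (Rd d)) (hΩo : IsOpen Ω) (hΩ : volume Ω ≠ ∞)
    (hQ : closure D0 ⊆ Qcube d) (ε : ℕ → ℝ) (hε : ∀ n, 0 < ε n) (hε0 : Tendsto ε atTop (𝓝 0)) :
    Tendsto (fun n => volume (softPart (ε n) Ω D0 \ goodPart (ε n) Ω D0)) atTop (𝓝 0) := by
  have fin : IsFiniteMeasure (volume.restrict Ω) := ⟨by simpa using hΩ.lt_top⟩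
  have h := (tendsto_measure_cthickening_of_isClosed (μ := volume.restrict Ω) (s := Ωᶜ)
    ⟨1, one_pos, measure_ne_top _ _⟩ hΩo.isClosed_compl).comp hε0
  have e0 : (volume.restrict Ω) Ωᶜ = 0 := by
    rw [Measure.restrict_apply hΩo.measurableSet.compl]; simp
  rw [e0] at h
  refine tendsto_of_tendsto_of_tendsto_of_le_of_le tendsto_const_nhds h (fun _ => zero_le) fun n => ?_
  simp only [Function.comp]
  rw [Measure.restrict_apply isClosed_cthickening.measurableSet]
  exact measure_mono (subset_inter (bad_sub (hε n) Ω D0 hQ) (sdiff_subset.trans (softPart_sub Ω D0)))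

open scoped Manifold in
lemma exists_cutoff {d : ℕ} {K U : Set (Rd d)} (hK : IsClosed K) (hU : IsOpen U) (hKU : K ⊆ U) :
    ∃ f : Rd d → ℝ, ContDiff ℝ (⊤ : ℕ∞) f ∧ tsupport f ⊆ U ∧ ∀ x ∈ K, ∀ᶠ y in 𝓝 x, f y = 1 := by
  obtain ⟨f, h0, h1, -⟩ := exists_contMDiffMap_zero_one_nhds_of_isClosed (n := (⊤ : ℕ∞)) 𝓘(ℝ, Rd d)
    hU.isClosed_compl hK (disjoint_left.2 fun x hx hx2 => hx (hKU hx2))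
  refine ⟨f, f.contMDiff.contDiff, ?_, ?_⟩
  · intro x hx
    by_contra hxU
    have := mem_nhdsSet_iff_forall.1 h0 x hxU
    exact (notMem_tsupport_iff_eventuallyEq.2 this) hx
  · intro x hx
    exact mem_nhdsSet_iff_forall.1 h1 x hx

end HC

namespace HC

lemma dot_integrable {d N M : ℕ} (A : Fin d → (Vec N →ₗ[ℝ] Vec M)) (ψ : Rd d → Vec M)
    (hs : ContDiff ℝ (⊤ : ℕ∞) ψ) (hc : HasCompactSupport ψ) (μ : Measure (Rd d)) (v : Rd d → Vec N)
    (hv : Integrable v μ) : Integrable (fun x => dot (v x) (adjApply A ψ x)) μ := by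
  unfold dot
  refine integrable_finsetSum _ fun j _ => ?_
  obtain ⟨C, hC⟩ := (adjApply_cont A ψ hs).bounded_above_of_compact_support (adjApply_cs A ψ hc)
  refine (integrable_comp hv j).mul_bdd (c := C) ?_ (Eventually.of_forall fun x => (norm_le_pi_norm _ j).trans (hC x))
  exact ((continuous_apply j).comp (adjApply_cont A ψ hs)).aestronglyMeasurable

lemma dot_zero_left {N : ℕ} (u : Vec N) : dot 0 u = 0 := by simp [dot]

lemma adjApply_congr {d N M : ℕ} (A : Fin d → (Vec N →ₗ[ℝ] Vec M)) {ψ ψ' : Rd d → Vec M} {x : Rd d}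
    (h : ψ =ᶠ[𝓝 x] ψ') : adjApply A ψ x = adjApply A ψ' x := by
  unfold adjApply; rw [h.fderiv_eq]

lemma tsmul_sub {d M : ℕ} (χ : Rd d → ℝ) (ψ : Rd d → Vec M) :
    tsupport (fun x => χ x • ψ x) ⊆ tsupport χ := by
  refine closure_mono fun x hx hx' => hx ?_
  beta_reduce
  rw [hx', zero_smul]

lemma test_smul {d M : ℕ} {Ω : Set (Rd d)} {χ : Rd d → ℝ} {ψ : Rd d → Vec M}
    (hχ : ContDiff ℝ (⊤ : ℕ∞) χ) (hs : ContDiff ℝ (⊤ : ℕ∞) ψ) (hc : HasCompactSupport ψ)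
    (h : tsupport χ ⊆ Ω) : TestOn Ω (fun x => χ x • ψ x) := by
  refine ⟨?_, ?_, ?_⟩
  · refine contDiff_pi.2 fun i => ?_
    have h2 : ContDiff ℝ (⊤ : ℕ∞) (fun x => ψ x i) := contDiff_pi.1 hs i
    have h3 : ContDiff ℝ (⊤ : ℕ∞) (fun x => χ x * ψ x i) := hχ.mul h2
    exact h3
  · refine HasCompactSupport.intro hc (fun x hx => ?_)
    beta_reduce
    rw [image_eq_zero_of_notMem_tsupport hx, smul_zero]
  · exact (tsmul_sub χ ψ).trans h

lemma cell_free {d N M : ℕ} (A : Fin d → (Vec N →ₗ[ℝ] Vec M)) {Ω D0 : Set (Rd d)} (hΩo : IsOpen Ω)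
    (hD : IsOpen D0) (hQ : closure D0 ⊆ Qcube d) {ε : ℝ} (hε : 0 < ε) (v : Rd d → Vec N)
    (hf : AFreeOn A Ω v) (h0 : ∀ᵐ x ∂volume.restrict (stiffPart ε Ω D0), v x = 0)
    (z : Fin d → ℤ) (hz : cell ε z (closure D0) ⊆ Ω) (ψ : Rd d → Vec M)
    (hs : ContDiff ℝ (⊤ : ℕ∞) ψ) (hc : HasCompactSupport ψ) :
    ∫ x in cell ε z D0, dot (v x) (adjApply A ψ x) = 0 := by
  obtain ⟨χ, hχ, hχU, hχ1⟩ := exists_cutoff (cell_closed hε z isClosed_closure)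
    (hΩo.inter (cell_open hε z Qcube_open)) (subset_inter hz (cell_mono z hQ))
  have hst : tsupport (fun x => χ x • ψ x) ⊆ tsupport χ := tsmul_sub χ ψ
  have ht : TestOn Ω (fun x => χ x • ψ x) :=
    test_smul hχ hs hc (hχU.trans inter_subset_left)
  have key := hf _ ht
  have hstm : MeasurableSet (stiffPart ε Ω D0) :=
    hΩo.measurableSet.diff (softPart_open hε Ω hD).measurableSet
  have hcΩ : cell ε z D0 ⊆ Ω := (cell_mono z subset_closure).trans hz
  have hcm : MeasurableSet (cell ε z D0) := (cell_open hε z hD).measurableSet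
  rw [ae_restrict_iff' hstm] at h0
  have e1 : ∫ x in Ω, dot (v x) (adjApply A (fun x => χ x • ψ x) x)
      = ∫ x in Ω, (cell ε z D0).indicator (fun x => dot (v x) (adjApply A ψ x)) x := by
    refine setIntegral_congr_ae hΩo.measurableSet ?_
    filter_upwards [h0] with x hx hxΩ
    by_cases hxc : x ∈ cell ε z D0
    · rw [indicator_of_mem hxc]
      congr 1
      apply adjApply_congr
      filter_upwards [hχ1 x (cell_mono z subset_closure hxc)] with y hy
      rw [hy, one_smul]
    · rw [indicator_of_notMem hxc]
      by_cases hxQ : x ∈ cell ε z (Qcube d)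
      · have : v x = 0 := by
          refine hx ⟨hxΩ, fun hxs => ?_⟩
          obtain ⟨z', -, hxz'⟩ := mem_iUnion₂.1 hxs
          have := cell_disj hε hxQ (cell_mono z' (subset_closure.trans hQ) hxz')
          subst this
          exact hxc hxz'
        rw [this, dot_zero_left]
      · rw [adjApply_off A _ x fun h => hxQ (hχU (hst h)).2, dot_zero_right]
  rw [e1, setIntegral_indicator hcm, inter_eq_right.2 hcΩ] at key
  exact key

theorem good_free {d N M : ℕ} (A : Fin d → (Vec N →ₗ[ℝ] Vec M)) {Ω D0 : Set (Rd d)} (hΩo : IsOpen Ω)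
    (hD : IsOpen D0) (hQ : closure D0 ⊆ Qcube d) {ε : ℝ} (hε : 0 < ε) (v : Rd d → Vec N)
    (hv : Integrable v (volume.restrict Ω))
    (hf : AFreeOn A Ω v) (h0 : ∀ᵐ x ∂volume.restrict (stiffPart ε Ω D0), v x = 0) :
    AFreeOn A univ ((goodPart ε Ω D0).indicator v) := by
  rintro ψ ⟨hs, hc, -⟩
  have e : ∀ x, dot ((goodPart ε Ω D0).indicator v x) (adjApply A ψ x)
      = (goodPart ε Ω D0).indicator (fun x => dot (v x) (adjApply A ψ x)) x := by
    intro x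
    by_cases hx : x ∈ goodPart ε Ω D0
    · simp [hx]
    · simp [hx, dot_zero_left]
  simp only [e, Measure.restrict_univ]
  have hgm := (goodPart_open hε Ω hD).measurableSet
  rw [integral_indicator hgm]
  have hIntg := (dot_integrable A ψ hs hc _ v hv)
  have hint2 : IntegrableOn (fun x => dot (v x) (adjApply A ψ x)) (goodPart ε Ω D0) :=
    IntegrableOn.mono_set hIntg ((goodPart_sub Ω D0).trans (softPart_sub Ω D0))
  unfold goodPart at hint2 ⊢
  rw [integral_iUnion (fun z => (cell_open hε _ hD).measurableSet) ?_ hint2]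
  · simp only [fun z : {z : Fin d → ℤ // cell ε z (closure D0) ⊆ Ω} =>
      cell_free A hΩo hD hQ hε v hf h0 z.1 z.2 ψ hs hc, tsum_zero]
  · intro z z' hzz'
    refine disjoint_left.2 fun x hx hx' => hzz' (Subtype.ext ?_)
    exact cell_disj hε (cell_mono _ (subset_closure.trans hQ) hx) (cell_mono _ (subset_closure.trans hQ) hx')

lemma AFreeOn.congr {d N M : ℕ} {A : Fin d → (Vec N →ₗ[ℝ] Vec M)} {O : Set (Rd d)} {u v : Rd d → Vec N}
    (hf : AFreeOn A O u) (h : ∀ᵐ x ∂volume.restrict O, u x = v x) : AFreeOn A O v := by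
  intro ψ hψ
  rw [← hf ψ hψ]
  refine integral_congr_ae ?_
  filter_upwards [h] with x hx
  rw [hx]

lemma dot_smul_left {N : ℕ} (c : ℝ) (u v : Vec N) : dot (c • u) v = c * dot u v := by
  simp [dot, Finset.mul_sum, mul_assoc]

lemma dot_sub_left {N : ℕ} (u u' v : Vec N) : dot (u - u') v = dot u v - dot u' v := by
  simp [dot, ← Finset.sum_sub_distrib, sub_mul]

lemma AFreeOn.smul {d N M : ℕ} {A : Fin d → (Vec N →ₗ[ℝ] Vec M)} {O : Set (Rd d)} {u : Rd d → Vec N}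
    (hf : AFreeOn A O u) (c : ℝ) : AFreeOn A O (c • u) := by
  intro ψ hψ
  simp only [Pi.smul_apply, dot_smul_left]
  rw [integral_const_mul, hf ψ hψ, mul_zero]

lemma AFreeOn.sub {d N M : ℕ} {A : Fin d → (Vec N →ₗ[ℝ] Vec M)} {O : Set (Rd d)} {u v : Rd d → Vec N}
    (hf : AFreeOn A O u) (hg : AFreeOn A O v) (hu : Integrable u (volume.restrict O))
    (hv : Integrable v (volume.restrict O)) : AFreeOn A O (u - v) := by
  intro ψ hψ
  simp only [Pi.sub_apply, dot_sub_left]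
  rw [integral_sub (dot_integrable A ψ hψ.1 hψ.2.1 _ u hu) (dot_integrable A ψ hψ.1 hψ.2.1 _ v hv),
    hf ψ hψ, hg ψ hψ, sub_zero]

end HC

namespace HC

lemma eN_nonneg {N : ℕ} (ξ : Vec N) : 0 ≤ eN ξ := Real.sqrt_nonneg _

lemma eN_cont {N : ℕ} : Continuous (eN : Vec N → ℝ) := by
  unfold eN; fun_prop

lemma norm_le_eN {N : ℕ} (ξ : Vec N) : ‖ξ‖ ≤ eN ξ := by
  refine (pi_norm_le_iff_of_nonneg (eN_nonneg ξ)).2 fun j => ?_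
  rw [Real.norm_eq_abs, ← Real.sqrt_sq_eq_abs]
  exact Real.sqrt_le_sqrt (Finset.single_le_sum (f := fun j => ξ j ^ 2) (fun i _ => sq_nonneg _) (Finset.mem_univ j))

lemma eN_le {N : ℕ} (ξ : Vec N) : eN ξ ≤ (N + 1) * ‖ξ‖ := by
  have h : eN ξ ≤ √(((N + 1) * ‖ξ‖) ^ 2) := by
    refine Real.sqrt_le_sqrt ?_
    calc ∑ j, ξ j ^ 2 ≤ ∑ j : Fin N, ‖ξ‖ ^ 2 := by
          refine Finset.sum_le_sum fun j _ => ?_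
          have := norm_le_pi_norm ξ j
          rw [Real.norm_eq_abs] at this
          rw [← sq_abs]
          gcongr
      _ = N * ‖ξ‖ ^ 2 := by simp
      _ ≤ ((N + 1) * ‖ξ‖) ^ 2 := by
          rw [mul_pow]
          have : (N : ℝ) ≤ (N + 1) ^ 2 := by nlinarith [Nat.cast_nonneg (α := ℝ) N]
          gcongr
  rwa [Real.sqrt_sq (by positivity)] at h

lemma eN_zero {N : ℕ} : eN (0 : Vec N) = 0 := by simp [eN]

lemma eLpNorm_le_eN {d N : ℕ} (P : ℝ≥0∞) (μ : Measure (Rd d)) (u : Rd d → Vec N) :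
    eLpNorm u P μ ≤ eLpNorm (fun x => eN (u x)) P μ :=
  eLpNorm_mono fun x => by
    rw [Real.norm_of_nonneg (eN_nonneg _)]; exact norm_le_eN _

lemma eLpNorm_eN_le {d N : ℕ} (P : ℝ≥0∞) (μ : Measure (Rd d)) (u : Rd d → Vec N) :
    eLpNorm (fun x => eN (u x)) P μ ≤ ENNReal.ofReal (N + 1) * eLpNorm u P μ :=
  eLpNorm_le_mul_eLpNorm_of_ae_le_mul (Eventually.of_forall fun x => by
    rw [Real.norm_of_nonneg (eN_nonneg _)]; exact eN_le _) P

lemma memLp_eN {d N : ℕ} {P : ℝ≥0∞} {μ : Measure (Rd d)} {u : Rd d → Vec N} (hu : MemLp u P μ) :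
    MemLp (fun x => eN (u x)) P μ :=
  ⟨eN_cont.comp_aestronglyMeasurable hu.1, (eLpNorm_eN_le P μ u).trans_lt
    (ENNReal.mul_lt_top ENNReal.ofReal_lt_top hu.2)⟩

lemma ext_bound {d N : ℕ} {p c : ℝ} (hc : 0 < c) {Ω S : Set (Rd d)} (hS : S ⊆ Ω) {u e : Rd d → Vec N}
    (hu : MemLpOn p Ω u) (he : MemLpOn p Ω e) (h : LpNormOn p Ω e ≤ c * LpNormOn p S u) :
    eLpNorm e (ENNReal.ofReal p) (volume.restrict Ω) ≤
      ENNReal.ofReal (c * (N + 1)) * eLpNorm u (ENNReal.ofReal p) (volume.restrict S) := by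
  have hu' : MemLp u (ENNReal.ofReal p) (volume.restrict S) := hu.mono_measure (Measure.restrict_mono_set _ hS)
  refine (eLpNorm_le_eN _ _ _).trans ?_
  rw [ENNReal.ofReal_mul hc.le, mul_assoc]
  refine le_trans ?_ (mul_le_mul' le_rfl (eLpNorm_eN_le _ _ _))
  unfold LpNormOn at h
  rw [← ENNReal.ofReal_toReal (memLp_eN he).2.ne, ← ENNReal.ofReal_toReal (memLp_eN hu').2.ne,
    ← ENNReal.ofReal_mul hc.le]
  exact ENNReal.ofReal_le_ofReal h

lemma conjExp_holder {p : ℝ} (hp : 1 < p) : p.HolderConjugate (conjExp p) := by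
  exact Real.HolderConjugate.conjExponent hp

lemma dot_holder {d N : ℕ} {p : ℝ} (hp : 1 < p) {μ : Measure (Rd d)} {u g : Rd d → Vec N}
    (hu : MemLp u (ENNReal.ofReal p) μ) (hg : MemLp g (ENNReal.ofReal (conjExp p)) μ) :
    Integrable (fun x => dot (u x) (g x)) μ ∧ ‖∫ x, dot (u x) (g x) ∂μ‖ₑ ≤
      N * (eLpNorm u (ENNReal.ofReal p) μ * eLpNorm g (ENNReal.ofReal (conjExp p)) μ) := by
  have hpq := conjExp_holder hp
  have hq0 : 0 < conjExp p := hpq.symm.pos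
  have hp0 : 0 < p := hpq.pos
  have pt : ∀ x, ‖dot (u x) (g x)‖ₑ ≤ N * (‖u x‖ₑ * ‖g x‖ₑ) := by
    intro x
    unfold dot
    refine (enorm_sum_le _ _).trans ?_
    calc _ ≤ ∑ j : Fin N, ‖u x‖ₑ * ‖g x‖ₑ := by
          refine Finset.sum_le_sum fun j _ => ?_
          rw [enorm_mul]
          refine mul_le_mul' ?_ ?_
          · rw [← ofReal_norm, ← ofReal_norm]; exact ENNReal.ofReal_le_ofReal (norm_le_pi_norm _ j)
          · rw [← ofReal_norm, ← ofReal_norm]; exact ENNReal.ofReal_le_ofReal (norm_le_pi_norm _ j)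
      _ = _ := by simp
  have hm : AEStronglyMeasurable (fun x => dot (u x) (g x)) μ := by
    unfold dot
    refine Finset.aestronglyMeasurable_fun_sum _ fun j _ => ?_
    exact ((continuous_apply j).comp_aestronglyMeasurable hu.1).mul
      ((continuous_apply j).comp_aestronglyMeasurable hg.1)
  have I : ∫⁻ x, ‖dot (u x) (g x)‖ₑ ∂μ ≤ N * (eLpNorm u (ENNReal.ofReal p) μ * eLpNorm g (ENNReal.ofReal (conjExp p)) μ) := by
    refine (lintegral_mono pt).trans ?_
    rw [lintegral_const_mul' _ _ (by simp)]
    refine mul_le_mul' le_rfl ?_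
    refine (ENNReal.lintegral_mul_le_Lp_mul_Lq μ hpq hu.1.enorm hg.1.enorm).trans ?_
    rw [eLpNorm_eq_lintegral_rpow_enorm_toReal (by simpa using hp0) ENNReal.ofReal_ne_top,
      eLpNorm_eq_lintegral_rpow_enorm_toReal (by simpa using hq0) ENNReal.ofReal_ne_top,
      ENNReal.toReal_ofReal hp0.le, ENNReal.toReal_ofReal hq0.le]
  refine ⟨⟨hm, ?_⟩, (enorm_integral_le_lintegral_enorm _).trans I⟩
  exact I.trans_lt (ENNReal.mul_lt_top (by simp) (ENNReal.mul_lt_top hu.2 hg.2))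

lemma growth_int {d N : ℕ} {p a lam Lam : ℝ} (hp : 1 < p) {μ : Measure (Rd d)} [IsFiniteMeasure μ]
    {F : Rd d → ℝ} {u : Rd d → Vec N} (hF : AEStronglyMeasurable F μ)
    (hl : 0 < lam) (ha : 0 < a) (hL : 0 < Lam)
    (hu : MemLp u (ENNReal.ofReal p) μ)
    (h : ∀ x, lam * (-a + eN (u x) ^ p) ≤ F x ∧ F x ≤ Lam * (1 + eN (u x) ^ p)) :
    Integrable F μ ∧ Integrable (fun x => eN (u x) ^ p) μ := by
  have hp0 : 0 < p := by linarith
  have h1 : Integrable (fun x => eN (u x) ^ p) μ := by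
    have := (memLp_eN hu).integrable_norm_rpow (by simpa using hp0) ENNReal.ofReal_ne_top
    simpa [ENNReal.toReal_ofReal hp0.le, Real.norm_of_nonneg (eN_nonneg _)] using this
  refine ⟨?_, h1⟩
  have h2 : Integrable (fun x => (lam * a + Lam) + Lam * eN (u x) ^ p) μ :=
    (integrable_const _).add (h1.const_mul _)
  refine h2.mono' hF (Eventually.of_forall fun x => ?_)
  have h3 := h x
  have h4 : 0 ≤ eN (u x) ^ p := Real.rpow_nonneg (eN_nonneg _) _
  have h5 := mul_nonneg hl.le h4
  have h6 := mul_nonneg hL.le h4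
  have h7 := mul_pos hl ha
  rw [Real.norm_eq_abs, abs_le]
  constructor <;> nlinarith

lemma h4_pt {N : ℕ} {p mu : ℝ} (hp : 1 < p) (hmu : 0 < mu) (ξ ζ : Vec N) :
    mu * (1 + eN ξ ^ (p - 1) + eN ζ ^ (p - 1)) * eN (ξ - ζ) ≤
      (3 * mu * (N + 1) ^ p) * ((1 + ‖ξ‖ + ‖ζ‖) ^ (p - 1) * ‖ξ - ζ‖) := by
  have hp1 : 0 ≤ p - 1 := by linarith
  set T := ((N + 1 : ℝ) * (1 + ‖ξ‖ + ‖ζ‖)) ^ (p - 1) with hT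
  have n1 : (1 : ℝ) ≤ N + 1 := by linarith [Nat.cast_nonneg (α := ℝ) N]
  have b1 : eN ξ ^ (p - 1) ≤ T := by
    refine Real.rpow_le_rpow (eN_nonneg _) ((eN_le ξ).trans ?_) hp1
    gcongr
    linarith [norm_nonneg ζ]
  have b2 : eN ζ ^ (p - 1) ≤ T := by
    refine Real.rpow_le_rpow (eN_nonneg _) ((eN_le ζ).trans ?_) hp1
    gcongr
    linarith [norm_nonneg ξ]
  have b3 : 1 ≤ T := by
    refine Real.one_le_rpow ?_ hp1
    nlinarith [norm_nonneg ξ, norm_nonneg ζ]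
  have e : T = (N + 1 : ℝ) ^ (p - 1) * (1 + ‖ξ‖ + ‖ζ‖) ^ (p - 1) := by
    rw [hT, Real.mul_rpow (by positivity) (by positivity)]
  have e2 : (N + 1 : ℝ) ^ p = (N + 1 : ℝ) ^ (p - 1) * (N + 1) := by
    conv_rhs => rw [← Real.rpow_add_one (by positivity)]
    simp
  calc _ ≤ mu * (3 * T) * ((N + 1) * ‖ξ - ζ‖) := by
        have : 1 + eN ξ ^ (p - 1) + eN ζ ^ (p - 1) ≤ 3 * T := by linarith
        have h0 : 0 ≤ T := by linarith
        have := eN_le (ξ - ζ)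
        refine mul_le_mul (by gcongr) this (eN_nonneg _) (by positivity)
    _ = _ := by rw [e, e2]; ring

lemma energy_bound {d N : ℕ} {p mu : ℝ} (hp : 1 < p) (hmu : 0 < mu) {μ : Measure (Rd d)}
    {ξ ζ : Rd d → Vec N} (hξ : MemLp ξ (ENNReal.ofReal p) μ) (hζ : MemLp ζ (ENNReal.ofReal p) μ)
    {F : Vec N → ℝ} (hF : ∀ ξ ζ, |F ξ - F ζ| ≤ mu * (1 + eN ξ ^ (p - 1) + eN ζ ^ (p - 1)) * eN (ξ - ζ))
    (h1 : Integrable (fun x => F (ξ x)) μ) (h2 : Integrable (fun x => F (ζ x)) μ) :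
    ‖∫ x, F (ξ x) ∂μ - ∫ x, F (ζ x) ∂μ‖ₑ ≤ ENNReal.ofReal (3 * mu * (N + 1) ^ p) *
      ((eLpNorm (fun _ : Rd d => (1 : ℝ)) (ENNReal.ofReal p) μ + eLpNorm ξ (ENNReal.ofReal p) μ
        + eLpNorm ζ (ENNReal.ofReal p) μ) ^ (p - 1) * eLpNorm (ξ - ζ) (ENNReal.ofReal p) μ) := by
  have hpq := conjExp_holder hp
  have hq0 : 0 < conjExp p := hpq.symm.pos
  have hp0 : 0 < p := hpq.pos
  have hp1 : 0 ≤ p - 1 := by linarith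
  set h : Rd d → ℝ := fun x => 1 + ‖ξ x‖ + ‖ζ x‖ with hh
  have hhm : AEStronglyMeasurable h μ := (aestronglyMeasurable_const.add hξ.1.norm).add hζ.1.norm
  have hP : (1 : ℝ≥0∞) ≤ ENNReal.ofReal p := by simpa using hp.le
  have hn : eLpNorm h (ENNReal.ofReal p) μ ≤ eLpNorm (fun _ : Rd d => (1 : ℝ)) (ENNReal.ofReal p) μ
      + eLpNorm ξ (ENNReal.ofReal p) μ + eLpNorm ζ (ENNReal.ofReal p) μ := by
    rw [← eLpNorm_norm ξ, ← eLpNorm_norm ζ]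
    refine (eLpNorm_add_le (aestronglyMeasurable_const.add hξ.1.norm) hζ.1.norm hP).trans ?_
    exact add_le_add (eLpNorm_add_le aestronglyMeasurable_const hξ.1.norm hP) le_rfl
  rw [← integral_sub h1 h2]
  refine (enorm_integral_le_lintegral_enorm _).trans ?_
  have pt : ∀ x, ‖F (ξ x) - F (ζ x)‖ₑ ≤ ENNReal.ofReal (3 * mu * (N + 1) ^ p) *
      (‖h x‖ₑ ^ (p - 1) * ‖(ξ - ζ) x‖ₑ) := by
    intro x
    have hx0 : 0 ≤ h x := by positivity
    rw [← ofReal_norm, ← ofReal_norm, ← ofReal_norm, ENNReal.ofReal_rpow_of_nonneg (norm_nonneg _) hp1,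
      ← ENNReal.ofReal_mul (by positivity), ← ENNReal.ofReal_mul (by positivity), Real.norm_eq_abs]
    refine ENNReal.ofReal_le_ofReal ((hF _ _).trans ((h4_pt hp hmu _ _).trans (le_of_eq ?_)))
    rw [Real.norm_of_nonneg hx0]; rfl
  refine (lintegral_mono pt).trans ?_
  have m1 : AEMeasurable (fun x => ‖h x‖ₑ ^ (p - 1)) μ := hhm.enorm.pow_const _
  have m2 := (hξ.1.sub hζ.1).enorm
  rw [lintegral_const_mul' _ _ ENNReal.ofReal_ne_top]
  refine mul_le_mul' le_rfl ?_
  refine (ENNReal.lintegral_mul_le_Lp_mul_Lq μ hpq.symm m1 m2).trans ?_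
  refine mul_le_mul' ?_ ?_
  · refine le_trans ?_ (ENNReal.rpow_le_rpow hn hp1)
    rw [eLpNorm_eq_lintegral_rpow_enorm_toReal (by simpa using hp0) ENNReal.ofReal_ne_top,
      ENNReal.toReal_ofReal hp0.le, ← ENNReal.rpow_mul]
    have e1 : (p - 1) * conjExp p = p := by
      unfold conjExp; field_simp [show p - 1 ≠ 0 by linarith]
    have e2 : 1 / conjExp p = 1 / p * (p - 1) := by
      unfold conjExp; field_simp [show p - 1 ≠ 0 by linarith]
    simp only [← ENNReal.rpow_mul, e1, e2]
    exact le_rfl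
  · rw [eLpNorm_eq_lintegral_rpow_enorm_toReal (by simpa using hp0) ENNReal.ofReal_ne_top,
      ENNReal.toReal_ofReal hp0.le]

end HC

namespace HC

lemma weak_of_Lp {d N : ℕ} {p : ℝ} (hp : 1 < p) {μ : Measure (Rd d)} {x : ℕ → Rd d → Vec N}
    (hx : ∀ n, MemLp (x n) (ENNReal.ofReal p) μ)
    (h0 : Tendsto (fun n => eLpNorm (x n) (ENNReal.ofReal p) μ) atTop (𝓝 0))
    {φ : Rd d → Vec N} (hφ : MemLp φ (ENNReal.ofReal (conjExp p)) μ) :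
    Tendsto (fun n => ∫ y, dot (x n y) (φ y) ∂μ) atTop (𝓝 0) := by
  rw [tendsto_zero_iff_enorm_tendsto_zero]
  have h1 : Tendsto (fun n => (N : ℝ≥0∞) * (eLpNorm (x n) (ENNReal.ofReal p) μ *
      eLpNorm φ (ENNReal.ofReal (conjExp p)) μ)) atTop (𝓝 (N * (0 * eLpNorm φ (ENNReal.ofReal (conjExp p)) μ))) :=
    ENNReal.Tendsto.const_mul (ENNReal.Tendsto.mul_const h0 (Or.inr hφ.2.ne)) (Or.inr (by simp))
  rw [zero_mul, mul_zero] at h1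
  exact tendsto_of_tendsto_of_tendsto_of_le_of_le tendsto_const_nhds h1 (fun _ => zero_le)
    fun n => (dot_holder hp (hx n) hφ).2

lemma weak_ind {d N : ℕ} {p : ℝ} (hp : 1 < p) {μ : Measure (Rd d)} {v : ℕ → Rd d → Vec N}
    (hv : ∀ n, MemLp (v n) (ENNReal.ofReal p) μ) {B : ℝ≥0∞} (hBt : B ≠ ∞)
    (hB : ∀ n, eLpNorm (v n) (ENNReal.ofReal p) μ ≤ B) {H : ℕ → Set (Rd d)} (hH : ∀ n, MeasurableSet (H n))
    (hH0 : Tendsto (fun n => μ (H n)) atTop (𝓝 0))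
    {φ : Rd d → Vec N} (hφ : MemLp φ (ENNReal.ofReal (conjExp p)) μ) :
    Tendsto (fun n => ∫ y, dot (v n y) ((H n).indicator φ y) ∂μ) atTop (𝓝 0) := by
  have hpq := conjExp_holder hp
  have hq1 : (1 : ℝ≥0∞) ≤ ENNReal.ofReal (conjExp p) := by simpa using hpq.symm.lt.le
  have hI : Tendsto (fun n => eLpNorm ((H n).indicator φ) (ENNReal.ofReal (conjExp p)) μ) atTop (𝓝 0) := by
    refine ENNReal.tendsto_nhds_zero.2 fun η hη => ?_
    by_cases hηt : η = ∞
    · simp [hηt]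
    obtain ⟨δ, hδ, hs⟩ := hφ.eLpNorm_indicator_le hq1 ENNReal.ofReal_ne_top
      (ENNReal.toReal_pos hη.ne' hηt)
    filter_upwards [ENNReal.tendsto_nhds_zero.1 hH0 (ENNReal.ofReal δ) (by simpa using hδ)] with n hn
    have := hs (H n) (hH n) hn
    rwa [ENNReal.ofReal_toReal hηt] at this
  rw [tendsto_zero_iff_enorm_tendsto_zero]
  have h1 : Tendsto (fun n => (N : ℝ≥0∞) * (B *
      eLpNorm ((H n).indicator φ) (ENNReal.ofReal (conjExp p)) μ)) atTop (𝓝 (N * (B * 0))) :=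
    ENNReal.Tendsto.const_mul (ENNReal.Tendsto.const_mul hI (Or.inr hBt)) (Or.inr (by simp))
  rw [mul_zero, mul_zero] at h1
  refine tendsto_of_tendsto_of_tendsto_of_le_of_le tendsto_const_nhds h1 (fun _ => zero_le)
    fun n => (dot_holder hp (hv n) (hφ.indicator (hH n))).2.trans ?_
  exact mul_le_mul' le_rfl (mul_le_mul' (hB n) le_rfl)

lemma energy_tendsto {d N : ℕ} {p mu : ℝ} (hp : 1 < p) (hmu : 0 < mu) {μ : Measure (Rd d)} [IsFiniteMeasure μ]
    {ξ ζ : ℕ → Rd d → Vec N} (hξ : ∀ n, MemLp (ξ n) (ENNReal.ofReal p) μ)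
    (hζ : ∀ n, MemLp (ζ n) (ENNReal.ofReal p) μ)
    {B : ℝ≥0∞} (hBt : B ≠ ∞) (hBξ : ∀ᶠ n in atTop, eLpNorm (ξ n) (ENNReal.ofReal p) μ ≤ B)
    (hBζ : ∀ᶠ n in atTop, eLpNorm (ζ n) (ENNReal.ofReal p) μ ≤ B)
    (h0 : Tendsto (fun n => eLpNorm (ξ n - ζ n) (ENNReal.ofReal p) μ) atTop (𝓝 0))
    {F : ℕ → Vec N → ℝ} (hF : ∀ n, ∀ ξ ζ, |F n ξ - F n ζ| ≤ mu * (1 + eN ξ ^ (p - 1) + eN ζ ^ (p - 1)) * eN (ξ - ζ))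
    (h1 : ∀ n, Integrable (fun x => F n (ξ n x)) μ) (h2 : ∀ n, Integrable (fun x => F n (ζ n x)) μ)
    (S : ℕ → Set (Rd d)) :
    Tendsto (fun n => ∫ x in S n, F n (ξ n x) ∂μ - ∫ x in S n, F n (ζ n x) ∂μ) atTop (𝓝 0) := by
  rw [tendsto_zero_iff_enorm_tendsto_zero]
  set C1 := eLpNorm (fun _ : Rd d => (1 : ℝ)) (ENNReal.ofReal p) μ
  have hC1 : C1 ≠ ∞ := (memLp_const (1 : ℝ)).2.ne
  set C := (C1 + B + B) ^ (p - 1)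
  have hC : C ≠ ∞ := ENNReal.rpow_ne_top_of_nonneg (by linarith) (by simp [hC1, hBt])
  have h3 : Tendsto (fun n => ENNReal.ofReal (3 * mu * (N + 1) ^ p) * (C * eLpNorm (ξ n - ζ n) (ENNReal.ofReal p) μ))
      atTop (𝓝 (ENNReal.ofReal (3 * mu * (N + 1) ^ p) * (C * 0))) :=
    ENNReal.Tendsto.const_mul (ENNReal.Tendsto.const_mul h0 (Or.inr hC)) (Or.inr ENNReal.ofReal_ne_top)
  rw [mul_zero, mul_zero] at h3
  refine tendsto_of_tendsto_of_tendsto_of_le_of_le' tendsto_const_nhds h3 (Eventually.of_forall fun _ => zero_le) ?_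
  filter_upwards [hBξ, hBζ] with n hn1 hn2
  have hle : μ.restrict (S n) ≤ μ := Measure.restrict_le_self
  refine (energy_bound hp hmu ((hξ n).mono_measure hle) ((hζ n).mono_measure hle) (hF n)
    ((h1 n).mono_measure hle) ((h2 n).mono_measure hle)).trans ?_
  refine mul_le_mul' le_rfl (mul_le_mul' (ENNReal.rpow_le_rpow ?_ (by linarith)) (eLpNorm_mono_measure _ hle))
  exact add_le_add (add_le_add (eLpNorm_mono_measure _ hle) ((eLpNorm_mono_measure _ hle).trans hn1))
    ((eLpNorm_mono_measure _ hle).trans hn2)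

lemma dot_add_left {N : ℕ} (u u' v : Vec N) : dot (u + u') v = dot u v + dot u' v := by
  simp [dot, ← Finset.sum_add_distrib, add_mul]

/-- passing from `V` to `g` when `g` is `L^p`-close to a version of `V` modified on small sets -/
theorem abs_core {d N : ℕ} {p a lam Lam mu : ℝ} (hp : 1 < p) (hmu : 0 < mu)
    (ha : 0 < a) (hl : 0 < lam) (hL : 0 < Lam) {μ : Measure (Rd d)} [IsFiniteMeasure μ]
    {V v t g : ℕ → Rd d → Vec N} {H : ℕ → Set (Rd d)} (hH : ∀ n, MeasurableSet (H n))
    (hH0 : Tendsto (fun n => μ (H n)) atTop (𝓝 0))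
    (hV : ∀ n, MemLp (V n) (ENNReal.ofReal p) μ) (hv : ∀ n, MemLp (v n) (ENNReal.ofReal p) μ)
    (hg : ∀ n, MemLp (g n) (ENNReal.ofReal p) μ) (ht : ∀ n, ∀ᵐ x ∂μ, t n x = (H n)ᶜ.indicator (v n) x)
    {B : ℝ≥0∞} (hBt : B ≠ ∞) (hBV : ∀ n, eLpNorm (V n) (ENNReal.ofReal p) μ ≤ B)
    (hBv : ∀ n, eLpNorm (v n) (ENNReal.ofReal p) μ ≤ B)
    (h1 : Tendsto (fun n => eLpNorm (V n - v n) (ENNReal.ofReal p) μ) atTop (𝓝 0))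
    (h2 : Tendsto (fun n => eLpNorm (g n - t n) (ENNReal.ofReal p) μ) atTop (𝓝 0)) :
    (∀ φ, MemLp φ (ENNReal.ofReal (conjExp p)) μ → Tendsto (fun n => ∫ y, dot (V n y) (φ y) ∂μ) atTop (𝓝 0) →
      Tendsto (fun n => ∫ y, dot (g n y) (φ y) ∂μ) atTop (𝓝 0)) ∧
    (∀ F : ℕ → Vec N → ℝ, (∀ n, Continuous (F n)) →
      (∀ n ξ, lam * (-a + eN ξ ^ p) ≤ F n ξ ∧ F n ξ ≤ Lam * (1 + eN ξ ^ p)) →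
      (∀ n, ∀ ξ ζ, |F n ξ - F n ζ| ≤ mu * (1 + eN ξ ^ (p - 1) + eN ζ ^ (p - 1)) * eN (ξ - ζ)) →
      ∀ S : ℕ → Set (Rd d), ∃ r : ℕ → ℝ, Tendsto r atTop (𝓝 0) ∧
        ∀ n, ∫ x in S n, F n (g n x) ∂μ ≤ ∫ x in S n, F n (V n x) ∂μ + r n) := by
  have hP : (1 : ℝ≥0∞) ≤ ENNReal.ofReal p := by simpa using hp.le
  have hp0 : 0 < p := by linarith
  set t' : ℕ → Rd d → Vec N := fun n => (H n)ᶜ.indicator (v n) with ht'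
  have tm : ∀ n, MemLp (t' n) (ENNReal.ofReal p) μ := fun n => (hv n).indicator (hH n).compl
  have h2' : Tendsto (fun n => eLpNorm (g n - t' n) (ENNReal.ofReal p) μ) atTop (𝓝 0) := by
    refine h2.congr fun n => eLpNorm_congr_ae ?_
    filter_upwards [ht n] with x hx
    simp [hx, ht']
  have hBt' : ∀ n, eLpNorm (t' n) (ENNReal.ofReal p) μ ≤ B := fun n =>
    (eLpNorm_indicator_le _).trans (hBv n)
  constructor
  · intro φ hφ hV0
    have a1 := weak_of_Lp hp (fun n => (hV n).sub (hv n)) h1 hφ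
    have a2 := weak_of_Lp hp (fun n => (hg n).sub (tm n)) h2' hφ
    have a3 := weak_ind hp hv hBt hBv hH hH0 hφ
    have a4 := ((hV0.sub a1).sub a3).add a2
    simp only [sub_zero, add_zero] at a4
    refine a4.congr fun n => ?_
    have i1 := (dot_holder hp (hV n) hφ).1
    have i2 := (dot_holder hp ((hV n).sub (hv n)) hφ).1
    have i3 := (dot_holder hp (hv n) (hφ.indicator (hH n))).1
    have i4 := (dot_holder hp ((hg n).sub (tm n)) hφ).1
    rw [← integral_sub i1 i2]
    rw [← integral_sub (f := fun x => dot (V n x) (φ x) - dot ((V n - v n) x) (φ x)) (i1.sub i2) i3]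
    rw [← integral_add (f := fun x => dot (V n x) (φ x) - dot ((V n - v n) x) (φ x)
      - dot (v n x) ((H n).indicator φ x)) ((i1.sub i2).sub i3) i4]
    refine integral_congr_ae (Eventually.of_forall fun x => ?_)
    simp only [Pi.sub_apply, dot_sub_left, ht']
    by_cases hx : x ∈ H n
    · simp [hx, dot_zero_left]
    · simp [hx, dot_zero_right]
  · intro F hFc hF3 hF4 S
    have int : ∀ (n) (w : Rd d → Vec N), MemLp w (ENNReal.ofReal p) μ → Integrable (fun x => F n (w x)) μ :=
      fun n w hw => (growth_int hp ((hFc n).comp_aestronglyMeasurable hw.1) hl ha hL hw (fun x => hF3 n _)).1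
    have e1 := energy_tendsto hp hmu hV hv hBt (Eventually.of_forall hBV) (Eventually.of_forall hBv) h1 hF4
      (fun n => int n _ (hV n)) (fun n => int n _ (hv n)) S
    have hgB : ∀ᶠ n in atTop, eLpNorm (g n) (ENNReal.ofReal p) μ ≤ B + 1 := by
      filter_upwards [ENNReal.tendsto_nhds_zero.1 h2' 1 one_pos] with n hn
      calc eLpNorm (g n) (ENNReal.ofReal p) μ = eLpNorm (t' n + (g n - t' n)) (ENNReal.ofReal p) μ := by
            congr 1; abel
        _ ≤ _ := eLpNorm_add_le (tm n).1 ((hg n).1.sub (tm n).1) hP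
        _ ≤ _ := add_le_add (hBt' n) hn
    have e2 := energy_tendsto hp hmu hg tm (B := B + 1) (by simp [hBt]) hgB
      (Eventually.of_forall fun n => (hBt' n).trans le_self_add) h2' hF4
      (fun n => int n _ (hg n)) (fun n => int n _ (tm n)) S
    have e3 : Tendsto (fun n => (a * lam + Lam) * (μ (H n)).toReal) atTop (𝓝 ((a * lam + Lam) * (0 : ℝ≥0∞).toReal)) :=
      ((ENNReal.tendsto_toReal (by simp)).comp hH0).const_mul _
    refine ⟨_, by simpa using (e2.sub e1).add e3, fun n => ?_⟩
    have e4 : ∫ x in S n, F n (t' n x) ∂μ ≤ ∫ x in S n, F n (v n x) ∂μ + (a * lam + Lam) * (μ (H n)).toReal := by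
      have k1 : IntegrableOn (fun x => (H n).indicator (fun _ => a * lam + Lam) x) (S n) μ :=
        ((integrable_const _).indicator (hH n)).integrableOn
      calc ∫ x in S n, F n (t' n x) ∂μ ≤ ∫ x in S n, (F n (v n x) + (H n).indicator (fun _ => a * lam + Lam) x) ∂μ := by
            refine integral_mono (int n _ (tm n)).integrableOn ((int n _ (hv n)).integrableOn.add k1) fun x => ?_
            by_cases hx : x ∈ H n
            · have b1 := (hF3 n 0).2
              have b2 := (hF3 n (v n x)).1
              have b3 : 0 ≤ eN (v n x) ^ p := Real.rpow_nonneg (eN_nonneg _) _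
              rw [eN_zero, Real.zero_rpow hp0.ne'] at b1
              simp only [ht', hx, mem_compl_iff, not_true_eq_false, not_false_eq_true, indicator_of_notMem, indicator_of_mem]
              nlinarith
            · simp [ht', hx]
        _ = ∫ x in S n, F n (v n x) ∂μ + ∫ x in S n, (H n).indicator (fun _ => a * lam + Lam) x ∂μ :=
            integral_add (int n _ (hv n)).integrableOn k1
        _ ≤ _ := by
            gcongr
            calc _ ≤ ∫ x, (H n).indicator (fun _ => a * lam + Lam) x ∂μ := by
                  refine integral_mono_measure Measure.restrict_le_self (Eventually.of_forall fun x => ?_)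
                    ((integrable_const _).indicator (hH n))
                  exact indicator_nonneg (fun _ _ => by positivity) x
              _ = _ := by
                  rw [integral_indicator_const _ (hH n), smul_eq_mul, mul_comm]; rfl
    linarith

end HC

namespace HC

lemma trunc_of_le {d N : ℕ} {n : ℕ} {w : Rd d → Vec N} {x : Rd d} (h : ‖w x‖ ≤ n) : trunc n w x = w x := by
  unfold trunc; exact indicator_of_mem (by exact h) _

lemma trunc_of_lt {d N : ℕ} {n : ℕ} {w : Rd d → Vec N} {x : Rd d} (h : (n : ℝ) < ‖w x‖) : trunc n w x = 0 := by
  unfold trunc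
  refine indicator_of_notMem (s := {x | ‖w x‖ ≤ n}) (fun h' => ?_) _
  exact absurd (show ‖w x‖ ≤ n from h') (not_le.2 h)

lemma trunc_of_zero {d N : ℕ} {n : ℕ} {w : Rd d → Vec N} {x : Rd d} (h : w x = 0) : trunc n w x = 0 := by
  rw [trunc_of_le (by simp [h]), h]

lemma cheb {d N : ℕ} {p : ℝ} (hp : 1 < p) (w : ℕ → Rd d → Vec N) (hw : ∀ n, Measurable (w n))
    {B : ℝ≥0∞} (hBt : B ≠ ∞) (hB : ∀ n, ∫⁻ x, ‖w n x‖ₑ ^ p ≤ B) :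
    Tendsto (fun n : ℕ => volume {x | (n : ℝ) < ‖w n x‖}) atTop (𝓝 0) := by
  have h1 : Tendsto (fun n : ℕ => B * (n : ℝ≥0∞)⁻¹) atTop (𝓝 (B * 0)) :=
    ENNReal.Tendsto.const_mul ENNReal.tendsto_inv_nat_nhds_zero (Or.inr hBt)
  rw [mul_zero] at h1
  refine tendsto_of_tendsto_of_tendsto_of_le_of_le' tendsto_const_nhds h1 (Eventually.of_forall fun _ => zero_le) ?_
  filter_upwards [eventually_ge_atTop 1] with n hn
  have hn1 : (1 : ℝ≥0∞) ≤ n := by exact_mod_cast hn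
  rw [← div_eq_mul_inv, ENNReal.le_div_iff_mul_le (Or.inl (by positivity)) (Or.inl (by simp)), mul_comm]
  refine le_trans ?_ (hB n)
  refine le_trans ?_ (mul_meas_ge_le_lintegral₀ ((hw n).enorm.pow_const p).aemeasurable (n : ℝ≥0∞))
  refine mul_le_mul' le_rfl (measure_mono fun x hx => ?_)
  have hx' : (n : ℝ≥0∞) ≤ ‖w n x‖ₑ := by
    rw [← ofReal_norm, ← ENNReal.ofReal_natCast]
    exact ENNReal.ofReal_le_ofReal (le_of_lt hx)
  show (n : ℝ≥0∞) ≤ ‖w n x‖ₑ ^ p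
  calc (n : ℝ≥0∞) ≤ (n : ℝ≥0∞) ^ p := by
        conv_lhs => rw [← ENNReal.rpow_one (n : ℝ≥0∞)]
        exact ENNReal.rpow_le_rpow_of_exponent_le hn1 hp.le
    _ ≤ _ := ENNReal.rpow_le_rpow hx' (by linarith)

theorem seq_core {d N M : ℕ} {p a lam Lam mu : ℝ} (hp : 1 < p) (hmu : 0 < mu)
    (ha : 0 < a) (hl : 0 < lam) (hL : 0 < Lam)
    (Ω D0 : Set (Rd d)) (hset : GoodSetting d Ω D0) (A : Fin d → (Vec N →ₗ[ℝ] Vec M)) (hA : ConstantRank A)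
    {c : ℝ} {E : ℝ → (Rd d → Vec N) → (Rd d → Vec N)} (hE : ExtensionProperty p A Ω D0 c E)
    (e : ℕ → ℝ) (he : ∀ n, 0 < e n) (he1 : ∀ n, e n ≤ 1) (he0 : Tendsto e atTop (𝓝 0))
    (U : ℕ → Rd d → Vec N) (hU : ∀ n, MemLpOn p Ω (U n)) (hUf : ∀ n, AFreeOn A Ω (U n))
    {B : ℝ≥0∞} (hBt : B ≠ ∞) (hB1 : ∀ n, eLpNorm (e n • U n) (ENNReal.ofReal p) (volume.restrict Ω) ≤ B)
    (hB2 : ∀ n, eLpNorm (U n) (ENNReal.ofReal p) (volume.restrict (stiffPart (e n) Ω D0)) ≤ B)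
    (hW : ∀ φ, MemLpOn (conjExp p) Ω φ → Tendsto (fun n => ∫ x in Ω, dot (e n • U n x) (φ x)) atTop (𝓝 0))
    (F : ℕ → Vec N → ℝ) (hF1 : ∀ n, Continuous (F n))
    (hF3 : ∀ n ξ, lam * (-a + eN ξ ^ p) ≤ F n ξ ∧ F n ξ ≤ Lam * (1 + eN ξ ^ p))
    (hF4 : ∀ n, ∀ ξ ζ, |F n ξ - F n ζ| ≤ mu * (1 + eN ξ ^ (p - 1) + eN ζ ^ (p - 1)) * eN (ξ - ζ)) :
    ∃ σ : ℕ → ℕ, StrictMono σ ∧ ∃ g : ℕ → Rd d → Vec N,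
      (∀ n, MemLpOn p Ω (g n)) ∧ (∀ n, AFreeOn A Ω (g n)) ∧
      (∀ n, ∀ᵐ x ∂volume.restrict (stiffPart (e (σ n)) Ω D0), g n x = 0) ∧
      UnifIntegrable g (ENNReal.ofReal p) (volume.restrict Ω) ∧
      (∀ φ, MemLpOn (conjExp p) Ω φ → Tendsto (fun n => ∫ x in Ω, dot (g n x) (φ x)) atTop (𝓝 0)) ∧
      ∃ r : ℕ → ℝ, Tendsto r atTop (𝓝 0) ∧ ∀ n, ∫ x in softPart (e (σ n)) Ω D0, F (σ n) (g n x) ≤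
        (∫ x in softPart (e (σ n)) Ω D0, F (σ n) (e (σ n) • U (σ n) x)) + r n := by
  obtain ⟨hd2, hΩo, -, hΩb, -, hDo, -, -, -, hQ⟩ := hset
  obtain ⟨hc, hE1, -⟩ := hE
  have hΩt : volume Ω ≠ ∞ := hΩb.measure_lt_top.ne
  obtain ⟨R, hR⟩ := hΩb.exists_norm_le
  set μ : Measure (Rd d) := volume.restrict Ω with hμ
  have fin : IsFiniteMeasure μ := ⟨by simpa [hμ] using hΩt.lt_top⟩
  set P := ENNReal.ofReal p with hPdef
  have hP : (1 : ℝ≥0∞) ≤ P := by simpa [hPdef] using hp.le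
  have hp0 : 0 < p := by linarith
  have stm : ∀ n, MeasurableSet (stiffPart (e n) Ω D0) := fun n =>
    hΩo.measurableSet.diff (softPart_open (he n) Ω hDo).measurableSet
  have stsub : ∀ n, stiffPart (e n) Ω D0 ⊆ Ω := fun n => sdiff_subset
  set C := ENNReal.ofReal (c * (N + 1)) with hC
  have hEb : ∀ n (u : Rd d → Vec N), MemLpOn p Ω u → AFreeOn A Ω u → eLpNorm (E (e n) u) P μ ≤
      C * eLpNorm u P (volume.restrict (stiffPart (e n) Ω D0)) := fun n u h1 h2 =>
    ext_bound hc (stsub n) h1 (hE1 _ (he n) u h1 h2).2.1 (hE1 _ (he n) u h1 h2).2.2.1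
  -- the corrected sequence
  set X : ℕ → Rd d → Vec N := fun n => e n • E (e n) (U n) with hX
  have XL : ∀ n, MemLp (X n) P μ := fun n => ((hE1 _ (he n) _ (hU n) (hUf n)).2.1).const_smul (e n)
  have Xb : ∀ n, eLpNorm (X n) P μ ≤ ENNReal.ofReal (e n) * (C * B) := by
    intro n
    rw [hX, eLpNorm_const_smul, Real.enorm_of_nonneg (he n).le]
    exact mul_le_mul' le_rfl ((hEb n _ (hU n) (hUf n)).trans (mul_le_mul' le_rfl (hB2 n)))
  have hCB : C * B ≠ ∞ := ENNReal.mul_ne_top ENNReal.ofReal_ne_top hBt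
  have X0 : Tendsto (fun n => eLpNorm (X n) P μ) atTop (𝓝 0) := by
    have h1 : Tendsto (fun n => ENNReal.ofReal (e n) * (C * B)) atTop (𝓝 (ENNReal.ofReal 0 * (C * B))) :=
      ENNReal.Tendsto.mul_const (ENNReal.tendsto_ofReal he0) (Or.inr hCB)
    rw [ENNReal.ofReal_zero, zero_mul] at h1
    exact tendsto_of_tendsto_of_tendsto_of_le_of_le tendsto_const_nhds h1 (fun _ => zero_le) Xb
  set V : ℕ → Rd d → Vec N := fun n => e n • U n with hVdef
  have VL : ∀ n, MemLp (V n) P μ := fun n => (hU n).const_smul (e n)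
  set v : ℕ → Rd d → Vec N := fun n => V n - X n with hvdef
  have vL : ∀ n, MemLp (v n) P μ := fun n => (VL n).sub (XL n)
  have vf : ∀ n, AFreeOn A Ω (v n) := fun n =>
    ((hUf n).smul (e n)).sub ((hE1 _ (he n) _ (hU n) (hUf n)).2.2.2.smul (e n))
      ((VL n).integrable hP) ((XL n).integrable hP)
  have v0 : ∀ n, ∀ᵐ x ∂volume.restrict (stiffPart (e n) Ω D0), v n x = 0 := by
    intro n
    filter_upwards [(hE1 _ (he n) _ (hU n) (hUf n)).1] with x hx
    simp [hvdef, hVdef, hX, hx]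
  set Bv := B + C * B with hBv
  have hBvt : Bv ≠ ∞ := by simp [hBv, hBt, hCB]
  have vB : ∀ n, eLpNorm (v n) P μ ≤ Bv := by
    intro n
    refine (eLpNorm_sub_le (VL n).1 (XL n).1 hP).trans (add_le_add (hB1 n) ((Xb n).trans ?_))
    calc _ ≤ 1 * (C * B) := mul_le_mul' (by rw [← ENNReal.ofReal_one]; exact ENNReal.ofReal_le_ofReal (he1 n)) le_rfl
      _ = _ := one_mul _
  set vm : ℕ → Rd d → Vec N := fun n => (vL n).1.mk (v n) with hvm
  have vmm : ∀ n, Measurable (vm n) := fun n => (vL n).1.stronglyMeasurable_mk.measurable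
  have vmv : ∀ n, ∀ᵐ x ∂μ, v n x = vm n x := fun n => (vL n).1.ae_eq_mk
  set w : ℕ → Rd d → Vec N := fun n => (goodPart (e n) Ω D0).indicator (vm n) with hw
  have gm : ∀ n, MeasurableSet (goodPart (e n) Ω D0) := fun n => (goodPart_open (he n) Ω hDo).measurableSet
  have gsub : ∀ n, goodPart (e n) Ω D0 ⊆ Ω := fun n => (goodPart_sub Ω D0).trans (softPart_sub Ω D0)
  have wm : ∀ n, Measurable (w n) := fun n => (vmm n).indicator (gm n)
  have w0 : ∀ n, ∀ x ∉ Ω, w n x = 0 := fun n x hx => indicator_of_notMem (fun h => hx (gsub n h)) _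
  have ws : ∀ n, ∀ x ∉ softPart (e n) Ω D0, w n x = 0 := fun n x hx =>
    indicator_of_notMem (fun h => hx (goodPart_sub Ω D0 h)) _
  have wf : ∀ n, AFreeOn A univ (w n) := by
    intro n
    refine good_free A hΩo hDo hQ (he n) (vm n) ?_ ((vf n).congr (vmv n)) ?_
    · exact ((vL n).integrable hP).congr (vmv n)
    · filter_upwards [v0 n, ae_restrict_of_ae_restrict_of_subset (stsub n) (vmv n)] with x h1 h2
      rw [← h2, h1]
  have wB : ∀ n, ∫⁻ x, ‖w n x‖ₑ ^ p ≤ Bv ^ p := by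
    intro n
    have e1 : ∀ x, ‖w n x‖ₑ ^ p = (goodPart (e n) Ω D0).indicator (fun x => ‖vm n x‖ₑ ^ p) x := by
      intro x
      by_cases hx : x ∈ goodPart (e n) Ω D0
      · simp [hw, hx]
      · simp [hw, hx, hp0]
    simp only [e1]
    rw [lintegral_indicator (gm n)]
    refine (lintegral_mono_set (gsub n)).trans ?_
    have e2 : eLpNorm (vm n) P μ ≤ Bv := by rw [← eLpNorm_congr_ae (vmv n)]; exact vB n
    rw [eLpNorm_eq_lintegral_rpow_enorm_toReal (by simpa [hPdef] using hp0) ENNReal.ofReal_ne_top,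
      ENNReal.toReal_ofReal hp0.le] at e2
    have := ENNReal.rpow_le_rpow e2 hp0.le
    rwa [← ENNReal.rpow_mul, one_div, inv_mul_cancel₀ hp0.ne', ENNReal.rpow_one] at this
  have hBp : Bv ^ p ≠ ∞ := ENNReal.rpow_ne_top_of_nonneg hp0.le hBvt
  obtain ⟨σ, hσ, z, zL, zf, zt, tU⟩ := decomp (by omega) A hA p hp Ω hΩo.measurableSet hΩt R hR w wm w0 wf
    (Bv ^ p) hBp wB
  have tmeas : ∀ n, AEStronglyMeasurable (trunc n (w (σ n))) μ := fun n =>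
    (trunc_meas n (wm (σ n))).aestronglyMeasurable
  set Y : ℕ → Rd d → Vec N := fun n => E (e (σ n)) (z n) with hY
  have YL : ∀ n, MemLp (Y n) P μ := fun n => (hE1 _ (he _) _ (zL n) (zf n)).2.1
  have Yb : ∀ n, eLpNorm (Y n) P μ ≤ C * eLpNorm (z n - trunc n (w (σ n))) P μ := by
    intro n
    refine (hEb (σ n) _ (zL n) (zf n)).trans (mul_le_mul' le_rfl ?_)
    have : eLpNorm (z n) P (volume.restrict (stiffPart (e (σ n)) Ω D0)) =
        eLpNorm (z n - trunc n (w (σ n))) P (volume.restrict (stiffPart (e (σ n)) Ω D0)) := by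
      refine eLpNorm_congr_ae ((ae_restrict_iff' (stm _)).2 (Eventually.of_forall fun x hx => ?_))
      simp [trunc_of_zero (n := n) (ws (σ n) x hx.2)]
    rw [this]
    exact eLpNorm_mono_measure _ (Measure.restrict_mono_set _ (stsub _))
  have Y0 : Tendsto (fun n => eLpNorm (Y n) P μ) atTop (𝓝 0) := by
    have h1 : Tendsto (fun n => C * eLpNorm (z n - trunc n (w (σ n))) P μ) atTop (𝓝 (C * 0)) :=
      ENNReal.Tendsto.const_mul zt (Or.inr ENNReal.ofReal_ne_top)
    rw [mul_zero] at h1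
    exact tendsto_of_tendsto_of_tendsto_of_le_of_le tendsto_const_nhds h1 (fun _ => zero_le) Yb
  set g : ℕ → Rd d → Vec N := fun n => z n - Y n with hg
  have gL : ∀ n, MemLp (g n) P μ := fun n => (zL n).sub (YL n)
  have gt : Tendsto (fun n => eLpNorm (g n - trunc n (w (σ n))) P μ) atTop (𝓝 0) := by
    have h1 := zt.add Y0
    rw [add_zero] at h1
    refine tendsto_of_tendsto_of_tendsto_of_le_of_le tendsto_const_nhds h1 (fun _ => zero_le) fun n => ?_
    have : g n - trunc n (w (σ n)) = (z n - trunc n (w (σ n))) - Y n := by simp only [hg]; abel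
    rw [this]
    exact eLpNorm_sub_le ((zL n).1.sub (tmeas n)) (YL n).1 hP
  have tL : ∀ n, MemLp (trunc n (w (σ n))) P μ := by
    intro n
    have h1 : MemLp (w (σ n)) P μ := by
      have : MemLp (vm (σ n)) P μ := (memLp_congr_ae (vmv (σ n))).1 (vL (σ n))
      exact this.indicator (gm _)
    exact h1.mono (tmeas n) (Eventually.of_forall fun x => trunc_norm_le n _ x)
  have gU : UnifIntegrable g P μ := by
    have h1 : UnifIntegrable (fun n => g n - trunc n (w (σ n))) P μ :=
      unifIntegrable_of_tendsto_Lp (g := 0) hP ENNReal.ofReal_ne_top (fun n => (gL n).sub (tL n)) MemLp.zero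
        (by simpa using gt)
    have h2 := h1.add tU hP (fun n => (gL n).1.sub (tmeas n)) tmeas
    convert h2 using 1
    ext n x
    simp
  have eσ : Tendsto (fun n => e (σ n)) atTop (𝓝 0) := he0.comp hσ.tendsto_atTop
  set H : ℕ → Set (Rd d) := fun n => (softPart (e (σ n)) Ω D0 \ goodPart (e (σ n)) Ω D0) ∪ {x | (n : ℝ) < ‖w (σ n) x‖} with hH
  have Hm : ∀ n, MeasurableSet (H n) := fun n =>
    ((softPart_open (he _) Ω hDo).measurableSet.diff (gm _)).union
      (measurableSet_lt measurable_const (wm _).norm)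
  have H0 : Tendsto (fun n => μ (H n)) atTop (𝓝 0) := by
    have h1 := (bad_tendsto Ω D0 hΩo hΩt hQ (fun n => e (σ n)) (fun n => he _) eσ).add
      (cheb hp (fun n => w (σ n)) (fun n => wm _) hBp (fun n => wB _))
    rw [add_zero] at h1
    exact tendsto_of_tendsto_of_tendsto_of_le_of_le tendsto_const_nhds h1 (fun _ => zero_le) fun n =>
      (Measure.restrict_le_self _).trans (measure_union_le _ _)
  have tH : ∀ n, ∀ᵐ x ∂μ, trunc n (w (σ n)) x = (H n)ᶜ.indicator (v (σ n)) x := by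
    intro n
    have s0 := (ae_restrict_iff' (stm (σ n))).1 (v0 (σ n))
    filter_upwards [vmv (σ n), ae_restrict_of_ae s0, ae_restrict_mem hΩo.measurableSet] with x h1 h2 h3
    by_cases hs : x ∈ softPart (e (σ n)) Ω D0
    · by_cases hgd : x ∈ goodPart (e (σ n)) Ω D0
      · have hwx : w (σ n) x = v (σ n) x := by rw [h1]; exact indicator_of_mem hgd _
        by_cases hn : (n : ℝ) < ‖w (σ n) x‖
        · rw [trunc_of_lt hn, indicator_of_notMem (s := (H n)ᶜ) (fun h => h (Or.inr hn))]
        · rw [trunc_of_le (not_lt.1 hn), hwx, indicator_of_mem]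
          rintro (h | h)
          · exact h.2 hgd
          · exact hn h
      · rw [trunc_of_zero (indicator_of_notMem hgd _), indicator_of_notMem (s := (H n)ᶜ) (fun h => h (Or.inl ⟨hs, hgd⟩))]
    · rw [trunc_of_zero (ws _ x hs)]
      by_cases hx : x ∈ (H n)ᶜ
      · rw [indicator_of_mem hx, h2 ⟨h3, hs⟩]
      · rw [indicator_of_notMem hx]
  have vV : Tendsto (fun n => eLpNorm (V (σ n) - v (σ n)) P μ) atTop (𝓝 0) := by
    refine (X0.comp hσ.tendsto_atTop).congr fun n => ?_
    simp [hvdef]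
  obtain ⟨K1, K2⟩ := abs_core (V := fun n => V (σ n)) (v := fun n => v (σ n)) hp hmu ha hl hL Hm H0
    (fun n => VL _) (fun n => vL _) gL tH hBvt (fun n => (hB1 _).trans le_self_add) (fun n => vB _) vV gt
  refine ⟨σ, hσ, g, gL, ?_, ?_, gU, ?_, ?_⟩
  · exact fun n => (zf n).sub (hE1 _ (he _) _ (zL n) (zf n)).2.2.2 ((zL n).integrable hP) ((YL n).integrable hP)
  · intro n
    filter_upwards [(hE1 _ (he (σ n)) _ (zL n) (zf n)).1] with x hx
    simp [hg, hY, hx]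
  · intro φ hφ
    exact K1 φ hφ ((hW φ hφ).comp hσ.tendsto_atTop)
  · obtain ⟨r, hr, h⟩ := K2 (fun n => F (σ n)) (fun n => hF1 _) (fun n => hF3 _) (fun n => hF4 _)
      (fun n => softPart (e (σ n)) Ω D0)
    refine ⟨r, hr, fun n => ?_⟩
    have := h n
    rw [hμ, Measure.restrict_restrict_of_subset (softPart_sub Ω D0)] at this
    exact this

end HC

namespace HC

lemma low_bound {d N : ℕ} {p a lam m : ℝ} {μ : Measure (Rd d)} [IsFiniteMeasure μ]
    {F : Rd d → ℝ} {u : Rd d → Vec N} (hF : Integrable F μ) (hu : Integrable (fun x => eN (u x) ^ p) μ)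
    (h : ∀ x, lam * (-a + eN (u x) ^ p) ≤ F x) (hm : lam * a * μ.real univ ≤ m) :
    lam * ∫ x, eN (u x) ^ p ∂μ - m ≤ ∫ x, F x ∂μ := by
  have h1 : ∫ x, (lam * eN (u x) ^ p - lam * a) ∂μ ≤ ∫ x, F x ∂μ :=
    integral_mono ((hu.const_mul _).sub (integrable_const _)) hF fun x => by
      have := h x
      simp only
      linarith
  rw [integral_sub (hu.const_mul _) (integrable_const _), integral_const_mul, integral_const, smul_eq_mul] at h1
  linarith

lemma lint_of_int {d N : ℕ} {p K : ℝ} (hp : 0 < p) {μ : Measure (Rd d)} {u : Rd d → Vec N}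
    (hu : Integrable (fun x => eN (u x) ^ p) μ) (h : ∫ x, eN (u x) ^ p ∂μ ≤ K) :
    ∫⁻ x, ‖u x‖ₑ ^ p ∂μ ≤ ENNReal.ofReal K := by
  refine le_trans ?_ (ENNReal.ofReal_le_ofReal h)
  rw [ofReal_integral_eq_lintegral_ofReal hu (Eventually.of_forall fun x => Real.rpow_nonneg (eN_nonneg _) _)]
  refine lintegral_mono fun x => ?_
  rw [← ofReal_norm, ENNReal.ofReal_rpow_of_nonneg (norm_nonneg _) hp.le]
  exact ENNReal.ofReal_le_ofReal (Real.rpow_le_rpow (norm_nonneg _) (norm_le_eN _) hp.le)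

lemma eLp_of_lint {d N : ℕ} {p : ℝ} (hp : 0 < p) {μ : Measure (Rd d)} {u : Rd d → Vec N} {K : ℝ≥0∞}
    (h : ∫⁻ x, ‖u x‖ₑ ^ p ∂μ ≤ K) : eLpNorm u (ENNReal.ofReal p) μ ≤ K ^ (1 / p) := by
  rw [eLpNorm_eq_lintegral_rpow_enorm_toReal (by simpa using hp) ENNReal.ofReal_ne_top,
    ENNReal.toReal_ofReal hp.le]
  exact ENNReal.rpow_le_rpow h (by positivity)

lemma cara_meas {d N : ℕ} {f1 : Rd d → Vec N → ℝ} (h : H1stiff f1) {μ : Measure (Rd d)} {u : Rd d → Vec N}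
    (hu : AEStronglyMeasurable u μ) (c : ℝ) : AEStronglyMeasurable (fun x => f1 (c • x) (u x)) μ := by
  have h1 : StronglyMeasurable (Function.uncurry fun (ξ : Vec N) (x : Rd d) => f1 x ξ) :=
    stronglyMeasurable_uncurry_of_continuous_of_stronglyMeasurable (fun x => h.2 x)
      fun ξ => (h.1 ξ).stronglyMeasurable
  have h2 : AEMeasurable (fun x => (u x, c • x)) μ := hu.aemeasurable.prodMk (by fun_prop)
  exact (h1.measurable.comp_aemeasurable h2).aestronglyMeasurable

/-- soft part of the energy -/
def aE {d N : ℕ} (Ω D0 : Set (Rd d)) (f0 : ℝ → Vec N → ℝ) (ε : ℝ) (u : Rd d → Vec N) : ℝ :=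
  ∫ x in softPart ε Ω D0, f0 ε (ε • u x)

/-- stiff part of the energy -/
def bE {d N : ℕ} (Ω D0 : Set (Rd d)) (f1 : Rd d → Vec N → ℝ) (ε : ℝ) (u : Rd d → Vec N) : ℝ :=
  ∫ x in stiffPart ε Ω D0, f1 (ε⁻¹ • x) (u x)

lemma eps_bounds {d N M : ℕ} {p a lam Lam c : ℝ} (hp : 1 < p)
    (Ω D0 : Set (Rd d)) (hset : GoodSetting d Ω D0)
    (A : Fin d → (Vec N →ₗ[ℝ] Vec M))
    (f0 : ℝ → Vec N → ℝ) (f1 : Rd d → Vec N → ℝ)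
    (h1 : H1soft f0 ∧ H1stiff f1) (h3 : H3soft p a lam Lam f0 ∧ H3stiff p a lam Lam f1)
    {ε : ℝ} (hε : 0 < ε) (hε1 : ε ≤ 1) (u : Rd d → Vec N)
    (hbd : Feps p A Ω D0 f0 f1 ε u ≤ (c : EReal)) {m : ℝ} (hm : m = lam * a * (volume Ω).toReal) :
    u ∈ U1 p A Ω ∧ Feps p A Ω D0 f0 f1 ε u = ((aE Ω D0 f0 ε u + bE Ω D0 f1 ε u : ℝ) : EReal) ∧
    aE Ω D0 f0 ε u ∈ Icc (-m) (c + m) ∧ bE Ω D0 f1 ε u ∈ Icc (-m) (c + m) ∧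
    eLpNorm (ε • u) (ENNReal.ofReal p) (volume.restrict Ω) ≤ (ENNReal.ofReal ((c + 2 * m) / lam) + ENNReal.ofReal ((c + 2 * m) / lam)) ^ (1 / p) ∧
    eLpNorm u (ENNReal.ofReal p) (volume.restrict (stiffPart ε Ω D0)) ≤ (ENNReal.ofReal ((c + 2 * m) / lam) + ENNReal.ofReal ((c + 2 * m) / lam)) ^ (1 / p) := by
  obtain ⟨hd2, hΩo, -, hΩb, -, hDo, -, -, -, hQ⟩ := hset
  obtain ⟨⟨ha, hl, hL, h3a⟩, -, -, -, h3b⟩ := h3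
  have hp0 : 0 < p := by linarith
  have hΩt : volume Ω ≠ ∞ := hΩb.measure_lt_top.ne
  have hmem : u ∈ U1 p A Ω := by
    by_contra hn
    unfold Feps at hbd
    rw [if_neg hn] at hbd
    exact absurd hbd (by simp)
  have hFe : Feps p A Ω D0 f0 f1 ε u = ((aE Ω D0 f0 ε u + bE Ω D0 f1 ε u : ℝ) : EReal) := by
    unfold Feps; rw [if_pos hmem]; rfl
  refine ⟨hmem, hFe, ?_⟩
  rw [hFe] at hbd
  have hab : aE Ω D0 f0 ε u + bE Ω D0 f1 ε u ≤ c := by exact_mod_cast hbd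
  have ssub : softPart ε Ω D0 ⊆ Ω := softPart_sub Ω D0
  have tsub : stiffPart ε Ω D0 ⊆ Ω := sdiff_subset
  have fin : ∀ S : Set (Rd d), S ⊆ Ω → IsFiniteMeasure (volume.restrict S) := fun S hS =>
    ⟨by simpa using (measure_mono hS).trans_lt hΩt.lt_top⟩
  have mle : ∀ S : Set (Rd d), S ⊆ Ω → lam * a * (volume.restrict S).real univ ≤ m := fun S hS => by
    rw [hm]
    refine mul_le_mul_of_nonneg_left ?_ (by positivity)
    rw [Measure.real, Measure.restrict_apply_univ]
    exact ENNReal.toReal_mono hΩt (measure_mono hS)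
  have uL : MemLp u (ENNReal.ofReal p) (volume.restrict Ω) := hmem.1
  have us : MemLp (ε • u) (ENNReal.ofReal p) (volume.restrict (softPart ε Ω D0)) :=
    (uL.const_smul ε).mono_measure (Measure.restrict_mono_set _ ssub)
  have ut : MemLp u (ENNReal.ofReal p) (volume.restrict (stiffPart ε Ω D0)) :=
    uL.mono_measure (Measure.restrict_mono_set _ tsub)
  have := fin _ ssub
  have := fin _ tsub
  obtain ⟨ia, ja⟩ := growth_int (F := fun x => f0 ε (ε • u x)) hp
    ((h1.1 ε hε).comp_aestronglyMeasurable us.1) hl ha hL us (fun x => h3a ε hε _)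
  obtain ⟨ib, jb⟩ := growth_int (F := fun x => f1 (ε⁻¹ • x) (u x)) hp
    (cara_meas h1.2 ut.1 _) hl ha hL ut (fun x => h3b _ _)
  have la := low_bound ia ja (fun x => (h3a ε hε _).1) (mle _ ssub)
  have lb := low_bound ib jb (fun x => (h3b _ _).1) (mle _ tsub)
  change _ ≤ aE Ω D0 f0 ε u at la
  change _ ≤ bE Ω D0 f1 ε u at lb
  set Ia := ∫ x in softPart ε Ω D0, eN ((ε • u) x) ^ p
  set Ib := ∫ x in stiffPart ε Ω D0, eN (u x) ^ p
  have Ia0 : 0 ≤ Ia := integral_nonneg fun x => Real.rpow_nonneg (eN_nonneg _) _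
  have Ib0 : 0 ≤ Ib := integral_nonneg fun x => Real.rpow_nonneg (eN_nonneg _) _
  have la0 := mul_nonneg hl.le Ia0
  have lb0 := mul_nonneg hl.le Ib0
  have Iak : Ia ≤ (c + 2 * m) / lam := by rw [le_div_iff₀ hl]; linarith
  have Ibk : Ib ≤ (c + 2 * m) / lam := by rw [le_div_iff₀ hl]; linarith
  have La := lint_of_int hp0 ja Iak
  have Lb := lint_of_int hp0 jb Ibk
  refine ⟨⟨by linarith, by linarith⟩, ⟨by linarith, by linarith⟩, eLp_of_lint hp0 ?_, eLp_of_lint hp0 ?_⟩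
  · have hU : Ω = softPart ε Ω D0 ∪ stiffPart ε Ω D0 := (union_sdiff_cancel ssub).symm
    calc ∫⁻ x in Ω, ‖(ε • u) x‖ₑ ^ p = ∫⁻ x in softPart ε Ω D0 ∪ stiffPart ε Ω D0, ‖(ε • u) x‖ₑ ^ p := by
          rw [← hU]
      _ ≤ _ := lintegral_union_le _ _ _
      _ ≤ _ := by
          refine add_le_add La (le_trans (lintegral_mono fun x => ?_) Lb)
          refine ENNReal.rpow_le_rpow ?_ hp0.le
          rw [Pi.smul_apply, enorm_smul, Real.enorm_of_nonneg hε.le]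
          calc _ ≤ 1 * ‖u x‖ₑ := mul_le_mul' (by rw [← ENNReal.ofReal_one]; exact ENNReal.ofReal_le_ofReal hε1) le_rfl
            _ = _ := one_mul _
  · exact Lb.trans le_self_add

lemma pequi_of_unif {d N : ℕ} {p : ℝ} (hp : 1 < p) {Ω : Set (Rd d)} {g : ℕ → Rd d → Vec N}
    (hg : ∀ n, MemLpOn p Ω (g n)) (hU : UnifIntegrable g (ENNReal.ofReal p) (volume.restrict Ω)) :
    PEquiintegrable p Ω g := by
  intro η hη
  have hp0 : 0 < p := by linarith
  set κ := (η / 2) ^ (1 / p) / (N + 1) with hκ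
  have hκ0 : 0 < κ := by positivity
  obtain ⟨δ, hδ, h⟩ := hU hκ0
  refine ⟨δ, hδ, fun n S hS hSΩ hvol => ?_⟩
  have h1 := h n S hS (by rw [Measure.restrict_apply hS, inter_eq_left.2 hSΩ]; exact hvol.le)
  rw [eLpNorm_indicator_eq_eLpNorm_restrict hS, Measure.restrict_restrict_of_subset hSΩ] at h1
  have gS : MemLp (g n) (ENNReal.ofReal p) (volume.restrict S) :=
    (hg n).mono_measure (Measure.restrict_mono_set _ hSΩ)
  have h2 : eLpNorm (fun x => eN (g n x)) (ENNReal.ofReal p) (volume.restrict S) ≤ ENNReal.ofReal ((η / 2) ^ (1 / p)) := by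
    refine (eLpNorm_eN_le _ _ _).trans ((mul_le_mul' le_rfl h1).trans (le_of_eq ?_))
    rw [← ENNReal.ofReal_mul (by positivity)]
    congr 1
    rw [hκ]; field_simp
  rw [(memLp_eN gS).eLpNorm_eq_integral_rpow_norm (by simpa using hp0) ENNReal.ofReal_ne_top,
    ENNReal.toReal_ofReal hp0.le, ENNReal.ofReal_le_ofReal_iff (by positivity), one_div] at h2
  simp only [Real.norm_of_nonneg (eN_nonneg _)] at h2
  have h0 : 0 ≤ ∫ x in S, eN (g n x) ^ p := integral_nonneg fun x => Real.rpow_nonneg (eN_nonneg _) _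
  have h3 := (Real.rpow_le_rpow_iff h0 (by positivity) (by positivity)).1 h2
  linarith

end HC

namespace HC

/-- refined splitting for the liminf inequality.
Under the hypotheses of the splitting lemma, for an admissible operator `𝒜` there is a
`p`-equiintegrable replacement `{ṽ_ε}` of the soft part realizing the liminf splitting. -/
theorem refined_splitting
    {d N M : ℕ} (p a lam Lam mu : ℝ) (hp : 1 < p)
    (Ω D0 : Set (Rd d)) (hset : GoodSetting d Ω D0)
    (A : Fin d → (Vec N →ₗ[ℝ] Vec M)) (hA : Admissible p A Ω D0)
    (f0 : ℝ → Vec N → ℝ) (f1 : Rd d → Vec N → ℝ) (f0lim : Vec N → ℝ)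
    (h1 : H1soft f0 ∧ H1stiff f1) (h2 : H2 f1)
    (h3 : H3soft p a lam Lam f0 ∧ H3stiff p a lam Lam f1)
    (h4 : H4soft p mu f0 ∧ H4stiff p mu f1) (h5 : H5 f0 f0lim)
    (u ut : ℝ → Rd d → Vec N) (v : Rd d → Vec N)
    (hu0 : WeakLpTendsto p Ω (𝓝[>] (0 : ℝ)) (fun ε x => ε • u ε x) 0)
    (hut : ∀ ε : ℝ, 0 < ε → MemLpOn p Ω (ut ε) ∧ AFreeOn A Ω (ut ε))
    (heq : ∀ ε : ℝ, 0 < ε → ∀ᵐ x ∂volume.restrict (stiffPart ε Ω D0), u ε x = ut ε x)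
    (hutw : WeakLpTendsto p Ω (𝓝[>] (0 : ℝ)) ut v)
    (c : ℝ) (hc : -(a * lam) * (volume Ω).toReal ≤ c)
    (hbd : ∀ ε : ℝ, 0 < ε → Feps p A Ω D0 f0 f1 ε (u ε) ≤ (c : EReal)) :
    ∃ vt : ℝ → Rd d → Vec N,
      (∀ ε : ℝ, 0 < ε → MemLpOn p Ω (vt ε)) ∧
      PEquiintegrable p Ω (fun ε : {ε : ℝ // 0 < ε} => fun x => ε.1 • vt ε.1 x) ∧
      (∀ ε : ℝ, 0 < ε → ∀ᵐ x ∂volume.restrict (stiffPart ε Ω D0), vt ε x = 0) ∧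
      (∀ ε : ℝ, 0 < ε → AFreeOn A Ω (vt ε)) ∧
      WeakLpTendsto p Ω (𝓝[>] (0 : ℝ)) (fun ε x => ε • vt ε x) 0 ∧
      (Filter.liminf (fun ε => F0eps p A Ω D0 f0 ε (vt ε)) (𝓝[>] (0 : ℝ)) +
          Filter.liminf (fun ε => F1eps p A Ω D0 f1 ε (ut ε)) (𝓝[>] (0 : ℝ)) ≤
        Filter.liminf (fun ε => Feps p A Ω D0 f0 f1 ε (u ε)) (𝓝[>] (0 : ℝ))) := by
  obtain ⟨hcr, -, cE, E, hE⟩ := hA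
  obtain ⟨hd2, hΩo, hΩc, hΩb, hΩL, hDo, hDc, hDL, hDk, hQ⟩ := id hset
  obtain ⟨ha, hl, hL, h3a⟩ := id h3.1
  obtain ⟨hmu, h4a⟩ := id h4.1
  have hp0 : 0 < p := by linarith
  obtain ⟨m, hm⟩ : ∃ m, m = lam * a * (volume Ω).toReal := ⟨_, rfl⟩
  have key := fun (ε : ℝ) (hε : 0 < ε) (hε1 : ε ≤ 1) =>
    eps_bounds hp Ω D0 hset A f0 f1 h1 h3 hε hε1 (u ε) (hbd ε hε) hm
  set B : ℝ≥0∞ := (ENNReal.ofReal ((c + 2 * m) / lam) + ENNReal.ofReal ((c + 2 * m) / lam)) ^ (1 / p) with hB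
  have hBt : B ≠ ∞ := ENNReal.rpow_ne_top_of_nonneg (by positivity) (by simp)
  have evpos : ∀ᶠ ε in 𝓝[>] (0 : ℝ), 0 < ε := eventually_mem_nhdsWithin
  have evlt : ∀ η : ℝ, 0 < η → ∀ᶠ ε in 𝓝[>] (0 : ℝ), 0 < ε ∧ ε < η := fun η hη =>
    Ioo_mem_nhdsGT hη
  set Lf := Filter.liminf (fun ε => Feps p A Ω D0 f0 f1 ε (u ε)) (𝓝[>] (0 : ℝ)) with hLf
  have Lle : Lf ≤ (c : EReal) := by
    refine liminf_le_of_le (by isBoundedDefault) fun b hb => ?_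
    obtain ⟨ε, h, h'⟩ := (hb.and evpos).exists
    exact h.trans (hbd ε h')
  have Lge : ((-m + -m : ℝ) : EReal) ≤ Lf := by
    refine le_liminf_of_le (by isBoundedDefault) ?_
    filter_upwards [evlt 1 one_pos] with ε hε
    obtain ⟨-, hF, ha', hb', -⟩ := key ε hε.1 hε.2.le
    rw [hF]
    exact_mod_cast add_le_add ha'.1 hb'.1
  obtain ⟨ℓ, hℓ⟩ : ∃ ℓ : ℝ, Lf = (ℓ : EReal) := by
    refine ⟨Lf.toReal, (EReal.coe_toReal ?_ ?_).symm⟩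
    · intro h; rw [h] at Lle; exact absurd Lle (by simp)
    · intro h; rw [h] at Lge; exact absurd Lge (by simp)
  -- a minimizing sequence of scales
  have hex : ∀ n : ℕ, ∃ ε : ℝ, (0 < ε ∧ ε < 1 / ((n : ℝ) + 1)) ∧
      aE Ω D0 f0 ε (u ε) + bE Ω D0 f1 ε (u ε) < ℓ + 1 / ((n : ℝ) + 1) := by
    intro n
    have hn : (0 : ℝ) < 1 / ((n : ℝ) + 1) := by positivity
    have hlt : Lf < ((ℓ + 1 / ((n : ℝ) + 1) : ℝ) : EReal) := by
      rw [hℓ]; exact EReal.coe_lt_coe_iff.2 (by linarith)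
    obtain ⟨ε, h, h'⟩ := ((frequently_lt_of_liminf_lt (by isBoundedDefault) hlt).and_eventually
      (evlt _ hn)).exists
    refine ⟨ε, h', ?_⟩
    have hle1 : ε ≤ 1 := h'.2.le.trans (by rw [div_le_one (by positivity)]; linarith [Nat.cast_nonneg (α := ℝ) n])
    obtain ⟨-, hF, -⟩ := key ε h'.1 hle1
    rw [hF] at h
    exact_mod_cast h
  choose e0 he0 hlt0 using hex
  have te0 : Tendsto e0 atTop (𝓝[>] (0 : ℝ)) := by
    refine tendsto_nhdsWithin_iff.2 ⟨?_, Eventually.of_forall fun n => (he0 n).1⟩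
    exact tendsto_of_tendsto_of_tendsto_of_le_of_le tendsto_const_nhds tendsto_one_div_add_atTop_nhds_zero_nat
      (fun n => (he0 n).1.le) fun n => (he0 n).2.le
  have e0le : ∀ n, e0 n ≤ 1 := fun n => (he0 n).2.le.trans
    (by rw [div_le_one (by positivity)]; linarith [Nat.cast_nonneg (α := ℝ) n])
  obtain ⟨τ₁, hτ₁, hτ₁'⟩ := strictMono_subseq_of_tendsto_atTop (tendsto_inv_nhdsGT_zero.comp te0)
  have compact : IsCompact ((Icc (-m) (c + m)) ×ˢ (Icc (-m) (c + m))) := isCompact_Icc.prod isCompact_Icc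
  obtain ⟨⟨α, β⟩, -, τ₂, hτ₂, hlim⟩ := compact.tendsto_subseq
    (x := fun n => (aE Ω D0 f0 (e0 (τ₁ n)) (u (e0 (τ₁ n))), bE Ω D0 f1 (e0 (τ₁ n)) (u (e0 (τ₁ n)))))
    (fun n => ⟨(key _ (he0 _).1 (e0le _)).2.2.1, (key _ (he0 _).1 (e0le _)).2.2.2.1⟩)
  obtain ⟨e, he⟩ : ∃ e : ℕ → ℝ, e = fun n => e0 (τ₁ (τ₂ n)) := ⟨_, rfl⟩
  have epos : ∀ n, 0 < e n := fun n => by rw [he]; exact (he0 _).1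
  have ele : ∀ n, e n ≤ 1 := fun n => by rw [he]; exact e0le _
  have eanti : StrictAnti e := by
    intro i j hij
    have h := hτ₁' (hτ₂ hij)
    simp only [Function.comp_apply] at h
    rw [he]
    exact (inv_lt_inv₀ (he0 _).1 (he0 _).1).1 h
  have ττ : Tendsto (fun n => τ₁ (τ₂ n)) atTop atTop := hτ₁.tendsto_atTop.comp hτ₂.tendsto_atTop
  have te : Tendsto e atTop (𝓝[>] (0 : ℝ)) := by rw [he]; exact te0.comp ττ
  have la : Tendsto (fun n => aE Ω D0 f0 (e n) (u (e n))) atTop (𝓝 α) := by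
    rw [he]; exact (continuous_fst.tendsto _).comp hlim
  have lb : Tendsto (fun n => bE Ω D0 f1 (e n) (u (e n))) atTop (𝓝 β) := by
    rw [he]; exact (continuous_snd.tendsto _).comp hlim
  have hαβ : α + β ≤ ℓ := by
    have t1 : Tendsto (fun n => ℓ + 1 / (((τ₁ (τ₂ n) : ℕ) : ℝ) + 1)) atTop (𝓝 (ℓ + 0)) :=
      tendsto_const_nhds.add (tendsto_one_div_add_atTop_nhds_zero_nat.comp ττ)
    rw [add_zero] at t1
    refine le_of_tendsto_of_tendsto' (la.add lb) t1 fun n => ?_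
    rw [he]
    exact (hlt0 _).le
  have zint : ∀ φ : Rd d → Vec N, ∫ x in Ω, dot ((0 : Rd d → Vec N) x) (φ x) = 0 := by
    intro φ; simp [dot_zero_left]
  obtain ⟨σ, hσ, g, gL, gf, g0, gU, gw, r, hr, hgr⟩ := seq_core hp hmu ha hl hL Ω D0 hset A hcr hE e epos ele
    (tendsto_nhdsWithin_iff.1 te).1 (fun n => u (e n)) (fun n => (key _ (epos n) (ele n)).1.1)
    (fun n => (key _ (epos n) (ele n)).1.2) hBt (fun n => (key _ (epos n) (ele n)).2.2.2.2.1)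
    (fun n => (key _ (epos n) (ele n)).2.2.2.2.2)
    (fun φ hφ => by
      have := (hu0 φ hφ).comp te
      rw [zint] at this
      exact this)
    (fun n => f0 (e n)) (fun n => h1.1 _ (epos n)) (fun n ξ => h3a _ (epos n) ξ) (fun n ξ ζ => h4a _ (epos n) ξ ζ)
  obtain ⟨s, hs⟩ : ∃ s : ℕ → ℝ, s = fun n => e (σ n) := ⟨_, rfl⟩
  have spos : ∀ n, 0 < s n := fun n => by rw [hs]; exact epos _
  have santi : StrictAnti s := by rw [hs]; exact fun i j hij => eanti (hσ hij)
  have ts : Tendsto s atTop (𝓝[>] (0 : ℝ)) := by rw [hs]; exact te.comp hσ.tendsto_atTop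
  obtain ⟨vt, hvt⟩ : ∃ vt : ℝ → Rd d → Vec N, vt = fun ε =>
    if h : ∃ n, s n = ε then ε⁻¹ • g h.choose else 0 := ⟨_, rfl⟩
  have vts : ∀ n, vt (s n) = (s n)⁻¹ • g n := by
    intro n
    have hx : ∃ k, s k = s n := ⟨n, rfl⟩
    have h2 : hx.choose = n := santi.injective hx.choose_spec
    rw [hvt]
    simp only [dif_pos hx, h2]
  have vt0 : ∀ ε, (¬ ∃ n, s n = ε) → vt ε = 0 := by
    intro ε h
    rw [hvt]
    simp only [dif_neg h]
  have svt : ∀ n x, s n • vt (s n) x = g n x := by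
    intro n x
    rw [vts, Pi.smul_apply, smul_smul, mul_inv_cancel₀ (spos n).ne', one_smul]
  have vtL : ∀ ε : ℝ, MemLpOn p Ω (vt ε) := by
    intro ε
    by_cases h : ∃ n, s n = ε
    · obtain ⟨n, rfl⟩ := h
      rw [vts]
      exact MemLp.const_smul (gL n) _
    · rw [vt0 ε h]; exact MemLp.zero
  have vtf : ∀ ε : ℝ, AFreeOn A Ω (vt ε) := by
    intro ε
    by_cases h : ∃ n, s n = ε
    · obtain ⟨n, rfl⟩ := h
      rw [vts]
      exact (gf n).smul _
    · rw [vt0 ε h]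
      intro ψ _
      exact zint _
  refine ⟨vt, fun ε _ => vtL ε, ?_, ?_, fun ε _ => vtf ε, ?_, ?_⟩
  · intro η hη
    obtain ⟨δ, hδ, h⟩ := pequi_of_unif hp gL gU η hη
    refine ⟨δ, hδ, fun ε S hS hSΩ hvol => ?_⟩
    by_cases hx : ∃ n, s n = ε.1
    · obtain ⟨n, hn⟩ := hx
      beta_reduce
      rw [← hn]
      simp only [svt]
      exact h n S hS hSΩ hvol
    · simp only [vt0 _ hx, Pi.zero_apply, smul_zero, eN_zero, Real.zero_rpow hp0.ne', integral_zero]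
      exact hη
  · intro ε _
    by_cases hx : ∃ n, s n = ε
    · obtain ⟨n, rfl⟩ := hx
      rw [vts]
      have := g0 n
      rw [hs]
      filter_upwards [this] with x hx
      rw [Pi.smul_apply, hx, smul_zero]
    · rw [vt0 ε hx]; exact Eventually.of_forall fun x => rfl
  · intro φ hφ
    rw [zint, Metric.tendsto_nhds]
    intro η hη
    obtain ⟨n0, hn0⟩ := eventually_atTop.1 (Metric.tendsto_nhds.1 (gw φ hφ) η hη)
    filter_upwards [evlt (s n0) (spos n0)] with ε hε
    by_cases hx : ∃ n, s n = ε
    · obtain ⟨n, rfl⟩ := hx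
      simp only [svt]
      exact hn0 n (santi.lt_iff_gt.1 hε.2).le
    · simp only [vt0 _ hx, Pi.zero_apply, smul_zero, dot_zero_left, integral_zero, dist_self]
      exact hη
  · have lA : Filter.liminf (fun ε => F0eps p A Ω D0 f0 ε (vt ε)) (𝓝[>] (0 : ℝ)) ≤ (α : EReal) := by
      have t1 : Tendsto (fun n => ((aE Ω D0 f0 (s n) (u (s n)) + r n : ℝ) : EReal)) atTop (𝓝 ((α + 0 : ℝ) : EReal)) := by
        refine (continuous_coe_real_ereal.tendsto _).comp (Tendsto.add ?_ hr)
        rw [hs]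
        exact la.comp hσ.tendsto_atTop
      rw [add_zero] at t1
      rw [← t1.liminf_eq]
      refine (liminf_le_liminf_of_le (g := map s atTop) ts).trans ?_
      rw [show Filter.liminf (fun ε => F0eps p A Ω D0 f0 ε (vt ε)) (map s atTop)
        = Filter.liminf (fun n => F0eps p A Ω D0 f0 (s n) (vt (s n))) atTop from rfl]
      refine liminf_le_liminf (Eventually.of_forall fun n => ?_)
      unfold F0eps
      rw [if_pos (show vt (s n) ∈ U1 p A Ω from ⟨vtL _, vtf _⟩)]
      simp only [svt]
      rw [EReal.coe_le_coe_iff, hs]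
      exact hgr n
    have lB : Filter.liminf (fun ε => F1eps p A Ω D0 f1 ε (ut ε)) (𝓝[>] (0 : ℝ)) ≤ (β : EReal) := by
      have t1 : Tendsto (fun n => ((bE Ω D0 f1 (e n) (u (e n)) : ℝ) : EReal)) atTop (𝓝 (β : EReal)) :=
        (continuous_coe_real_ereal.tendsto _).comp lb
      rw [← t1.liminf_eq]
      refine (liminf_le_liminf_of_le (g := map e atTop) te).trans ?_
      rw [show Filter.liminf (fun ε => F1eps p A Ω D0 f1 ε (ut ε)) (map e atTop)
        = Filter.liminf (fun n => F1eps p A Ω D0 f1 (e n) (ut (e n))) atTop from rfl]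
      refine liminf_le_liminf (Eventually.of_forall fun n => le_of_eq ?_)
      unfold F1eps
      rw [if_pos (show ut (e n) ∈ U1 p A Ω from hut _ (epos n))]
      congr 1
      refine integral_congr_ae ?_
      filter_upwards [heq _ (epos n)] with x hx
      rw [hx]
    rw [hℓ]
    refine (add_le_add lA lB).trans ?_
    exact_mod_cast hαβ

end HC
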